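/- arXiv:2302.13119 — 12 statements merged into one kernel-verified Lean document; each statement's English description precedes it below -/
import Mathlib

section
/- Let (G, k) be a weakly reversible mass-action system with vertices y_1, …, y_m ∈ ℝ^n, positive rate constants k, stoichiometric subspace S, and net reaction vectors w_1, …, w_m. Then the image (column span) of the matrix of net reaction vectors W = (w_1, w_2, …, w_m) equals S, i.e., Im(W) = S. -/
open Finset

/-- For a weakly reversible mass-action system `(G, k)` with vertices
`y 1, …, y m ∈ ℝ^n`, positive rate constants `k`, stoichiometric subspace `S`, and net
reaction vectors `w 1, …, w m`, the column span of the matrix of net reaction vectors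
equals `S`, i.e. `Im(W) = S`. -/
theorem span_net_reaction_vectors_eq_stoichiometric_subspace
    {n m : ℕ} (y : Fin m → Fin n → ℝ) (hy : Function.Injective y)
    (E : Fin m → Fin m → Prop) [DecidableRel E]
    (hE_noself : ∀ i, ¬ E i i)
    (hE_noiso : ∀ i, ∃ j, E i j ∨ E j i)
    (hwr : ∀ i j, E i j → Relation.ReflTransGen E j i)
    (k : Fin m → Fin m → ℝ) (hk : ∀ i j, E i j → 0 < k i j)
    (w : Fin m → Fin n → ℝ)
    (hw : ∀ i, w i = ∑ j ∈ Finset.univ.filter (fun j => E i j), k i j • (y j - y i))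
    (S : Submodule ℝ (Fin n → ℝ))
    (hS : S = Submodule.span ℝ {d | ∃ i j, E i j ∧ d = y j - y i}) :
    Submodule.span ℝ (Set.range w) = S := by
  subst hS
  apply le_antisymm
  · rw [Submodule.span_le]
    rintro _ ⟨i, rfl⟩
    rw [SetLike.mem_coe, hw i]
    refine Submodule.sum_mem _ fun j hj => Submodule.smul_mem _ _ (Submodule.subset_span ?_)
    exact ⟨i, j, (Finset.mem_filter.mp hj).2, rfl⟩
  · rw [Submodule.span_le]
    rintro _ ⟨i, j, hij, rfl⟩
    by_contra hnot
    obtain ⟨f, hf, hker⟩ := Submodule.exists_le_ker_of_notMem hnot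
    have hharm : ∀ v, ∑ u ∈ Finset.univ.filter (fun u => E v u),
        k v u * (f (y u) - f (y v)) = 0 := by
      intro v
      have h : f (w v) = 0 := hker (Submodule.subset_span ⟨v, rfl⟩)
      rw [hw v, map_sum] at h
      simpa using h
    have hsymm : ∀ a b, Relation.ReflTransGen E a b → Relation.ReflTransGen E b a := by
      intro a b h
      induction h with
      | refl => exact Relation.ReflTransGen.refl
      | tail _ hbc ih => exact (hwr _ _ hbc).trans ih
    classical
    obtain ⟨v, hv, hmax⟩ := Finset.exists_max_image
      (Finset.univ.filter (fun v => Relation.ReflTransGen E i v)) (fun v => f (y v))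
      ⟨i, by simp [Relation.ReflTransGen.refl]⟩
    have hiv : Relation.ReflTransGen E i v := (Finset.mem_filter.mp hv).2
    have hmax' : ∀ u, Relation.ReflTransGen E i u → f (y u) ≤ f (y v) := fun u hu =>
      hmax u (by simpa using hu)
    have hconst : ∀ u, Relation.ReflTransGen E v u → f (y u) = f (y v) := by
      intro u hu
      induction hu with
      | refl => rfl
      | @tail b c hvb hbc ih =>
        have hz := (Finset.sum_eq_zero_iff_of_nonpos (fun u hu => by
          have hbu : E b u := (Finset.mem_filter.mp hu).2
          have h1 := hmax' u ((hiv.trans hvb).tail hbu)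
          exact mul_nonpos_of_nonneg_of_nonpos (hk b u hbu).le (by linarith))).mp (hharm b) c
          (by simpa using hbc)
        rcases mul_eq_zero.mp hz with h | h
        · exact absurd h (hk b c hbc).ne'
        · linarith
    have h1 := hconst i (hsymm _ _ hiv)
    have h2 := hconst j ((hsymm _ _ hiv).tail hij)
    apply hf
    rw [map_sub, h1, h2, sub_self]
end

section
/- Let (G, k) be a weakly reversible mass-action system with vertices y_1, …, y_m ∈ ℝ^n, positive rate constants k, stoichiometric subspace S, and net reaction vectors w_1, …, w_m. Then for every nonzero vector v ∈ S there exists an index i ∈ {1, …, m} such that ⟨v, w_i⟩ < 0. -/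
open Finset Matrix

/-- For a weakly reversible mass-action system `(G, k)` with vertices
`y 1, …, y m ∈ ℝ^n`, positive rate constants `k`, stoichiometric subspace `S`, and net
reaction vectors `w 1, …, w m`: every nonzero vector `v ∈ S` satisfies `⟨v, w i⟩ < 0`
for some index `i`. -/
theorem exists_net_reaction_vector_neg_inner
    {n m : ℕ} (y : Fin m → Fin n → ℝ) (hy : Function.Injective y)
    (E : Fin m → Fin m → Prop) [DecidableRel E]
    (hE_noself : ∀ i, ¬ E i i)
    (hE_noiso : ∀ i, ∃ j, E i j ∨ E j i)
    (hwr : ∀ i j, E i j → Relation.ReflTransGen E j i)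
    (k : Fin m → Fin m → ℝ) (hk : ∀ i j, E i j → 0 < k i j)
    (w : Fin m → Fin n → ℝ)
    (hw : ∀ i, w i = ∑ j ∈ Finset.univ.filter (fun j => E i j), k i j • (y j - y i))
    (S : Submodule ℝ (Fin n → ℝ))
    (hS : S = Submodule.span ℝ {d | ∃ i j, E i j ∧ d = y j - y i}) :
    ∀ v ∈ S, v ≠ 0 → ∃ i : Fin m, v ⬝ᵥ w i < 0 := by
  intro v hv hv0
  by_contra! hneg
  -- the function `f i = v ⬝ᵥ y i` is constant along edges
  have hsymm : ∀ i j, Relation.ReflTransGen E i j → Relation.ReflTransGen E j i := by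
    intro i j h
    induction h with
    | refl => exact Relation.ReflTransGen.refl
    | tail _ hbc ih => exact (hwr _ _ hbc).trans ih
  have hwi : ∀ i, v ⬝ᵥ w i
      = ∑ j ∈ Finset.univ.filter (fun j => E i j), k i j * (v ⬝ᵥ y j - v ⬝ᵥ y i) := by
    intro i
    rw [hw i, dotProduct_sum]
    refine Finset.sum_congr rfl fun j _ => ?_
    rw [dotProduct_smul, dotProduct_sub, smul_eq_mul]
  have hconst : ∀ a b, E a b → v ⬝ᵥ y b = v ⬝ᵥ y a := by
    intro a b hab
    obtain ⟨p, hp, hmax⟩ := Set.exists_max_image {j | Relation.ReflTransGen E a j}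
      (fun j => v ⬝ᵥ y j) (Set.toFinite _) ⟨a, Relation.ReflTransGen.refl⟩
    have hp' : Relation.ReflTransGen E a p := hp
    have hall : ∀ j, Relation.ReflTransGen E p j → v ⬝ᵥ y j = v ⬝ᵥ y p := by
      intro j h
      induction h with
      | refl => rfl
      | @tail c d hpc hcd ih =>
        have hle : ∀ j ∈ Finset.univ.filter (fun j => E c j),
            k c j * (v ⬝ᵥ y j - v ⬝ᵥ y c) ≤ 0 := by
          intro j hj
          have hcj : E c j := (Finset.mem_filter.mp hj).2
          have h1 : v ⬝ᵥ y j ≤ v ⬝ᵥ y p := hmax j ((hp'.trans hpc).tail hcj)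
          exact mul_nonpos_of_nonneg_of_nonpos (hk c j hcj).le (by linarith)
        have h0 : ∑ j ∈ Finset.univ.filter (fun j => E c j),
            k c j * (v ⬝ᵥ y j - v ⬝ᵥ y c) = 0 :=
          le_antisymm (Finset.sum_nonpos hle) (by rw [← hwi]; exact hneg c)
        have h2 := (Finset.sum_eq_zero_iff_of_nonpos hle).mp h0 d
          (Finset.mem_filter.mpr ⟨Finset.mem_univ _, hcd⟩)
        have h3 := (mul_eq_zero.mp h2).resolve_left (hk c d hcd).ne'
        linarith
    have hpa := hsymm a p hp'
    rw [hall a hpa, hall b (hpa.tail hab)]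
  have horth : ∀ u ∈ S, v ⬝ᵥ u = 0 := by
    intro u hu
    rw [hS] at hu
    induction hu using Submodule.span_induction with
    | mem x hx =>
      obtain ⟨i, j, hij, rfl⟩ := hx
      rw [dotProduct_sub, hconst i j hij, sub_self]
    | zero => simp
    | add x z _ _ hx hz => rw [dotProduct_add, hx, hz, add_zero]
    | smul c x _ hx => rw [dotProduct_smul, hx, smul_zero]
  exact hv0 (dotProduct_self_eq_zero.mp (horth v hv))
end

section
/- Let G be a finite directed graph on vertex set {1, …, m} with no self-loops, equipped with positive rate constants k_{ij} on its edges i → j, and let A_k be its Kirchhoff matrix. Let T_1, …, T_t be the terminal strongly connected components of G. Then there exists a basis {e_1, …, e_t} of ker(A_k) such that for each p ∈ {1, …, t}: (e_p)_i > 0 if vertex i belongs to T_p, and (e_p)_i = 0 otherwise. In particular, dim ker(A_k) = t. -/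
open Finset Matrix

/-- The Kirchhoff matrix of a finite directed graph on `Fin m` (edge relation `E`, no
self-loops) with rate constants `k` on the edges: `[A_k]_{ji} = k i j` if `i → j` is an
edge, `[A_k]_{ii} = -∑_{i→j} k i j`, and `0` otherwise. -/
def kirchhoffMatrix {m : ℕ} (E : Fin m → Fin m → Prop) [DecidableRel E]
    (k : Fin m → Fin m → ℝ) : Matrix (Fin m) (Fin m) ℝ :=
  Matrix.of fun j i =>
    if i = j then -(∑ j' ∈ Finset.univ.filter (fun j' => E i j'), k i j')
    else if E i j then k i j else 0

/-- `T` is a terminal strongly connected component of the directed graph with edge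
relation `E`: it is nonempty, any two of its vertices are mutually reachable, it is
maximal with this property, and every edge starting in `T` ends in `T`. -/
def IsTerminalSCC {m : ℕ} (E : Fin m → Fin m → Prop) (T : Set (Fin m)) : Prop :=
  T.Nonempty ∧
  (∀ a ∈ T, ∀ b ∈ T, Relation.ReflTransGen E a b) ∧
  (∀ a ∈ T, ∀ b, Relation.ReflTransGen E a b → Relation.ReflTransGen E b a → b ∈ T) ∧
  (∀ a ∈ T, ∀ b, E a b → b ∈ T)


/-- Balance equations. -/
def KBal {m : ℕ} (w : Fin m → Fin m → ℝ) (x : Fin m → ℝ) : Prop :=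
  ∀ j, ∑ i, w i j * x i = ∑ i, w j i * x j

theorem kbal_iff {m : ℕ} (E : Fin m → Fin m → Prop) [DecidableRel E]
    (hE : ∀ i, ¬ E i i) (k : Fin m → Fin m → ℝ) (x : Fin m → ℝ) :
    x ∈ LinearMap.ker (kirchhoffMatrix E k).mulVecLin ↔
      KBal (fun i j => if E i j then k i j else 0) x := by
  rw [LinearMap.mem_ker, Matrix.mulVecLin_apply, funext_iff]
  unfold KBal
  refine forall_congr' fun j => ?_
  have h : ((kirchhoffMatrix E k) *ᵥ x) j =
      ∑ i, (if E i j then k i j else 0) * x i - ∑ i, (if E j i then k j i else 0) * x j := by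
    have h2 : ∀ i, kirchhoffMatrix E k j i * x i =
        (if E i j then k i j else 0) * x i -
          (if i = j then (∑ i, (if E j i then k j i else 0) * x j) else 0) := by
      intro i
      by_cases hij : i = j
      · subst hij
        simp [kirchhoffMatrix, hE, Finset.sum_filter, Finset.sum_mul]
      · simp [kirchhoffMatrix, hij]
    simp only [Matrix.mulVec, dotProduct]
    rw [Finset.sum_congr rfl (fun i _ => h2 i), Finset.sum_sub_distrib]
    simp
  rw [h, Pi.zero_apply, sub_eq_zero]

theorem kbal_abs {m : ℕ} {w : Fin m → Fin m → ℝ} (hw : ∀ i j, 0 ≤ w i j)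
    {x : Fin m → ℝ} (hx : KBal w x) : KBal w (fun i => |x i|) := by
  have hle : ∀ j ∈ (Finset.univ : Finset (Fin m)),
      ∑ i, w j i * |x j| ≤ ∑ i, w i j * |x i| := by
    intro j _
    have h1 : ∑ i, w j i * |x j| = |∑ i, w j i * x j| := by
      rw [← Finset.sum_mul, ← Finset.sum_mul, abs_mul,
        abs_of_nonneg (Finset.sum_nonneg fun i _ => hw j i)]
    rw [h1, ← hx j]
    refine (Finset.abs_sum_le_sum_abs _ _).trans (le_of_eq ?_)
    refine Finset.sum_congr rfl fun i _ => ?_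
    rw [abs_mul, abs_of_nonneg (hw i j)]
  have heq : ∑ j, ∑ i, w j i * |x j| = ∑ j, ∑ i, w i j * |x i| := Finset.sum_comm
  intro j
  exact (((Finset.sum_eq_sum_iff_of_le hle).1 heq) j (Finset.mem_univ j)).symm

theorem kbal_step {m : ℕ} {w : Fin m → Fin m → ℝ} (hw : ∀ i j, 0 ≤ w i j)
    {y : Fin m → ℝ} (hy : KBal w y) (hy0 : ∀ i, 0 ≤ y i) {a b : Fin m}
    (ha : 0 < y a) (hab : 0 < w a b) : 0 < y b := by
  refine lt_of_le_of_ne (hy0 b) fun hb => ?_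
  have h := hy b
  rw [← hb] at h
  simp only [mul_zero, Finset.sum_const_zero] at h
  rw [Finset.sum_eq_zero_iff_of_nonneg (fun i _ => mul_nonneg (hw i b) (hy0 i))] at h
  exact (mul_pos hab ha).ne' (h a (Finset.mem_univ a))

theorem kbal_cross {m : ℕ} {w : Fin m → Fin m → ℝ} (hw : ∀ i j, 0 ≤ w i j)
    {y : Fin m → ℝ} (hy : KBal w y) (hy0 : ∀ i, 0 ≤ y i) (S : Finset (Fin m))
    (hS : ∀ i ∈ S, ∀ j, j ∉ S → w i j = 0) {a b : Fin m}
    (ha : 0 < y a) (hab : 0 < w a b) (hb : b ∈ S) : a ∈ S := by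
  by_contra haS
  have h1 : ∑ j ∈ S, ∑ i, w i j * y i = ∑ j ∈ S, ∑ i, w j i * y j :=
    Finset.sum_congr rfl fun j _ => hy j
  have h2 : ∑ j ∈ S, ∑ i, w j i * y j = ∑ j ∈ S, ∑ i ∈ S, w j i * y j := by
    refine Finset.sum_congr rfl fun j hj => ?_
    refine (Finset.sum_subset (Finset.subset_univ S) fun i _ hi => ?_).symm
    rw [hS j hj i hi, zero_mul]
  have h3 : ∑ j ∈ S, ∑ i ∈ S, w j i * y j = ∑ j ∈ S, ∑ i ∈ S, w i j * y i := Finset.sum_comm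
  have h4 : ∑ j ∈ S, ∑ i ∈ S, w i j * y i < ∑ j ∈ S, ∑ i, w i j * y i := by
    refine Finset.sum_lt_sum (fun j _ => ?_) ⟨b, hb, ?_⟩
    · exact Finset.sum_le_sum_of_subset_of_nonneg (Finset.subset_univ S)
        fun i _ _ => mul_nonneg (hw i j) (hy0 i)
    · exact Finset.sum_lt_sum_of_subset (Finset.subset_univ S) (Finset.mem_univ a) haS
        (mul_pos hab ha) fun i _ _ => mul_nonneg (hw i b) (hy0 i)
  linarith

theorem kbal_reach {m : ℕ} {E : Fin m → Fin m → Prop} {w : Fin m → Fin m → ℝ}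
    (hw : ∀ i j, 0 ≤ w i j) (hE : ∀ i j, E i j → 0 < w i j)
    {y : Fin m → ℝ} (hy : KBal w y) (hy0 : ∀ i, 0 ≤ y i) {a b : Fin m}
    (ha : 0 < y a) (hab : Relation.ReflTransGen E a b) : 0 < y b := by
  induction hab with
  | refl => exact ha
  | tail _ h ih => exact kbal_step hw hy hy0 ih (hE _ _ h)

theorem kbal_back {m : ℕ} {E : Fin m → Fin m → Prop} {w : Fin m → Fin m → ℝ}
    (hw : ∀ i j, 0 ≤ w i j) (hE : ∀ i j, E i j → 0 < w i j) (hE0 : ∀ i j, ¬ E i j → w i j = 0)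
    {y : Fin m → ℝ} (hy : KBal w y) (hy0 : ∀ i, 0 ≤ y i) {a b : Fin m}
    (ha : 0 < y a) (hab : Relation.ReflTransGen E a b) : Relation.ReflTransGen E b a := by
  classical
  induction hab with
  | refl => exact Relation.ReflTransGen.refl
  | @tail c d hc h ih =>
    have hcpos := kbal_reach hw hE hy hy0 ha hc
    have := kbal_cross hw hy hy0 (Finset.univ.filter fun v => Relation.ReflTransGen E d v)
      (by
        intro i hi j hj
        simp only [Finset.mem_filter, Finset.mem_univ, true_and] at hi hj
        exact hE0 i j fun hij => hj (hi.tail hij))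
      hcpos (hE _ _ h) (by simp [Relation.ReflTransGen.refl])
    simp only [Finset.mem_filter, Finset.mem_univ, true_and] at this
    exact this.trans ih

theorem kbal_exists {m : ℕ} {E : Fin m → Fin m → Prop} {w : Fin m → Fin m → ℝ}
    (hw : ∀ i j, 0 ≤ w i j) (hE : ∀ i j, E i j → 0 < w i j) (hE0 : ∀ i j, ¬ E i j → w i j = 0)
    {T : Set (Fin m)} (hT : IsTerminalSCC E T) :
    ∃ y : Fin m → ℝ, KBal w y ∧ ∀ i, (i ∈ T → 0 < y i) ∧ (i ∉ T → y i = 0) := by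
  classical
  obtain ⟨⟨r, hr⟩, hconn, -, hclosed⟩ := hT
  have hout : ∀ i ∈ T, ∀ j, j ∉ T → w i j = 0 := fun i hi j hj =>
    hE0 i j fun hij => hj (hclosed i hi j hij)
  let B : Matrix T T ℝ := Matrix.of fun j i =>
    w i j - if i = j then ∑ l : T, w i l else 0
  have hB : ∃ v : T → ℝ, v ≠ 0 ∧ B *ᵥ v = 0 := by
    rw [Matrix.exists_mulVec_eq_zero_iff, ← Matrix.exists_vecMul_eq_zero_iff]
    refine ⟨fun _ => 1, fun h => one_ne_zero (congrFun h ⟨r, hr⟩), ?_⟩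
    funext i
    simp [Matrix.vecMul, dotProduct, B, Finset.sum_sub_distrib]
  obtain ⟨v, hv0, hv⟩ := hB
  let x : Fin m → ℝ := fun i => if h : i ∈ T then v ⟨i, h⟩ else 0
  have hxT : ∀ i : T, x i = v i := fun i => by simp [x]
  have hxN : ∀ i, i ∉ T → x i = 0 := fun i hi => by simp [x, hi]
  have hsum : ∀ f : Fin m → ℝ, (∀ i, i ∉ T → f i = 0) → ∑ i, f i = ∑ i : T, f i := by
    intro f hf
    rw [← Finset.sum_subset (Finset.subset_univ (Finset.univ.filter (· ∈ T)))
      (fun i _ hi => hf i (by simpa using hi))]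
    exact Finset.sum_subtype _ (by simp) f
  have hx : KBal w x := by
    intro j
    by_cases hj : j ∈ T
    · have h := congrFun hv ⟨j, hj⟩
      simp only [Matrix.mulVec, dotProduct, B, Matrix.of_apply, sub_mul,
        Finset.sum_sub_distrib, ite_mul, zero_mul, Finset.sum_ite_eq', Finset.mem_univ,
        if_true, Pi.zero_apply] at h
      rw [hsum _ (fun i hi => by rw [hxN i hi, mul_zero]),
        hsum _ (fun i hi => by rw [hout j hj i hi, zero_mul]), ← Finset.sum_mul]
      have := hxT ⟨j, hj⟩
      simp only [hxT] at this ⊢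
      rw [this]
      linarith
    · rw [hxN j hj]
      simp only [mul_zero, Finset.sum_const_zero]
      refine Finset.sum_eq_zero fun i _ => ?_
      by_cases hi : i ∈ T
      · rw [hout i hi j hj, zero_mul]
      · rw [hxN i hi, mul_zero]
  obtain ⟨a, ha⟩ := Function.ne_iff.1 hv0
  refine ⟨fun i => |x i|, kbal_abs hw hx, fun i => ⟨fun hi => ?_, fun hi => ?_⟩⟩
  · refine kbal_reach hw hE (kbal_abs hw hx) (fun _ => abs_nonneg _) (a := a) ?_
      (hconn a a.2 i hi)
    simpa [hxT] using ha
  · simp [hxN i hi]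

theorem terminalSCC_of_back {m : ℕ} {E : Fin m → Fin m → Prop} {a : Fin m}
    (h : ∀ b, Relation.ReflTransGen E a b → Relation.ReflTransGen E b a) :
    IsTerminalSCC E {v | Relation.ReflTransGen E a v} :=
  ⟨⟨a, Relation.ReflTransGen.refl⟩, fun c hc d hd => (h c hc).trans hd,
    fun c hc d hd _ => Relation.ReflTransGen.trans hc hd,
    fun c hc d hd => Relation.ReflTransGen.tail hc hd⟩

theorem terminalSCC_eq {m : ℕ} {E : Fin m → Fin m → Prop} {S T : Set (Fin m)}
    (hS : IsTerminalSCC E S) (hT : IsTerminalSCC E T) {r : Fin m} (h1 : r ∈ S) (h2 : r ∈ T) :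
    S = T := by
  ext v
  exact ⟨fun hv => hT.2.2.1 r h2 v (hS.2.1 r h1 v hv) (hS.2.1 v hv r h1),
    fun hv => hS.2.2.1 r h1 v (hT.2.1 r h2 v hv) (hT.2.1 v hv r h2)⟩

/-- Let `G` be a finite directed graph on `{1, …, m}` with no self-loops
and positive rate constants `k` on its edges, with Kirchhoff matrix `A_k`. If
`T 1, …, T t` are (exactly) the terminal strongly connected components of `G`, then
`ker A_k` has a basis `e 1, …, e t` with `(e p) i > 0` for `i ∈ T p` and `(e p) i = 0`
otherwise; in particular `dim ker A_k = t`. -/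
theorem kirchhoff_kernel_basis_terminal_scc
    {m t : ℕ} (E : Fin m → Fin m → Prop) [DecidableRel E]
    (hE_noself : ∀ i, ¬ E i i)
    (k : Fin m → Fin m → ℝ) (hk : ∀ i j, E i j → 0 < k i j)
    (T : Fin t → Set (Fin m))
    (hT : ∀ p, IsTerminalSCC E (T p))
    (hTinj : Function.Injective T)
    (hTall : ∀ U : Set (Fin m), IsTerminalSCC E U → ∃ p, U = T p) :
    ∃ e : Fin t → (Fin m → ℝ),
      LinearIndependent ℝ e ∧
      Submodule.span ℝ (Set.range e) = LinearMap.ker (kirchhoffMatrix E k).mulVecLin ∧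
      (∀ p i, (i ∈ T p → 0 < e p i) ∧ (i ∉ T p → e p i = 0)) ∧
      Module.finrank ℝ (LinearMap.ker (kirchhoffMatrix E k).mulVecLin) = t := by
  classical
  have hw : ∀ i j, 0 ≤ (fun i j => if E i j then k i j else 0 : Fin m → Fin m → ℝ) i j := by
    intro i j
    by_cases h : E i j
    · simpa [h] using (hk i j h).le
    · simp [h]
  have hE : ∀ i j, E i j → 0 < (fun i j => if E i j then k i j else 0 : Fin m → Fin m → ℝ) i j := by
    intro i j h
    simpa [h] using hk i j h
  have hE0 : ∀ i j, ¬ E i j →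
      (fun i j => if E i j then k i j else 0 : Fin m → Fin m → ℝ) i j = 0 := by
    intro i j h
    simp [h]
  have hker := kbal_iff E hE_noself k
  generalize (fun i j => if E i j then k i j else 0 : Fin m → Fin m → ℝ) = w at hw hE hE0 hker
  choose e heB heT using fun p => kbal_exists hw hE hE0 (hT p)
  choose r hr using fun p => (hT p).1
  have hoff : ∀ p q, q ≠ p → e q (r p) = 0 := fun p q hqp =>
    (heT q (r p)).2 fun h => hqp (hTinj (terminalSCC_eq (hT q) (hT p) h (hr p)))
  have hpos : ∀ p, 0 < e p (r p) := fun p => (heT p (r p)).1 (hr p)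
  have heval : ∀ (c : Fin t → ℝ) p, (∑ q, c q • e q) (r p) = c p * e p (r p) := by
    intro c p
    rw [Finset.sum_apply, Finset.sum_eq_single p]
    · simp
    · intro q _ hq
      simp [hoff p q hq]
    · simp
  have hli : LinearIndependent ℝ e := by
    rw [Fintype.linearIndependent_iff]
    intro c hc p
    have h := heval c p
    rw [hc, Pi.zero_apply] at h
    exact (mul_eq_zero.1 h.symm).resolve_right (hpos p).ne'
  have hspan : Submodule.span ℝ (Set.range e) =
      LinearMap.ker (kirchhoffMatrix E k).mulVecLin := by
    have hle : Submodule.span ℝ (Set.range e) ≤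
        LinearMap.ker (kirchhoffMatrix E k).mulVecLin := by
      rw [Submodule.span_le]
      rintro _ ⟨p, rfl⟩
      exact (hker _).2 (heB p)
    refine le_antisymm hle fun x hx => ?_
    have hsm : ∑ q, (x (r q) / e q (r q)) • e q ∈ Submodule.span ℝ (Set.range e) :=
      Submodule.sum_mem _ fun q _ =>
        Submodule.smul_mem _ _ (Submodule.subset_span ⟨q, rfl⟩)
    have hy := kbal_abs hw ((hker _).1 (Submodule.sub_mem _ hx (hle hsm)))
    have hyr : ∀ p, (x - ∑ q, (x (r q) / e q (r q)) • e q) (r p) = 0 := by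
      intro p
      rw [Pi.sub_apply, heval, div_mul_cancel₀ _ (hpos p).ne', sub_self]
    have hzero : x - ∑ q, (x (r q) / e q (r q)) • e q = 0 := by
      by_contra hne
      obtain ⟨a, ha⟩ := Function.ne_iff.1 hne
      have hapos := abs_pos.2 ha
      obtain ⟨p, hp⟩ := hTall _ (terminalSCC_of_back (a := a) fun b hb =>
        kbal_back hw hE hE0 hy (fun _ => abs_nonneg _) hapos hb)
      have hrp : r p ∈ {v | Relation.ReflTransGen E a v} := hp ▸ hr p
      have h := kbal_reach hw hE hy (fun _ => abs_nonneg _) hapos hrp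
      rw [hyr p, abs_zero] at h
      exact lt_irrefl _ h
    rw [sub_eq_zero.1 hzero]
    exact hsm
  refine ⟨e, hli, hspan, heT, ?_⟩
  rw [← hspan, finrank_span_eq_card hli, Fintype.card_fin]
end

section
/- Let Q ∈ ℝ^{m×m} be a matrix with nonnegative off-diagonal entries and each column summing to zero, and let G be the directed graph on vertex set {1, …, m} with an edge i → j whenever i ≠ j and Q_{ji} > 0. If dim ker(Q) = 1 and ker(Q) contains a vector all of whose entries are nonzero, then G is strongly connected; that is, every vertex is reachable from every other vertex by a directed path (so G is weakly reversible and consists of a single linkage class). -/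
open Finset Matrix

theorem kirchhoff_mulVec_zero {m : ℕ} (Q : Matrix (Fin m) (Fin m) ℝ)
    (hcol : ∀ i : Fin m, ∑ j, Q j i = 0) (u : Fin m → ℝ)
    (h : ∀ j, 0 ≤ ∑ i, Q j i * u i) : ∀ j, ∑ i, Q j i * u i = 0 := by
  have hs : ∑ j, ∑ i, Q j i * u i = 0 := by
    rw [Finset.sum_comm]
    apply Finset.sum_eq_zero
    intro i _
    rw [← Finset.sum_mul, hcol, zero_mul]
  intro j
  exact (Finset.sum_eq_zero_iff_of_nonneg (fun j _ => h j)).1 hs j (Finset.mem_univ j)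

/-- Let `Q ∈ ℝ^{m×m}` have nonnegative off-diagonal entries and columns
summing to zero, and let `G` be the directed graph on `{1, …, m}` with an edge `i → j`
whenever `i ≠ j` and `Q j i > 0`. If `dim ker Q = 1` and `ker Q` contains a vector with
all entries nonzero, then `G` is strongly connected (i.e. weakly reversible with a single
linkage class). -/
theorem strongly_connected_of_kernel_dim_one_full_support
    {m : ℕ} (Q : Matrix (Fin m) (Fin m) ℝ)
    (hoff : ∀ i j : Fin m, i ≠ j → 0 ≤ Q j i)
    (hcol : ∀ i : Fin m, ∑ j, Q j i = 0)
    (hker : Module.finrank ℝ (LinearMap.ker Q.mulVecLin) = 1)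
    (hsupp : ∃ v ∈ LinearMap.ker Q.mulVecLin, ∀ i, v i ≠ 0) :
    ∀ i j : Fin m, Relation.ReflTransGen (fun a b => a ≠ b ∧ 0 < Q b a) i j := by
  classical
  obtain ⟨v, hv, hv0⟩ := hsupp
  have hv' : ∀ j, ∑ i, Q j i * v i = 0 := fun j => congrFun (LinearMap.mem_ker.1 hv) j
  -- the vector of absolute values is again in the kernel
  have hp : ∀ j, ∑ i, Q j i * |v i| = 0 := by
    apply kirchhoff_mulVec_zero Q hcol
    intro j
    obtain ⟨s, hs, hsj⟩ : ∃ s : ℝ, (∀ x : ℝ, s * x ≤ |x|) ∧ s * v j = |v j| := by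
      rcases le_total 0 (v j) with h | h
      · exact ⟨1, fun x => by simpa using le_abs_self x, by simp [abs_of_nonneg h]⟩
      · exact ⟨-1, fun x => by simpa using neg_le_abs x, by simp [abs_of_nonpos h]⟩
    calc (0 : ℝ) = s * ∑ i, Q j i * v i := by rw [hv', mul_zero]
      _ = ∑ i, Q j i * (s * v i) := by
        rw [Finset.mul_sum]
        exact Finset.sum_congr rfl fun i _ => by ring
      _ ≤ ∑ i, Q j i * |v i| := by
        apply Finset.sum_le_sum
        intro i _
        by_cases hij : i = j
        · subst hij
          rw [hsj]
        · exact mul_le_mul_of_nonneg_left (hs _) (hoff i j hij)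
  intro i₀ j₀
  by_contra hcon
  let S : Fin m → Prop := fun a =>
    Relation.ReflTransGen (fun a b => a ≠ b ∧ 0 < Q b a) i₀ a
  have hS0 : S i₀ := Relation.ReflTransGen.refl
  have hSj : ¬ S j₀ := hcon
  have hcl : ∀ a b, S a → ¬ S b → Q b a = 0 := by
    intro a b ha hb
    have hab : a ≠ b := by
      rintro rfl
      exact hb ha
    by_contra hne
    exact hb (Relation.ReflTransGen.tail ha
      ⟨hab, lt_of_le_of_ne (hoff a b hab) (Ne.symm hne)⟩)
  -- the restriction of the positive kernel vector to `S` is in the kernel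
  have hu : ∀ j, ∑ i, Q j i * (if S i then -|v i| else 0) = 0 := by
    apply kirchhoff_mulVec_zero Q hcol
    intro j
    by_cases hj : S j
    · calc (0 : ℝ) ≤ ∑ i, Q j i * (if S i then 0 else |v i|) := by
            apply Finset.sum_nonneg
            intro i _
            by_cases hi : S i
            · simp [hi]
            · have hij : i ≠ j := by
                rintro rfl
                exact hi hj
              simpa [hi] using mul_nonneg (hoff i j hij) (abs_nonneg (v i))
        _ = ∑ i, Q j i * (if S i then -|v i| else 0) + ∑ i, Q j i * |v i| := by
            rw [← Finset.sum_add_distrib]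
            refine Finset.sum_congr rfl fun i _ => ?_
            split_ifs <;> ring
        _ = _ := by rw [hp, add_zero]
    · apply le_of_eq
      symm
      apply Finset.sum_eq_zero
      intro i _
      by_cases hi : S i
      · simp [hcl i j hi hj]
      · simp [hi]
  let u : LinearMap.ker Q.mulVecLin :=
    ⟨fun i => if S i then -|v i| else 0, LinearMap.mem_ker.2 (funext hu)⟩
  let w : LinearMap.ker Q.mulVecLin := ⟨v, hv⟩
  have hw : w ≠ 0 := by
    intro h
    exact hv0 i₀ (congrFun (congrArg Subtype.val h) i₀)
  obtain ⟨c, hc⟩ := (finrank_eq_one_iff_of_nonzero' w hw).1 hker u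
  have hc' : ∀ i, c * v i = if S i then -|v i| else 0 :=
    fun i => congrFun (congrArg Subtype.val hc) i
  have h1 := hc' j₀
  rw [if_neg hSj] at h1
  have h2 := hc' i₀
  rw [if_pos hS0, (mul_eq_zero.1 h1).resolve_right (hv0 j₀), zero_mul] at h2
  exact hv0 i₀ (by simpa using h2.symm)
end

section
/- Let y_1, …, y_m ∈ ℝ^n be distinct points and w_1, …, w_m ∈ ℝ^n. Suppose the polynomial dynamical system ẋ = Σ_{i=1}^m x^{y_i} w_i admits a weakly reversible realization with a single linkage class on the vertices y_1, …, y_m; i.e., there exist a strongly connected directed graph E on {y_1, …, y_m} and positive rate constants k_{ij} on its edges such that w_i = Σ_{y_i→y_j ∈ E} k_{ij}(y_j − y_i) for every i. Then: (1) for each i there exists v ∈ ℝ^m_{≥0} with B_i v = w_i; and (2) the directed graph G_max on {y_1, …, y_m}, with an edge y_i → y_j whenever j ≠ i and there exists v ∈ ℝ^m_{≥0} with B_i v = w_i and v_j > 0, is strongly connected. -/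
open Finset

/-- Let `y 1, …, y m ∈ ℝ^n` be distinct and `w 1, …, w m ∈ ℝ^n`. If the
system `ẋ = ∑ i, x^{y i} • w i` admits a weakly reversible realization with a single
linkage class on these vertices (a strongly connected directed graph `E` with positive
rate constants `k` such that `w i = ∑_{y i → y j ∈ E} k i j • (y j - y i)`), then:
(1) for each `i` there exists a nonnegative `v` with `B_i v = w i`; and (2) the graph
`G_max` with an edge `y i → y j` whenever `j ≠ i` and some nonnegative `v` satisfies
`B_i v = w i` and `v j > 0`, is strongly connected. -/
theorem max_realization_strongly_connected_of_wr_single_linkage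
    {n m : ℕ} (y : Fin m → Fin n → ℝ) (hy : Function.Injective y)
    (w : Fin m → Fin n → ℝ)
    (E : Fin m → Fin m → Prop) [DecidableRel E]
    (hE_noself : ∀ i, ¬ E i i)
    (hconn : ∀ i j : Fin m, Relation.ReflTransGen E i j)
    (k : Fin m → Fin m → ℝ) (hk : ∀ i j, E i j → 0 < k i j)
    (hw : ∀ i, w i = ∑ j ∈ Finset.univ.filter (fun j => E i j), k i j • (y j - y i)) :
    (∀ i : Fin m, ∃ v : Fin m → ℝ, (∀ j, 0 ≤ v j) ∧ ∑ j, v j • (y j - y i) = w i) ∧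
    (∀ i j : Fin m, Relation.ReflTransGen
      (fun a b => b ≠ a ∧ ∃ v : Fin m → ℝ,
        (∀ j', 0 ≤ v j') ∧ (∑ j', v j' • (y j' - y a) = w a) ∧ 0 < v b) i j) := by
  have key : ∀ i, (∀ j, 0 ≤ (if E i j then k i j else 0)) ∧
      ∑ j, (if E i j then k i j else 0) • (y j - y i) = w i := by
    intro i
    refine ⟨fun j => ?_, ?_⟩
    · split_ifs with h
      · exact (hk i j h).le
      · exact le_rfl
    · rw [hw i, Finset.sum_filter]
      refine Finset.sum_congr rfl fun j _ => ?_
      split_ifs <;> simp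
  refine ⟨fun i => ⟨_, (key i).1, (key i).2⟩, fun i j => ?_⟩
  refine Relation.ReflTransGen.mono (fun a b hab => ?_) i j (hconn i j)
  refine ⟨?_, _, (key a).1, (key a).2, ?_⟩
  · rintro rfl
    exact hE_noself _ hab
  · simpa [hab] using hk a b hab
end

section
/- Let (G, k) be a weakly reversible mass-action system with m vertices y_1, …, y_m ∈ ℝ^n, a single linkage class, stoichiometric subspace S, and matrix of net reaction vectors W = (w_1, …, w_m). Then the deficiency of G satisfies δ = m − 1 − dim(Im(W)); that is, dim(Im(W)) = dim(S) and δ = m − 1 − dim(S). -/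
open Finset

/-- For a weakly reversible mass-action system `(G, k)` with `m`
vertices, a single linkage class (i.e. `G` strongly connected), stoichiometric subspace
`S` and matrix of net reaction vectors `W = (w 1, …, w m)`, the deficiency
`δ = m - 1 - dim S` satisfies `δ = m - 1 - dim (Im W)`; that is, `dim (Im W) = dim S`
and `δ = m - 1 - dim S`. -/
theorem deficiency_eq_via_net_reaction_vectors
    {n m : ℕ} (y : Fin m → Fin n → ℝ) (hy : Function.Injective y)
    (E : Fin m → Fin m → Prop) [DecidableRel E]
    (hE_noself : ∀ i, ¬ E i i)
    (hE_noiso : ∀ i, ∃ j, E i j ∨ E j i)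
    (hconn : ∀ i j : Fin m, Relation.ReflTransGen E i j)
    (k : Fin m → Fin m → ℝ) (hk : ∀ i j, E i j → 0 < k i j)
    (w : Fin m → Fin n → ℝ)
    (hw : ∀ i, w i = ∑ j ∈ Finset.univ.filter (fun j => E i j), k i j • (y j - y i))
    (S : Submodule ℝ (Fin n → ℝ))
    (hS : S = Submodule.span ℝ {d | ∃ i j, E i j ∧ d = y j - y i}) :
    Module.finrank ℝ (Submodule.span ℝ (Set.range w)) = Module.finrank ℝ S ∧
    m - 1 - Module.finrank ℝ S
      = m - 1 - Module.finrank ℝ (Submodule.span ℝ (Set.range w)) := by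
  have key : Submodule.span ℝ (Set.range w) = S := by
    apply le_antisymm
    · rw [Submodule.span_le]
      rintro _ ⟨i, rfl⟩
      rw [hw i, hS]
      refine Submodule.sum_mem _ fun j hj => Submodule.smul_mem _ _ (Submodule.subset_span ?_)
      exact ⟨i, j, (Finset.mem_filter.mp hj).2, rfl⟩
    · rw [hS, Submodule.span_le]
      rintro _ ⟨a, b, hab, rfl⟩
      by_contra hnot
      obtain ⟨f, hf, hle⟩ := Submodule.exists_le_ker_of_notMem hnot
      have hfw : ∀ i, f (w i) = 0 := fun i =>
        hle (Submodule.subset_span ⟨i, rfl⟩)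
      have : Nonempty (Fin m) := ⟨a⟩
      obtain ⟨i0, hi0⟩ := Finite.exists_max (fun i => f (y i))
      have hstep : ∀ i j, f (y i) = f (y i0) → E i j → f (y j) = f (y i0) := by
        intro i j hi hij
        have h0 := hfw i
        rw [hw i, map_sum] at h0
        have hnp : ∀ l ∈ Finset.univ.filter (fun l => E i l),
            f (k i l • (y l - y i)) ≤ 0 := by
          intro l hl
          rw [map_smul, map_sub, smul_eq_mul]
          have h1 := hk i l (Finset.mem_filter.mp hl).2
          have h2 := hi0 l
          exact mul_nonpos_of_nonneg_of_nonpos h1.le (by linarith)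
        have h3 := (Finset.sum_eq_zero_iff_of_nonpos hnp).mp h0 j (by simp [hij])
        rw [map_smul, map_sub, smul_eq_mul] at h3
        rcases mul_eq_zero.mp h3 with h | h
        · exact absurd h (hk i j hij).ne'
        · linarith
      have hall : ∀ j, f (y j) = f (y i0) := by
        intro j
        induction hconn i0 j with
        | refl => rfl
        | tail _ h ih => exact hstep _ _ ih h
      apply hf
      rw [map_sub, hall a, hall b, sub_self]
  rw [key]
  exact ⟨rfl, rfl⟩
end

section
/- Let G be a weakly reversible reaction network with a single linkage class L = {y_1, …, y_m} ⊂ ℝ^n and deficiency zero (equivalently, dim span{y_k − y_1 : 1 ≤ k ≤ m} = m − 1), equipped with positive rate constants k, and let w_1, …, w_m be its net reaction vectors. Then for each i ∈ {1, …, m} there exists a unique vector v ∈ ℝ^m_{≥0} such that B_i v = w_i and v_i = 1. -/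
open Finset

/-- Let `G` be a weakly reversible reaction network with a single
linkage class `L = {y 1, …, y m} ⊂ ℝ^n` (i.e. `G` strongly connected) and deficiency
zero (equivalently `dim span {y k - y 1} = m - 1`), with positive rate constants `k` and
net reaction vectors `w i`. Then for each `i` there is a unique vector `v ∈ ℝ^m_{≥0}`
with `B_i v = w i` and `v i = 1` (the `k`-th column of `B_i` being `y k - y i`). -/
theorem unique_realization_of_deficiency_zero_single_linkage
    {n m : ℕ} (hm : 0 < m) (y : Fin m → Fin n → ℝ) (hy : Function.Injective y)
    (E : Fin m → Fin m → Prop) [DecidableRel E]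
    (hE_noself : ∀ i, ¬ E i i)
    (hconn : ∀ i j : Fin m, Relation.ReflTransGen E i j)
    (hdef : Module.finrank ℝ
      (Submodule.span ℝ (Set.range fun j => y j - y ⟨0, hm⟩)) = m - 1)
    (k : Fin m → Fin m → ℝ) (hk : ∀ i j, E i j → 0 < k i j)
    (w : Fin m → Fin n → ℝ)
    (hw : ∀ i, w i = ∑ j ∈ Finset.univ.filter (fun j => E i j), k i j • (y j - y i)) :
    ∀ i : Fin m, ∃! v : Fin m → ℝ,
      (∀ j, 0 ≤ v j) ∧ (∑ j, v j • (y j - y i) = w i) ∧ v i = 1 := by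
  intro i
  have haff : AffineIndependent ℝ y := by
    rw [affineIndependent_iff_finrank_vectorSpan_eq ℝ y (n := m - 1) (by simp; omega),
      vectorSpan_range_eq_span_range_vsub_right ℝ y ⟨0, hm⟩]
    simpa only [vsub_eq_sub] using hdef
  have key : ∀ d : Fin m → ℝ, ∑ j, d j • (y j - y i) = 0 → ∀ j, j ≠ i → d j = 0 := by
    intro d hd j hj
    have h := (affineIndependent_iff (k := ℝ) (p := y)).1 haff Finset.univ
      (fun j => d j - (if j = i then ∑ l, d l else 0))
      (by simp [Finset.sum_sub_distrib])
      (by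
        simp only [smul_sub, Finset.sum_sub_distrib, ← Finset.sum_smul] at hd
        simpa [sub_smul, Finset.sum_sub_distrib, ite_smul] using hd)
      j (Finset.mem_univ j)
    simpa [hj] using h
  refine ⟨fun j => if j = i then 1 else if E i j then k i j else 0, ⟨?_, ?_, by simp⟩, ?_⟩
  · intro j
    dsimp only
    split_ifs with h1 h2
    · exact zero_le_one
    · exact (hk i j h2).le
    · exact le_rfl
  · rw [hw, Finset.sum_filter]
    refine Finset.sum_congr rfl fun j _ => ?_
    by_cases h1 : j = i
    · subst h1; simp
    · by_cases h2 : E i j <;> simp [h1, h2]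
  · rintro v ⟨_, hv, hvi⟩
    funext j
    by_cases h1 : j = i
    · subst h1; simp [hvi]
    · have h := key (fun j => v j - if E i j then k i j else 0) (by
        simp only [sub_smul, Finset.sum_sub_distrib]
        rw [hv, hw, Finset.sum_filter]
        simp [ite_smul]) j h1
      simp only [h1, if_false]
      exact sub_eq_zero.1 h
end

section
/- Every weakly reversible reaction network G = (V, E) in ℝ^n is endotactic: for every v ∈ ℝ^n and every edge y → y' ∈ E with v·(y' − y) < 0, there exists an edge ỹ → ŷ ∈ E such that v·(ŷ − ỹ) > 0 and v·ỹ < v·y. -/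
open Matrix

/-- Every weakly reversible reaction network `G = (V, E)` in `ℝ^n`
is endotactic: for every `v ∈ ℝ^n` and every edge `y → y'` with `v ⬝ (y' - y) < 0`,
there is an edge `ỹ → ŷ` with `v ⬝ (ŷ - ỹ) > 0` and `v ⬝ ỹ < v ⬝ y`. -/
theorem weakly_reversible_is_endotactic
    {n m : ℕ} (y : Fin m → Fin n → ℝ) (hy : Function.Injective y)
    (E : Fin m → Fin m → Prop)
    (hE_noself : ∀ i, ¬ E i i)
    (hE_noiso : ∀ i, ∃ j, E i j ∨ E j i)
    (hwr : ∀ i j, E i j → Relation.ReflTransGen E j i) :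
    ∀ v : Fin n → ℝ, ∀ i j : Fin m, E i j → v ⬝ᵥ (y j - y i) < 0 →
      ∃ a b : Fin m, E a b ∧ 0 < v ⬝ᵥ (y b - y a) ∧ v ⬝ᵥ y a < v ⬝ᵥ y i := by
  intro v i j hij hlt
  by_contra hcon
  have key : ∀ k, Relation.ReflTransGen E j k → v ⬝ᵥ y k < v ⬝ᵥ y i := by
    intro k hk
    induction hk with
    | refl =>
      rw [dotProduct_sub] at hlt
      linarith
    | tail _ hbc ih =>
      rename_i b c _
      by_contra hc
      refine hcon ⟨b, c, hbc, ?_, ih⟩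
      rw [dotProduct_sub]
      linarith
  exact lt_irrefl _ (key i (hwr i j hij))
end

section
/- Every weakly reversible reaction network G = (V, E) in ℝ^n consisting of a single linkage class is strongly endotactic: for every v ∈ ℝ^n and every edge y → y' ∈ E with v·(y' − y) < 0, there exists an edge ỹ → ŷ ∈ E such that v·(ŷ − ỹ) > 0, v·ỹ < v·y, and v·ỹ ≤ v·y* for every source vertex y* of G. -/
open Matrix

/-- Every weakly reversible reaction network `G = (V, E)` in `ℝ^n`
consisting of a single linkage class (i.e. strongly connected) is strongly endotactic:
for every `v ∈ ℝ^n` and every edge `y → y'` with `v ⬝ (y' - y) < 0`, there is an edge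
`ỹ → ŷ` with `v ⬝ (ŷ - ỹ) > 0`, `v ⬝ ỹ < v ⬝ y`, and `v ⬝ ỹ ≤ v ⬝ y*` for every
source vertex `y*` of `G`. -/
theorem weakly_reversible_single_linkage_is_strongly_endotactic
    {n m : ℕ} (y : Fin m → Fin n → ℝ) (hy : Function.Injective y)
    (E : Fin m → Fin m → Prop)
    (hE_noself : ∀ i, ¬ E i i)
    (hE_noiso : ∀ i, ∃ j, E i j ∨ E j i)
    (hconn : ∀ i j : Fin m, Relation.ReflTransGen E i j) :
    ∀ v : Fin n → ℝ, ∀ i j : Fin m, E i j → v ⬝ᵥ (y j - y i) < 0 →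
      ∃ a b : Fin m, E a b ∧ 0 < v ⬝ᵥ (y b - y a) ∧ v ⬝ᵥ y a < v ⬝ᵥ y i ∧
        ∀ s : Fin m, (∃ s', E s s') → v ⬝ᵥ y a ≤ v ⬝ᵥ y s := by
  intro v i j _ hlt
  rw [dotProduct_sub] at hlt
  have : Nonempty (Fin m) := ⟨i⟩
  obtain ⟨k, hk⟩ := Finite.exists_min (fun s : Fin m => v ⬝ᵥ y s)
  have hki : v ⬝ᵥ y k < v ⬝ᵥ y i := by
    have := hk j
    linarith
  by_contra hcon
  have key : ∀ s : Fin m, Relation.ReflTransGen E k s → v ⬝ᵥ y s = v ⬝ᵥ y k := by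
    intro s hs
    induction hs with
    | refl => rfl
    | @tail b c _ hbc ih =>
      by_contra hne
      have hc : v ⬝ᵥ y k < v ⬝ᵥ y c := lt_of_le_of_ne (hk c) (Ne.symm hne)
      refine hcon ⟨b, c, hbc, ?_, ?_, ?_⟩
      · rw [dotProduct_sub]
        linarith
      · linarith
      · intro t _
        rw [ih]
        exact hk t
  have := key i (hconn k i)
  linarith
end

section
/- Let (G, k) be a mass-action system whose reaction network G is weakly reversible, has a single linkage class with vertices y_1, …, y_m ∈ ℝ^n, and has deficiency zero (dim S = m − 1), with positive rate constants k. Then every stoichiometric compatibility class admits a globally attracting positive steady state: for every x_0 ∈ ℝ^n_{>0} there exists a point x̃ ∈ (x_0 + S) ∩ ℝ^n_{>0} such that Σ_{y_i→y_j ∈ E} k_{ij} x̃^{y_i}(y_j − y_i) = 0 and every solution x : [0, ∞) → ℝ^n_{>0} of dx/dt = Σ_{y_i→y_j ∈ E} k_{ij} x^{y_i}(y_j − y_i) with x(0) ∈ (x_0 + S) ∩ ℝ^n_{>0} satisfies lim_{t→∞} x(t) = x̃. -/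
open Finset Filter


lemma dz_kernel {ι : Type*} [Fintype ι] (K : ι → ι → ℝ) (hK0 : ∀ i j, 0 ≤ K i j)
    (E : ι → ι → Prop) (hE : ∀ i j, E i j → 0 < K i j)
    (hconn : ∀ i j, Relation.ReflTransGen E i j) :
    ∃ c : ι → ℝ, (∀ i, 0 < c i) ∧ ∀ j, ∑ i, K i j * c i = (∑ i, K j i) * c j := by
  classical
  rcases isEmpty_or_nonempty ι with h | ⟨⟨i0⟩⟩
  · exact ⟨fun _ => 1, fun i => by simp, fun j => h.elim j⟩
  let A : (ι → ℝ) →ₗ[ℝ] (ι → ℝ) :=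
    { toFun := fun v j => ∑ i, K i j * v i - (∑ i, K j i) * v j
      map_add' := by
        intro v w; ext j; simp only [Pi.add_apply, mul_add, Finset.sum_add_distrib]; ring
      map_smul' := by
        intro a v; ext j
        simp only [Pi.smul_apply, smul_eq_mul, RingHom.id_apply, mul_sub, Finset.mul_sum]
        congr 1
        · exact Finset.sum_congr rfl fun i _ => by ring
        · rw [Finset.sum_mul, Finset.sum_mul, Finset.mul_sum]
          exact Finset.sum_congr rfl fun i _ => by ring }
  have hsum : ∀ v : ι → ℝ, ∑ j, ∑ i, K i j * v i = ∑ j, (∑ i, K j i) * v j := by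
    intro v
    rw [Finset.sum_comm]
    exact Finset.sum_congr rfl fun i _ => by rw [Finset.sum_mul]
  have hA : ∀ v, ∑ j, A v j = 0 := by
    intro v
    change ∑ j, (∑ i, K i j * v i - (∑ i, K j i) * v j) = 0
    rw [Finset.sum_sub_distrib, hsum, sub_self]
  have hns : ¬ Function.Surjective A := by
    intro hs
    obtain ⟨v, hv⟩ := hs (Pi.single i0 1)
    have := hA v
    rw [hv] at this
    simp at this
  have hni : ¬ Function.Injective A := fun h => hns (LinearMap.injective_iff_surjective.1 h)
  obtain ⟨v, hv, hv0⟩ : ∃ v, A v = 0 ∧ v ≠ 0 := by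
    rw [injective_iff_map_eq_zero] at hni
    push Not at hni
    exact hni
  have hv' : ∀ j, ∑ i, K i j * v i = (∑ i, K j i) * v j := fun j => by
    have := congrFun hv j
    change ∑ i, K i j * v i - (∑ i, K j i) * v j = 0 at this
    linarith
  have hle : ∀ j ∈ (univ : Finset ι), (∑ i, K j i) * |v j| ≤ ∑ i, K i j * |v i| := by
    intro j _
    have h1 : (∑ i, K j i) * |v j| = |∑ i, K i j * v i| := by
      rw [hv' j, abs_mul, abs_of_nonneg (Finset.sum_nonneg fun i _ => hK0 j i)]
    rw [h1]
    refine (Finset.abs_sum_le_sum_abs _ _).trans (le_of_eq ?_)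
    exact Finset.sum_congr rfl fun i _ => by rw [abs_mul, abs_of_nonneg (hK0 i j)]
  have heq := (Finset.sum_eq_sum_iff_of_le hle).1 (hsum fun i => |v i|).symm
  refine ⟨fun i => |v i|, ?_, fun j => (heq j (mem_univ j)).symm⟩
  by_contra hcon
  push Not at hcon
  obtain ⟨j, hj⟩ := hcon
  have hj0 : v j = 0 := by simpa using hj
  apply hv0
  have hstep : ∀ i j, E i j → v j = 0 → v i = 0 := by
    intro i j hij hj
    have h1 := heq j (mem_univ j)
    rw [hj, abs_zero, mul_zero] at h1
    have h2 := (Finset.sum_eq_zero_iff_of_nonneg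
      (fun i _ => mul_nonneg (hK0 i j) (abs_nonneg _))).1 h1.symm i (mem_univ i)
    rcases mul_eq_zero.1 h2 with h | h
    · exact absurd h (hE i j hij).ne'
    · simpa using h
  ext i
  have := hconn i j
  induction this using Relation.ReflTransGen.head_induction_on with
  | refl => exact hj0
  | head h _ ih => exact hstep _ _ h ih

lemma dz_dual {n : ℕ} (g : (Fin n → ℝ) →ₗ[ℝ] ℝ) (v : Fin n → ℝ) :
    g v = v ⬝ᵥ (fun l => g (Pi.single l 1)) := by
  classical
  rw [LinearMap.pi_apply_eq_sum_univ g v]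
  simp only [dotProduct, smul_eq_mul]
  refine Finset.sum_congr rfl fun l _ => ?_
  congr 2; ext a; simp [Pi.single_apply, eq_comm]

lemma dz_exists_w {n m : ℕ} (y : Fin m → Fin n → ℝ) 
    (E : Fin m → Fin m → Prop) 
    (hconn : ∀ i j : Fin m, Relation.ReflTransGen E i j)
    (S : Submodule ℝ (Fin n → ℝ))
    (hS : S = Submodule.span ℝ {d | ∃ i j, E i j ∧ d = y j - y i})
    (hdef : Module.finrank ℝ S = m - 1) :
    (∀ i j, y j - y i ∈ S) ∧ ∀ b : Fin m → ℝ, ∃ w : Fin n → ℝ, ∀ i j, (y j - y i) ⬝ᵥ w = b j - b i := by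
  classical
  have hd : ∀ i j, y j - y i ∈ S := by
    intro i j
    induction hconn i j with
    | refl => simp
    | @tail a b _ h ih =>
      have : y b - y a ∈ S := by
        rw [hS]; exact Submodule.subset_span ⟨a, b, h, rfl⟩
      have := S.add_mem ih this
      convert this using 1
      abel
  refine ⟨hd, fun b => ?_⟩
  rcases Nat.eq_zero_or_pos m with rfl | hm
  · exact ⟨0, fun i => i.elim0⟩
  have hVS : vectorSpan ℝ (Set.range y) = S := by
    apply le_antisymm
    · rw [vectorSpan_def, Submodule.span_le]
      rintro _ ⟨_, ⟨i, rfl⟩, _, ⟨j, rfl⟩, rfl⟩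
      exact hd j i
    · rw [hS, Submodule.span_le]
      rintro _ ⟨i, j, _, rfl⟩
      exact vsub_mem_vectorSpan ℝ ⟨j, rfl⟩ ⟨i, rfl⟩
  have hai : AffineIndependent ℝ y := by
    rw [affineIndependent_iff_finrank_vectorSpan_eq (n := m - 1) ℝ y (by simp; omega), hVS, hdef]
  let i0 : Fin m := ⟨0, hm⟩
  have hli := (affineIndependent_iff_linearIndependent_vsub ℝ y i0).1 hai
  obtain ⟨g, hg⟩ := LinearMap.exists_extend
    ((Module.Basis.span hli).constr ℝ (fun i => b i - b i0))
  have hgi : ∀ i, g (y i - y i0) = b i - b i0 := by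
    intro i
    by_cases hi : i = i0
    · simp [hi]
    have h1 := congrArg (fun f => f (Module.Basis.span hli ⟨i, hi⟩)) hg
    simp only [LinearMap.comp_apply, Module.Basis.constr_basis, Submodule.subtype_apply] at h1
    rw [Module.Basis.span_apply] at h1
    simpa using h1
  refine ⟨fun l => g (Pi.single l 1), fun i j => ?_⟩
  rw [← dz_dual g]
  have : y j - y i = (y j - y i0) - (y i - y i0) := by abel
  rw [this, map_sub, hgi, hgi]; ring

lemma dz_coer {a b : ℝ} (ha : 0 < a) (hb : 0 < b) (t : ℝ) :
    b * |t| - |2 * b - 2 * b * Real.log (2 * b / a)| ≤ a * Real.exp t - b * t := by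
  rcases le_total 0 t with h | h
  · rw [abs_of_nonneg h]
    have h1 := Real.add_one_le_exp (t - Real.log (2 * b / a))
    rw [Real.exp_sub, Real.exp_log (by positivity)] at h1
    have h2 : 2 * b * (Real.exp t / (2 * b / a)) = a * Real.exp t := by field_simp
    have h3 := mul_le_mul_of_nonneg_left h1 (by positivity : 0 ≤ 2 * b)
    rw [h2] at h3
    have := neg_abs_le (2 * b - 2 * b * Real.log (2 * b / a))
    linarith
  · rw [abs_of_nonpos h]
    have := abs_nonneg (2 * b - 2 * b * Real.log (2 * b / a))
    have := Real.exp_pos t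
    nlinarith [mul_pos ha this]

lemma dz_birch {n : ℕ} (S : Submodule ℝ (Fin n → ℝ)) (xs x₀ : Fin n → ℝ)
    (hxs : ∀ l, 0 < xs l) (hx₀ : ∀ l, 0 < x₀ l) :
    ∃ xt : Fin n → ℝ, (∀ l, 0 < xt l) ∧ xt - x₀ ∈ S ∧
      ∀ s ∈ S, s ⬝ᵥ (fun l => Real.log (xt l) - Real.log (xs l)) = 0 := by
  let T : Set (Fin n → ℝ) := {v | ∀ s ∈ S, s ⬝ᵥ v = 0}
  let F : (Fin n → ℝ) → ℝ := fun v => ∑ l, (xs l * Real.exp (v l) - x₀ l * v l)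
  let C : Fin n → ℝ := fun l => |2 * x₀ l - 2 * x₀ l * Real.log (2 * x₀ l / xs l)|
  have hTc : IsClosed T := by
    have : T = ⋂ s ∈ S, {v | s ⬝ᵥ v = 0} := by ext v; simp [T]
    rw [this]
    refine isClosed_biInter fun s _ => isClosed_eq ?_ continuous_const
    unfold dotProduct
    fun_prop
  have hFc : Continuous F := by fun_prop
  have hF0 : F 0 = ∑ l, xs l := by simp [F]
  have hbd : ∀ v, F v ≤ F 0 → ∀ l, |v l| ≤ (F 0 + ∑ l, C l) / x₀ l := by
    intro v hv l
    rw [le_div_iff₀ (hx₀ l)]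
    have h1 : ∑ l, (x₀ l * |v l| - C l) ≤ F v :=
      Finset.sum_le_sum fun l _ => dz_coer (hxs l) (hx₀ l) (v l)
    rw [Finset.sum_sub_distrib] at h1
    have h2 : x₀ l * |v l| ≤ ∑ l, x₀ l * |v l| :=
      Finset.single_le_sum (f := fun l => x₀ l * |v l|)
        (fun i _ => mul_nonneg (hx₀ i).le (abs_nonneg _)) (mem_univ l)
    linarith
  let R : Fin n → ℝ := fun l => (F 0 + ∑ l, C l) / x₀ l
  have hK : IsCompact (T ∩ Set.Icc (-R) R) := isCompact_Icc.inter_left hTc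
  have h0T : (0 : Fin n → ℝ) ∈ T := fun s _ => by simp
  have hmemK : ∀ v ∈ T, F v ≤ F 0 → v ∈ T ∩ Set.Icc (-R) R := fun v hv h =>
    ⟨hv, fun l => (abs_le.1 (hbd v h l)).1, fun l => (abs_le.1 (hbd v h l)).2⟩
  obtain ⟨w, hwK, hw⟩ := hK.exists_isMinOn ⟨0, hmemK 0 h0T le_rfl⟩ hFc.continuousOn
  have hmin : ∀ v ∈ T, F w ≤ F v := by
    intro v hv
    by_cases h : F v ≤ F 0
    · exact hw (hmemK v hv h)
    · exact (hw (hmemK 0 h0T le_rfl)).trans (not_le.1 h).le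
  have hcrit : ∀ v ∈ T, ∑ l, (xs l * Real.exp (w l) - x₀ l) * v l = 0 := by
    intro v hv
    have hd : HasDerivAt (fun t : ℝ => F (w + t • v))
        (∑ l, (xs l * Real.exp (w l) - x₀ l) * v l) 0 := by
      apply HasDerivAt.fun_sum
      intro l _
      have h1 : HasDerivAt (fun t : ℝ => w l + t * v l) (v l) 0 := by
        simpa using ((hasDerivAt_id (0 : ℝ)).mul_const (v l)).const_add (w l)
      have h2 := (h1.exp.const_mul (xs l)).sub (h1.const_mul (x₀ l))
      simp only [zero_mul, add_zero] at h2
      have e : (xs l * Real.exp (w l) - x₀ l) * v l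
          = xs l * (Real.exp (w l) * v l) - x₀ l * v l := by ring
      rw [e]
      exact h2
    refine IsLocalMin.hasDerivAt_eq_zero (Filter.Eventually.of_forall fun t => ?_) hd
    simp only [zero_smul, add_zero]
    apply hmin
    intro s hs
    rw [dotProduct_add, dotProduct_smul, hwK.1 s hs, hv s hs]
    simp
  refine ⟨fun l => xs l * Real.exp (w l), fun l => mul_pos (hxs l) (Real.exp_pos _), ?_, ?_⟩
  · by_contra hns
    obtain ⟨g, hg0, hgS⟩ := Submodule.exists_le_ker_of_notMem hns
    apply hg0
    rw [dz_dual g]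
    refine hcrit _ fun s hs => ?_
    rw [← dz_dual g]
    exact hgS hs
  · intro s hs
    rw [← hwK.1 s hs]
    congr 1
    ext l
    rw [Real.log_mul (hxs l).ne' (Real.exp_pos _).ne', Real.log_exp]
    ring

lemma dz_T_nonneg {a b : ℝ} (ha : 0 < a) (hb : 0 < b) :
    0 ≤ a * (Real.log a - Real.log b) - a + b := by
  have h := Real.log_le_sub_one_of_pos (div_pos hb ha)
  rw [Real.log_div hb.ne' ha.ne'] at h
  have h2 := mul_le_mul_of_nonneg_left h ha.le
  have h3 : a * (b / a - 1) = b - a := by field_simp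
  rw [h3] at h2
  linarith

lemma dz_T_eq {a b : ℝ} (ha : 0 < a) (hb : 0 < b)
    (h0 : a * (Real.log a - Real.log b) - a + b = 0) : a = b := by
  by_contra hne
  have h := Real.log_lt_sub_one_of_pos (div_pos hb ha)
    (by intro h; rw [div_eq_one_iff_eq ha.ne'] at h; exact hne h.symm)
  rw [Real.log_div hb.ne' ha.ne'] at h
  have h2 := mul_lt_mul_of_pos_left h ha
  have h3 : a * (b / a - 1) = b - a := by field_simp
  rw [h3] at h2
  linarith

lemma dz_unif {ι : Type*} [Finite ι] (f : ι → ℝ) (hf : ∀ i, 0 < f i) :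
    ∃ a, 0 < a ∧ ∀ i, a ≤ f i := by
  rcases isEmpty_or_nonempty ι with h | h
  · exact ⟨1, one_pos, fun i => h.elim i⟩
  · obtain ⟨i, hi⟩ := Finite.exists_min f
    exact ⟨f i, hf i, hi⟩

/-- dissipation -/
noncomputable def dzD {ι : Type*} [Fintype ι] (κ : ι → ι → ℝ) (u : ι → ℝ) : ℝ :=
  ∑ i, ∑ j, κ i j * (u i * (Real.log (u i) - Real.log (u j)) - u i + u j)

lemma dzD_edge {ι : Type*} [Fintype ι] (κ : ι → ι → ℝ) (hκ : ∀ i j, 0 ≤ κ i j) (u : ι → ℝ)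
    (hu : ∀ i, 0 < u i) (i j : ι) :
    κ i j * (u i * (Real.log (u i) - Real.log (u j)) - u i + u j) ≤ dzD κ u := by
  have h : ∀ i j, 0 ≤ κ i j * (u i * (Real.log (u i) - Real.log (u j)) - u i + u j) :=
    fun i j => mul_nonneg (hκ i j) (dz_T_nonneg (hu i) (hu j))
  refine le_trans ?_ (Finset.single_le_sum
    (f := fun i => ∑ j, κ i j * (u i * (Real.log (u i) - Real.log (u j)) - u i + u j))
    (fun i _ => Finset.sum_nonneg fun j _ => h i j) (mem_univ i))
  exact Finset.single_le_sum
    (f := fun j => κ i j * (u i * (Real.log (u i) - Real.log (u j)) - u i + u j))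
    (fun j _ => h i j) (mem_univ j)

lemma dzD_nonneg {ι : Type*} [Fintype ι] (κ : ι → ι → ℝ) (hκ : ∀ i j, 0 ≤ κ i j) (u : ι → ℝ)
    (hu : ∀ i, 0 < u i) : 0 ≤ dzD κ u :=
  Finset.sum_nonneg fun i _ => Finset.sum_nonneg fun j _ =>
    mul_nonneg (hκ i j) (dz_T_nonneg (hu i) (hu j))

lemma dzD_zero {ι : Type*} [Fintype ι] (κ : ι → ι → ℝ) (hκ : ∀ i j, 0 ≤ κ i j)
    (E : ι → ι → Prop) (hE : ∀ i j, E i j → 0 < κ i j)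
    (hconn : ∀ i j, Relation.ReflTransGen E i j) (u : ι → ℝ)
    (hu : ∀ i, 0 < u i) (h0 : dzD κ u = 0) (i j : ι) : u i = u j := by
  induction hconn i j with
  | refl => rfl
  | @tail a b _ h ih =>
    rw [ih]
    apply dz_T_eq (hu a) (hu b)
    have h1 := dzD_edge κ hκ u hu a b
    rw [h0] at h1
    have h2 := dz_T_nonneg (hu a) (hu b)
    have h3 := hE a b h
    nlinarith

lemma dzD_ratio {ι : Type*} [Fintype ι] (κ : ι → ι → ℝ) (hκ : ∀ i j, 0 ≤ κ i j)
    (E : ι → ι → Prop) (hE : ∀ i j, E i j → 0 < κ i j)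
    (hconn : ∀ i j, Relation.ReflTransGen E i j) (c : ℝ) :
    ∃ a, 0 < a ∧ ∀ u : ι → ℝ, (∀ i, 0 < u i) → ∀ i, dzD κ u ≤ c * u i →
      ∀ j, a * u i ≤ u j := by
  have key : ∀ p : ι × ι, ∃ a, 0 < a ∧ ∀ u : ι → ℝ, (∀ i, 0 < u i) → dzD κ u ≤ c * u p.1 →
      a * u p.1 ≤ u p.2 := by
    rintro ⟨i, j⟩
    simp only
    induction hconn i j with
    | refl => exact ⟨1, one_pos, fun u _ _ => by simp⟩
    | @tail p q _ h ih =>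
      obtain ⟨a, ha, hau⟩ := ih
      have hk := hE p q h
      refine ⟨a * Real.exp (-(|c| / (a * κ p q) + 1)), by positivity, fun u hu hD => ?_⟩
      have h1 := hau u hu hD
      have h2 := (dzD_edge κ hκ u hu p q).trans hD
      have hup := hu p
      have huq := hu q
      have hui := hu i
      have h3 : c * u i ≤ |c| / a * u p := by
        have : |c| / a * (a * u i) ≤ |c| / a * u p := by gcongr
        have e : |c| / a * (a * u i) = |c| * u i := by field_simp
        rw [e] at this
        refine le_trans ?_ this
        gcongr
        exact le_abs_self c
      have h4 : u p * (Real.log (u p) - Real.log (u q)) - u p + u q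
          ≤ |c| / (a * κ p q) * u p := by
        have e : |c| / (a * κ p q) * u p = (|c| / a * u p) / κ p q := by field_simp
        rw [e, le_div_iff₀ hk]
        linarith
      have h5 : Real.log (u p) - Real.log (u q) ≤ |c| / (a * κ p q) + 1 := by
        have : u p * (Real.log (u p) - Real.log (u q)) ≤ u p * (|c| / (a * κ p q) + 1) := by
          linarith
        exact le_of_mul_le_mul_left this hup
      have h6 : u p * Real.exp (-(|c| / (a * κ p q) + 1)) ≤ u q := by
        rw [← Real.log_le_log_iff (by positivity) huq, Real.log_mul hup.ne' (Real.exp_pos _).ne',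
          Real.log_exp]
        linarith
      calc _ = (a * u i) * Real.exp (-(|c| / (a * κ p q) + 1)) := by ring
        _ ≤ u p * Real.exp (-(|c| / (a * κ p q) + 1)) := by gcongr
        _ ≤ _ := h6
  choose f hf hfu using key
  obtain ⟨a, ha, hle⟩ := dz_unif f hf
  refine ⟨a, ha, fun u hu i hD j => le_trans ?_ (hfu (i, j) u hu hD)⟩
  have := hu i
  have := hle (i, j)
  gcongr

lemma dz_fence {F : Type*} [NormedAddCommGroup F] [NormedSpace ℝ F] (x x' : ℝ → F) (V V' : ℝ → ℝ)
    (hx : ∀ t ∈ Set.Ici (0 : ℝ), HasDerivWithinAt x (x' t) (Set.Ici 0) t)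
    (hV : ∀ t ∈ Set.Ici (0 : ℝ), HasDerivWithinAt V (V' t) (Set.Ici 0) t)
    (p : F) (r c Vi : ℝ) (hc : 0 < c) (hVi : ∀ t, 0 ≤ t → Vi ≤ V t)
    (hball : ∀ t, 0 ≤ t → ‖x t - p‖ < r → c * ‖x' t‖ ≤ - V' t)
    (s : ℝ) (hs : 0 ≤ s) (hsr : ‖x s - p‖ + (V s - Vi) / c < r) (t : ℝ) (hst : s ≤ t) :
    ‖x t - x s‖ ≤ (V s - V t) / c := by
  have hε : ∀ᶠ ε in nhdsWithin (0 : ℝ) (Set.Ioi 0),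
      ‖x t - x s‖ ≤ (V s - V t) / c + ε * (t - s + 1) := by
    have h1 : Tendsto (fun ε : ℝ => ‖x s - p‖ + (V s - Vi) / c + ε * (t - s + 1))
        (nhdsWithin (0 : ℝ) (Set.Ioi 0)) (nhds (‖x s - p‖ + (V s - Vi) / c + 0 * (t - s + 1))) := by
      apply Tendsto.mono_left _ nhdsWithin_le_nhds
      apply Continuous.tendsto
      fun_prop
    rw [zero_mul, add_zero] at h1
    filter_upwards [h1.eventually_lt_const hsr, self_mem_nhdsWithin] with ε h2 h3
    have h3 : 0 < ε := h3
    have hsub : ∀ τ, s ≤ τ → Set.Ici τ ⊆ Set.Ici (0 : ℝ) := fun τ h =>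
      Set.Ici_subset_Ici.2 (hs.trans h)
    have := image_norm_le_of_norm_deriv_right_lt_deriv_boundary' (a := s) (b := t)
      (f := fun τ => x τ - x s) (f' := x')
      (B := fun τ => (V s - V τ) / c + ε * (τ - s + 1)) (B' := fun τ => - V' τ / c + ε)
      (fun τ hτ => (((hx τ (hs.trans hτ.1)).continuousWithinAt).mono
        (fun z hz => hs.trans hz.1)).sub continuousWithinAt_const)
      (fun τ hτ => ((hx τ (hs.trans hτ.1)).mono (hsub τ hτ.1)).sub_const _)
      (by simp [h3.le])
      (fun τ hτ => by
        have : ContinuousWithinAt V (Set.Icc s t) τ := ((hV τ (hs.trans hτ.1)).continuousWithinAt).mono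
          (fun z hz => hs.trans hz.1)
        fun_prop)
      (fun τ hτ => by
        have h := (hV τ (hs.trans hτ.1)).mono (hsub τ hτ.1)
        have h4 := (h.const_sub (V s)).div_const c
        have h5 : HasDerivWithinAt (fun τ => ε * (τ - s + 1)) ε (Set.Ici τ) τ := by
          simpa using ((((hasDerivWithinAt_id τ (Set.Ici τ)).sub_const s).add_const 1).const_mul ε)
        exact h4.add h5)
      (fun τ hτ heq => by
        have h4 : ‖x τ - p‖ < r := by
          have e : x τ - p = (x τ - x s) + (x s - p) := by abel
          have h5 : ‖x τ - p‖ ≤ ‖x τ - x s‖ + ‖x s - p‖ := by rw [e]; exact norm_add_le _ _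
          have h6 : (V s - V τ) / c ≤ (V s - Vi) / c := by
            have := hVi τ (hs.trans hτ.1)
            gcongr
          have h7 : ε * (τ - s + 1) ≤ ε * (t - s + 1) := by
            have := hτ.2.le
            gcongr
          linarith
        have h5 := hball τ (hs.trans hτ.1) h4
        have h6 : ‖x' τ‖ ≤ - V' τ / c := by
          rw [le_div_iff₀ hc]; linarith
        linarith)
      (Set.right_mem_Icc.2 hst)
    exact this
  have h1 : Tendsto (fun ε : ℝ => (V s - V t) / c + ε * (t - s + 1))
      (nhdsWithin (0 : ℝ) (Set.Ioi 0)) (nhds ((V s - V t) / c + 0 * (t - s + 1))) := by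
    apply Tendsto.mono_left _ nhdsWithin_le_nhds
    apply Continuous.tendsto
    fun_prop
  rw [zero_mul, add_zero] at h1
  exact ge_of_tendsto h1 hε

lemma dz_cluster_closed {X : Type*} [TopologicalSpace X] {x : ℝ → X} {p : X}
    (h : MapClusterPt p atTop x) {A : Set X} (hA : IsClosed A) (he : ∀ᶠ t in atTop, x t ∈ A) :
    p ∈ A := by
  by_contra hp
  have h1 := mapClusterPt_iff_frequently.1 h Aᶜ (hA.isOpen_compl.mem_nhds hp)
  obtain ⟨t, h2, h3⟩ := (h1.and_eventually he).exists
  exact h2 h3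

lemma dz_diss {n : ℕ} {ι : Type*} [Fintype ι] (y : ι → Fin n → ℝ) (κ : ι → ι → ℝ)
    (hbal : ∀ j, ∑ i, κ i j = ∑ i, κ j i) (w : Fin n → ℝ) :
    (∑ i, ∑ j, (κ i j * Real.exp (y i ⬝ᵥ w)) • (y j - y i)) ⬝ᵥ w
      = - dzD κ (fun i => Real.exp (y i ⬝ᵥ w)) := by
  have h0 : ∑ i, ∑ j, κ i j * (Real.exp (y j ⬝ᵥ w) - Real.exp (y i ⬝ᵥ w)) = 0 := by
    simp only [mul_sub, Finset.sum_sub_distrib]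
    rw [Finset.sum_comm]
    simp only [← Finset.sum_mul, hbal, sub_self]
  have h1 : dzD κ (fun i => Real.exp (y i ⬝ᵥ w)) =
      ∑ i, ∑ j, κ i j * (Real.exp (y i ⬝ᵥ w) * (y i ⬝ᵥ w - y j ⬝ᵥ w)) +
      ∑ i, ∑ j, κ i j * (Real.exp (y j ⬝ᵥ w) - Real.exp (y i ⬝ᵥ w)) := by
    unfold dzD
    simp only [← Finset.sum_add_distrib, Real.log_exp]
    refine Finset.sum_congr rfl fun i _ => Finset.sum_congr rfl fun j _ => by ring
  rw [h1, h0, add_zero]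
  simp only [sum_dotProduct, smul_dotProduct, sub_dotProduct, smul_eq_mul,
    ← Finset.sum_neg_distrib]
  refine Finset.sum_congr rfl fun i _ => Finset.sum_congr rfl fun j _ => by ring

lemma dz_coordS {n : ℕ} {ι : Type*} [Fintype ι] (v : ι → Fin n → ℝ)
    (S : Submodule ℝ (Fin n → ℝ)) (hS : S = Submodule.span ℝ (Set.range v)) :
    ∃ C : ℝ, 0 ≤ C ∧ ∀ s ∈ S, ∀ (w : Fin n → ℝ) (L : ℝ), 0 ≤ L → (∀ i, |v i ⬝ᵥ w| ≤ L) →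
      s ⬝ᵥ w ≤ C * ‖s‖ * L := by
  classical
  let Φ := Fintype.linearCombination ℝ v
  have hr : LinearMap.range Φ = S := by
    rw [hS]; exact Fintype.range_linearCombination ℝ v
  obtain ⟨ψ, hψ⟩ := LinearMap.exists_rightInverse_of_surjective Φ.rangeRestrict
    (LinearMap.range_rangeRestrict Φ)
  let ψc := LinearMap.toContinuousLinearMap ψ
  refine ⟨Fintype.card ι * ‖ψc‖, by positivity, fun s hs w L hL hw => ?_⟩
  have hs' : s ∈ LinearMap.range Φ := hr ▸ hs
  have h1 : Φ (ψ ⟨s, hs'⟩) = s := by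
    have := congrArg (fun f => ((f ⟨s, hs'⟩ : LinearMap.range Φ) : Fin n → ℝ)) hψ
    simpa using this
  have h2 : ∀ i, |ψ ⟨s, hs'⟩ i| ≤ ‖ψc‖ * ‖s‖ := by
    intro i
    exact (norm_le_pi_norm (ψ ⟨s, hs'⟩) i).trans (ψc.le_opNorm ⟨s, hs'⟩)
  have h3 : s ⬝ᵥ w = ∑ i, ψ ⟨s, hs'⟩ i * (v i ⬝ᵥ w) := by
    conv_lhs => rw [← h1]
    simp [Φ, Fintype.linearCombination_apply, sum_dotProduct, smul_dotProduct]
  rw [h3]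
  calc ∑ i, ψ ⟨s, hs'⟩ i * (v i ⬝ᵥ w) ≤ ∑ i : ι, (‖ψc‖ * ‖s‖) * L := by
        refine Finset.sum_le_sum fun i _ => ?_
        refine (le_abs_self _).trans ?_
        rw [abs_mul]
        have := h2 i
        have := hw i
        gcongr
    _ = _ := by simp; ring

/-- one-dimensional entropy -/
noncomputable def dzg (b a : ℝ) : ℝ := a * (Real.log a - Real.log b) - a + b

lemma dzg_cont (b : ℝ) : Continuous (dzg b) := by
  have : dzg b = fun a => a * Real.log a - a * Real.log b - a + b := by
    ext a; unfold dzg; ring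
  rw [this]
  have := Real.continuous_mul_log
  fun_prop

lemma dzg_deriv (b : ℝ) {a : ℝ} (ha : 0 < a) :
    HasDerivAt (dzg b) (Real.log a - Real.log b) a := by
  have h := (((hasDerivAt_id a).mul ((Real.hasDerivAt_log ha.ne').sub_const (Real.log b))).sub
    (hasDerivAt_id a)).add_const b
  have e : Real.log a - Real.log b = 1 * (Real.log a - Real.log b) + id a * a⁻¹ - 1 := by
    simp [ha.ne']
  rw [e]
  exact h

lemma dzg_lower {a b : ℝ} (ha : 0 < a) (hb : 0 < b) : a - b * Real.exp 1 ≤ dzg b a := by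
  have h := dz_T_nonneg ha (by positivity : 0 < b * Real.exp 1)
  rw [Real.log_mul hb.ne' (Real.exp_pos _).ne', Real.log_exp] at h
  unfold dzg
  linarith

lemma dzg_local {b q : ℝ} (hb : 0 < b) (hq : 0 ≤ q) :
    ∃ C, 0 ≤ C ∧ ∀ᶠ a in nhds q, 0 < a → dzg b a - dzg b q ≤ C * |a - q| := by
  rcases hq.eq_or_lt with rfl | hq
  · refine ⟨0, le_rfl, ?_⟩
    filter_upwards [gt_mem_nhds hb] with a hab ha
    have : Real.log a ≤ Real.log b := Real.log_le_log ha hab.le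
    simp only [dzg]
    nlinarith
  · obtain ⟨C, hC, h⟩ := (dzg_deriv b hq).isBigO_sub.exists_pos
    refine ⟨C, hC.le, ?_⟩
    filter_upwards [h.bound] with a ha _
    exact (le_abs_self _).trans ha

/-- Lyapunov function -/
noncomputable def dzV {n : ℕ} (b x : Fin n → ℝ) : ℝ := ∑ l, dzg (b l) (x l)

lemma dzV_cont {n : ℕ} (b : Fin n → ℝ) : Continuous (dzV b) := by
  unfold dzV
  exact continuous_finsetSum _ fun l _ => (dzg_cont (b l)).comp (continuous_apply l)

lemma dzV_local {n : ℕ} (b p : Fin n → ℝ) (hb : ∀ l, 0 < b l) (hp : ∀ l, 0 ≤ p l) :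
    ∃ C, 0 ≤ C ∧ ∀ᶠ x in nhds p, (∀ l, 0 < x l) → dzV b x - dzV b p ≤ C * ‖x - p‖ := by
  choose C hC h using fun l => dzg_local (hb l) (hp l)
  refine ⟨∑ l, C l, Finset.sum_nonneg fun l _ => hC l, ?_⟩
  have h2 : ∀ᶠ x in nhds p, ∀ l, 0 < x l →
      dzg (b l) (x l) - dzg (b l) (p l) ≤ C l * |x l - p l| :=
    eventually_all.2 fun l => (continuous_apply l).continuousAt.eventually (h l)
  filter_upwards [h2] with x hx hx0
  unfold dzV
  rw [← Finset.sum_sub_distrib, Finset.sum_mul]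
  refine Finset.sum_le_sum fun l _ => (hx l (hx0 l)).trans ?_
  have := norm_le_pi_norm (x - p) l
  have h3 := hC l
  rw [Pi.sub_apply, Real.norm_eq_abs] at this
  gcongr

/-- log coordinates -/
noncomputable def dzw {n : ℕ} (b x : Fin n → ℝ) : Fin n → ℝ :=
  fun l => Real.log (x l) - Real.log (b l)

/-- the vector field -/
noncomputable def dzf {n : ℕ} {ι : Type*} [Fintype ι] (y : ι → Fin n → ℝ) (κ : ι → ι → ℝ)
    (b x : Fin n → ℝ) : Fin n → ℝ :=
  ∑ i, ∑ j, (κ i j * Real.exp (y i ⬝ᵥ dzw b x)) • (y j - y i)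

lemma dz_mono {a b : ℝ} (ha : 0 < a) (hb : 0 < b) :
    0 ≤ (a - b) * (Real.log a - Real.log b) := by
  rcases le_total a b with h | h
  · have := Real.log_le_log ha h
    nlinarith
  · have := Real.log_le_log hb h
    nlinarith

lemma dz_interior {n : ℕ} {ι : Type*} [Fintype ι] (y : ι → Fin n → ℝ) (κ : ι → ι → ℝ)
    (hκ : ∀ i j, 0 ≤ κ i j)
    (E : ι → ι → Prop) (hE : ∀ i j, E i j → 0 < κ i j)
    (hconn : ∀ i j, Relation.ReflTransGen E i j)
    (S : Submodule ℝ (Fin n → ℝ))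
    (hS : S = Submodule.span ℝ (Set.range fun q : ι × ι => y q.2 - y q.1))
    (b p : Fin n → ℝ) (hb : ∀ l, 0 < b l) (hp : ∀ l, 0 < p l) (hpS : p - b ∈ S) (hne : p ≠ b) :
    0 < dzD κ (fun i => Real.exp (y i ⬝ᵥ dzw b p)) := by
  have hu : ∀ i, 0 < Real.exp (y i ⬝ᵥ dzw b p) := fun i => Real.exp_pos _
  refine (dzD_nonneg κ hκ _ hu).lt_of_ne fun h0 => hne ?_
  have h1 := dzD_zero κ hκ E hE hconn _ hu h0.symm
  obtain ⟨C, _, hC⟩ := dz_coordS _ S hS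
  have h2 := hC _ hpS (dzw b p) 0 le_rfl (fun q => by
    have := Real.exp_injective (h1 q.2 q.1)
    simp [sub_dotProduct, this])
  rw [mul_zero] at h2
  have h3 : ∀ l ∈ (univ : Finset (Fin n)), 0 ≤ (p - b) l * dzw b p l :=
    fun l _ => dz_mono (hp l) (hb l)
  have h4 := (Finset.sum_eq_zero_iff_of_nonneg h3).1 (le_antisymm h2 (Finset.sum_nonneg h3))
  ext l
  rcases mul_eq_zero.1 (h4 l (mem_univ l)) with h | h
  · exact sub_eq_zero.1 h
  · exact Real.log_injOn_pos (hp l) (hb l) (sub_eq_zero.1 h)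

lemma dz_boundary {n : ℕ} {ι : Type*} [Fintype ι] (y : ι → Fin n → ℝ) (κ : ι → ι → ℝ)
    (hκ : ∀ i j, 0 ≤ κ i j)
    (E : ι → ι → Prop) (hE : ∀ i j, E i j → 0 < κ i j)
    (hconn : ∀ i j, Relation.ReflTransGen E i j)
    (S : Submodule ℝ (Fin n → ℝ))
    (hS : S = Submodule.span ℝ (Set.range fun q : ι × ι => y q.2 - y q.1))
    (b p : Fin n → ℝ) (hb : ∀ l, 0 < b l) (l : Fin n) (hpl : p l = 0) (c : ℝ) (hc : 0 < c) :
    ∃ r, 0 < r ∧ ∀ x : Fin n → ℝ, (∀ l, 0 < x l) → x - b ∈ S → ‖x - p‖ < r →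
      c * ‖dzf y κ b x‖ ≤ dzD κ (fun i => Real.exp (y i ⬝ᵥ dzw b x)) := by
  let C0 : ℝ := ∑ i, ∑ j, κ i j * ‖y j - y i‖
  obtain ⟨a, ha, hau⟩ := dzD_ratio κ hκ E hE hconn (c * C0)
  obtain ⟨C, hC0, hC⟩ := dz_coordS _ S hS
  let Q : ℝ := C * (‖p - b‖ + 1) * |Real.log a|
  have hQ : 0 ≤ Q := by positivity
  have hbl := hb l
  let r0 : ℝ := b l * Real.exp (-(2 * Q / b l + 1))
  refine ⟨min 1 (min (b l / 2) r0), by positivity, fun x hx hxS hxr => ?_⟩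
  have hx1 : ‖x - p‖ < 1 := hxr.trans_le (min_le_left _ _)
  have hxl : x l ≤ ‖x - p‖ := by
    have := norm_le_pi_norm (x - p) l
    rw [Pi.sub_apply, hpl, sub_zero, Real.norm_eq_abs] at this
    exact (le_abs_self _).trans this
  have hx2 : x l < b l / 2 :=
    hxl.trans_lt (hxr.trans_le ((min_le_right _ _).trans (min_le_left _ _)))
  have hx3 : x l < r0 := hxl.trans_lt (hxr.trans_le ((min_le_right _ _).trans (min_le_right _ _)))
  by_contra hcon
  push Not at hcon
  set u : ι → ℝ := fun i => Real.exp (y i ⬝ᵥ dzw b x) with hudef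
  have hu : ∀ i, 0 < u i := fun i => Real.exp_pos _
  rcases isEmpty_or_nonempty ι with hι | hι
  · have : dzf y κ b x = 0 := by simp [dzf]
    rw [this, norm_zero, mul_zero] at hcon
    exact absurd hcon (not_lt.2 (dzD_nonneg κ hκ u hu))
  obtain ⟨i, hi⟩ := Finite.exists_max u
  have hf : ‖dzf y κ b x‖ ≤ C0 * u i := by
    unfold dzf
    simp only [C0, Finset.sum_mul]
    refine (norm_sum_le _ _).trans (Finset.sum_le_sum fun i' _ => ?_)
    refine (norm_sum_le _ _).trans (Finset.sum_le_sum fun j _ => ?_)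
    rw [norm_smul, Real.norm_eq_abs, abs_of_nonneg (mul_nonneg (hκ i' j) (hu i').le)]
    have h1 := mul_le_mul_of_nonneg_left (hi i') (mul_nonneg (hκ i' j) (norm_nonneg (y j - y i')))
    linarith
  have hD : dzD κ u ≤ c * C0 * u i := by
    refine hcon.le.trans ?_
    rw [mul_assoc]
    gcongr
  have hr := hau u hu i hD
  have hlog : ∀ j, Real.log a + y i ⬝ᵥ dzw b x ≤ y j ⬝ᵥ dzw b x := by
    intro j
    have h1 := Real.log_le_log (mul_pos ha (hu i)) (hr j)
    rw [Real.log_mul ha.ne' (hu i).ne'] at h1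
    simpa [hudef] using h1
  have hlog2 : ∀ j, y j ⬝ᵥ dzw b x ≤ y i ⬝ᵥ dzw b x := fun j => Real.exp_le_exp.1 (hi j)
  have hL := neg_abs_le (Real.log a)
  have h2 := hC _ hxS (dzw b x) |Real.log a| (abs_nonneg _) (fun q => by
    simp only [sub_dotProduct]
    rw [abs_le]
    have h1 := hlog q.1
    have h2 := hlog q.2
    have h3 := hlog2 q.1
    have h4 := hlog2 q.2
    constructor <;> linarith)
  have h3 : ‖x - b‖ ≤ ‖p - b‖ + 1 := by
    have e : x - b = (x - p) + (p - b) := by abel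
    have := norm_add_le (x - p) (p - b)
    rw [e]; linarith
  have h4 : (x - b) ⬝ᵥ dzw b x ≤ Q := by
    refine h2.trans ?_
    simp only [Q]
    gcongr
  have h5 : (x l - b l) * (Real.log (x l) - Real.log (b l)) ≤ (x - b) ⬝ᵥ dzw b x :=
    Finset.single_le_sum (f := fun l => (x - b) l * dzw b x l)
      (fun l _ => dz_mono (hx l) (hb l)) (mem_univ l)
  have h6 : Real.log (x l) < Real.log (b l) - (2 * Q / b l + 1) := by
    have := Real.log_lt_log (hx l) hx3
    simp only [r0] at this
    rw [Real.log_mul hbl.ne' (Real.exp_pos _).ne', Real.log_exp] at this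
    linarith
  have h7 : b l / 2 * (2 * Q / b l + 1) ≤ (b l - x l) * (Real.log (b l) - Real.log (x l)) := by
    have : 0 ≤ 2 * Q / b l + 1 := by positivity
    apply mul_le_mul <;> linarith
  have h8 : b l / 2 * (2 * Q / b l + 1) = Q + b l / 2 := by field_simp
  nlinarith

lemma dz_contAt {n : ℕ} {ι : Type*} [Fintype ι] (y : ι → Fin n → ℝ) (κ : ι → ι → ℝ)
    (b p : Fin n → ℝ) (hp : ∀ l, 0 < p l) :
    ContinuousAt (fun x => dzf y κ b x) p ∧
      ContinuousAt (fun x => dzD κ (fun i => Real.exp (y i ⬝ᵥ dzw b x))) p := by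
  have hw : ∀ i, ContinuousAt (fun x => y i ⬝ᵥ dzw b x) p := by
    intro i
    unfold dotProduct dzw
    refine tendsto_finsetSum _ fun l _ => ?_
    refine Tendsto.const_mul _ (Tendsto.sub_const ?_ _)
    exact ((continuous_apply l).tendsto p).log (hp l).ne'
  constructor
  · unfold dzf
    refine tendsto_finsetSum _ fun i _ => tendsto_finsetSum _ fun j _ => ?_
    exact ((hw i).rexp.const_mul _).smul_const _
  · unfold dzD
    simp only [Real.log_exp]
    refine tendsto_finsetSum _ fun i _ => tendsto_finsetSum _ fun j _ => ?_
    exact ((((hw i).rexp.mul ((hw i).sub (hw j))).sub (hw i).rexp).add (hw j).rexp).const_mul _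

lemma dz_antitone (a : ℝ) (V V' : ℝ → ℝ) (ha : 0 ≤ a)
    (hV : ∀ t ∈ Set.Ici (0 : ℝ), HasDerivWithinAt V (V' t) (Set.Ici 0) t)
    (h0 : ∀ t, a ≤ t → V' t ≤ 0) : AntitoneOn V (Set.Ici a) := by
  have hsub : Set.Ici a ⊆ Set.Ici 0 := Set.Ici_subset_Ici.2 ha
  refine antitoneOn_of_hasDerivWithinAt_nonpos (f' := V') (convex_Ici a)
    (fun t ht => (hV t (hsub ht)).continuousWithinAt.mono hsub) ?_ ?_
  · intro t ht
    exact (hV t (hsub (interior_subset ht))).mono (interior_subset.trans hsub)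
  · intro t ht
    exact h0 t (interior_subset ht)

lemma dz_dyn {n : ℕ} {ι : Type*} [Fintype ι] (y : ι → Fin n → ℝ) (κ : ι → ι → ℝ)
    (hκ : ∀ i j, 0 ≤ κ i j)
    (E : ι → ι → Prop) (hE : ∀ i j, E i j → 0 < κ i j)
    (hconn : ∀ i j, Relation.ReflTransGen E i j)
    (hbal : ∀ j, ∑ i, κ i j = ∑ i, κ j i)
    (S : Submodule ℝ (Fin n → ℝ))
    (hS : S = Submodule.span ℝ (Set.range fun q : ι × ι => y q.2 - y q.1))
    (b : Fin n → ℝ) (hb : ∀ l, 0 < b l)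
    (x : ℝ → Fin n → ℝ) (hx : ∀ t ∈ Set.Ici (0 : ℝ), ∀ l, 0 < x t l)
    (hd : ∀ t ∈ Set.Ici (0 : ℝ), HasDerivWithinAt x (dzf y κ b (x t)) (Set.Ici 0) t)
    (h0 : x 0 - b ∈ S) : Tendsto x atTop (nhds b) := by
  classical
  have hfS : ∀ z, dzf y κ b z ∈ S := by
    intro z
    unfold dzf
    refine S.sum_mem fun i _ => S.sum_mem fun j _ => S.smul_mem _ ?_
    rw [hS]
    exact Submodule.subset_span ⟨(i, j), rfl⟩
  -- trajectories stay in the class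
  have hclass : ∀ t, 0 ≤ t → x t - b ∈ S := by
    intro t ht
    by_contra hns
    obtain ⟨g, hg0, hgS⟩ := Submodule.exists_le_ker_of_notMem hns
    apply hg0
    have hgS' : ∀ s ∈ S, g s = 0 := fun s hs => hgS hs
    let G := LinearMap.toContinuousLinearMap g
    have hder : ∀ τ ∈ Set.Ici (0 : ℝ), HasDerivWithinAt (fun τ => G (x τ)) 0 (Set.Ici 0) τ := by
      intro τ hτ
      have := G.hasFDerivAt.comp_hasDerivWithinAt τ (hd τ hτ)
      have e : G (dzf y κ b (x τ)) = 0 := hgS' _ (hfS _)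
      rw [e] at this
      exact this
    have h1 := dz_antitone 0 _ (fun _ => 0) le_rfl hder (fun _ _ => le_rfl)
    have h2 := dz_antitone 0 _ (fun _ => -0) le_rfl (fun τ hτ => (hder τ hτ).neg)
      (fun _ _ => by simp)
    have h3 : g (x t) ≤ g (x 0) := h1 Set.self_mem_Ici ht ht
    have h4 : - g (x t) ≤ - g (x 0) := h2 Set.self_mem_Ici ht ht
    have h5 := hgS' _ h0
    rw [map_sub] at h5 ⊢
    linarith
  let V : ℝ → ℝ := fun t => dzV b (x t)
  let V' : ℝ → ℝ := fun t => - dzD κ (fun i => Real.exp (y i ⬝ᵥ dzw b (x t)))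
  have hV : ∀ t ∈ Set.Ici (0 : ℝ), HasDerivWithinAt V (V' t) (Set.Ici 0) t := by
    intro t ht
    have e : V' t = ∑ l, (Real.log (x t l) - Real.log (b l)) * dzf y κ b (x t) l := by
      change - dzD κ (fun i => Real.exp (y i ⬝ᵥ dzw b (x t))) = _
      rw [← dz_diss y κ hbal]
      exact Finset.sum_congr rfl fun l _ => mul_comm _ _
    rw [e]
    refine HasDerivWithinAt.fun_sum fun l _ => ?_
    have h1 := (hasDerivWithinAt_pi.1 (hd t ht)) l
    exact (dzg_deriv (b l) (hx t ht l)).comp_hasDerivWithinAt t h1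
  have hD0 : ∀ t, 0 ≤ t → V' t ≤ 0 := fun t _ =>
    neg_nonpos.2 (dzD_nonneg κ hκ _ fun i => Real.exp_pos _)
  have hVanti := dz_antitone 0 V V' le_rfl hV hD0
  -- boundedness
  let R : Fin n → ℝ := fun l => V 0 + b l * Real.exp 1
  have hbdd : ∀ t, 0 ≤ t → x t ∈ Set.Icc 0 R := by
    intro t ht
    refine ⟨fun l => (hx t ht l).le, fun l => ?_⟩
    have h1 := dzg_lower (hx t ht l) (hb l)
    have h2 : dzg (b l) (x t l) ≤ V t :=
      Finset.single_le_sum (f := fun l => dzg (b l) (x t l))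
        (fun l _ => dz_T_nonneg (hx t ht l) (hb l)) (mem_univ l)
    have h3 : V t ≤ V 0 := hVanti Set.self_mem_Ici ht ht
    change x t l ≤ V 0 + b l * Real.exp 1
    linarith
  refine isCompact_Icc.tendsto_nhds_of_unique_mapClusterPt (s := Set.Icc 0 R)
    ((eventually_ge_atTop 0).mono hbdd) ?_
  intro p hpK hcl
  by_contra hne
  have hp0 : ∀ l, 0 ≤ p l := fun l => hpK.1 l
  have hpS : p - b ∈ S := by
    have hcl' : IsClosed {z : Fin n → ℝ | z - b ∈ S} :=
      (Submodule.closed_of_finiteDimensional S).preimage (continuous_id.sub continuous_const)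
    exact dz_cluster_closed hcl hcl' ((eventually_ge_atTop 0).mono hclass)
  have hVp : ∀ t, 0 ≤ t → dzV b p ≤ V t := by
    intro t ht
    have hcl' : IsClosed {z : Fin n → ℝ | dzV b z ≤ V t} :=
      isClosed_le (dzV_cont b) continuous_const
    exact dz_cluster_closed hcl hcl' ((eventually_ge_atTop t).mono fun s hs =>
      hVanti ht (ht.trans hs) hs)
  -- good starting times
  have hgood : ∀ c r : ℝ, 0 < c → 0 < r → ∀ P : (Fin n → ℝ) → Prop, (∀ᶠ z in nhds p, P z) →
      ∃ s, 0 ≤ s ∧ ‖x s - p‖ + (V s - dzV b p) / c < r ∧ P (x s) := by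
    intro c r hc hr P hP
    have h1 : ∀ᶠ z in nhds p, ‖z - p‖ + (dzV b z - dzV b p) / c < r := by
      have hcont : Continuous fun z => ‖z - p‖ + (dzV b z - dzV b p) / c := by
        have := dzV_cont b
        fun_prop
      refine hcont.continuousAt.eventually_lt_const ?_
      simpa using hr
    have h2 := mapClusterPt_iff_frequently.1 hcl _ (h1.and hP)
    obtain ⟨s, ⟨h3, h4⟩, h5⟩ := (h2.and_eventually (eventually_ge_atTop 0)).exists
    exact ⟨s, h5, h3, h4⟩
  by_cases hpos : ∀ l, 0 < p l
  · -- interior cluster point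
    have hDp := dz_interior y κ hκ E hE hconn S hS b p hb hpos hpS hne
    obtain ⟨hcf, hcD⟩ := dz_contAt y κ b p hpos
    set d := dzD κ (fun i => Real.exp (y i ⬝ᵥ dzw b p)) with hdd
    have hd2 : d / 2 < d := by linarith
    have he1 := hcD.eventually_const_lt hd2
    have he2 := hcf.norm.eventually_lt_const (lt_add_one ‖dzf y κ b p‖)
    obtain ⟨r, hr, hball⟩ := Metric.eventually_nhds_iff.1 (he1.and he2)
    let c := d / 2 / (‖dzf y κ b p‖ + 1)
    have hN : 0 < ‖dzf y κ b p‖ + 1 := by positivity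
    have hc : 0 < c := by positivity
    obtain ⟨s, hs, hsr, -⟩ := hgood c r hc hr (fun _ => True) (Eventually.of_forall fun _ => trivial)
    have hfence := dz_fence x (fun t => dzf y κ b (x t)) V V' hd hV p r c (dzV b p) hc hVp
      (fun t ht htr => by
        have h1 := hball (y := x t) (by rwa [dist_eq_norm])
        have h2 : c * ‖dzf y κ b (x t)‖ ≤ c * (‖dzf y κ b p‖ + 1) := by
          have := h1.2.le
          gcongr
        have h3 : c * (‖dzf y κ b p‖ + 1) = d / 2 := by simp only [c]; field_simp
        have h4 : - V' t = dzD κ (fun i => Real.exp (y i ⬝ᵥ dzw b (x t))) := neg_neg _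
        rw [h4]
        have := h1.1
        linarith) s hs hsr
    have hin : ∀ t, s ≤ t → V' t + d / 2 * 1 ≤ 0 := by
      intro t hst
      have h1 := hfence t hst
      have h2 : (V s - V t) / c ≤ (V s - dzV b p) / c := by
        have := hVp t (hs.trans hst)
        gcongr
      have h3 : ‖x t - p‖ ≤ ‖x t - x s‖ + ‖x s - p‖ := by
        have e : x t - p = (x t - x s) + (x s - p) := by abel
        rw [e]; exact norm_add_le _ _
      have h4 := (hball (y := x t) (by rw [dist_eq_norm]; linarith)).1
      change - dzD κ (fun i => Real.exp (y i ⬝ᵥ dzw b (x t))) + d / 2 * 1 ≤ 0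
      linarith
    have hanti := dz_antitone s (fun t => V t + d / 2 * t) (fun t => V' t + d / 2 * 1) hs
      (fun t ht => (hV t ht).add ((hasDerivWithinAt_id t _).const_mul (d / 2))) hin
    let t1 := s + (V s - dzV b p + 1) / (d / 2)
    have hVs := hVp s hs
    have hst1 : s ≤ t1 := by
      have : 0 ≤ (V s - dzV b p + 1) / (d / 2) := by
        apply div_nonneg <;> linarith
      simp only [t1]; linarith
    have h5 : V t1 + d / 2 * t1 ≤ V s + d / 2 * s := hanti Set.self_mem_Ici hst1 hst1
    have h6 : d / 2 * t1 = d / 2 * s + (V s - dzV b p + 1) := by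
      simp only [t1]; field_simp
    have h7 := hVp t1 (hs.trans hst1)
    linarith
  · -- boundary cluster point
    push Not at hpos
    obtain ⟨l, hl⟩ := hpos
    have hpl : p l = 0 := le_antisymm hl (hp0 l)
    obtain ⟨C, hC, hloc⟩ := dzV_local b p hb hp0
    have hc : 0 < C + 1 := by linarith
    obtain ⟨r, hr, hball⟩ := dz_boundary y κ hκ E hE hconn S hS b p hb l hpl (C + 1) hc
    obtain ⟨s, hs, hsr, hsP⟩ := hgood (C + 1) r hc hr _ hloc
    have hfence := dz_fence x (fun t => dzf y κ b (x t)) V V' hd hV p r (C + 1) (dzV b p) hc hVp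
      (fun t ht htr => by
        have h4 : - V' t = dzD κ (fun i => Real.exp (y i ⬝ᵥ dzw b (x t))) := neg_neg _
        rw [h4]
        exact hball (x t) (hx t ht) (hclass t ht) htr) s hs hsr
    have hcl' : IsClosed {z : Fin n → ℝ | ‖z - x s‖ ≤ (V s - dzV b p) / (C + 1)} :=
      isClosed_le (by fun_prop) continuous_const
    have h1 : ‖p - x s‖ ≤ (V s - dzV b p) / (C + 1) :=
      dz_cluster_closed hcl hcl' ((eventually_ge_atTop s).mono fun t hst =>
        (hfence t hst).trans (by
          have := hVp t (hs.trans hst)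
          gcongr))
    rw [le_div_iff₀ hc, norm_sub_rev] at h1
    have h2 : V s - dzV b p ≤ C * ‖x s - p‖ := hsP (hx s hs)
    have h3 : ‖x s - p‖ ≤ 0 := by linarith
    have h4 : x s = p := sub_eq_zero.1 (norm_le_zero_iff.1 h3)
    have := hx s hs l
    rw [h4, hpl] at this
    exact lt_irrefl _ this

/-- Let `(G, k)` be a mass-action system whose network is weakly
reversible, has a single linkage class (i.e. is strongly connected) with vertices
`y 1, …, y m ∈ ℝ^n`, and has deficiency zero (`dim S = m - 1`), with positive rate
constants. Then every stoichiometric compatibility class admits a globally attracting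
positive steady state: for every `x₀ ∈ ℝ^n_{>0}` there is `x̃ ∈ (x₀ + S) ∩ ℝ^n_{>0}`
which is a steady state of the mass-action ODE and to which every positive solution of
the ODE starting in `(x₀ + S) ∩ ℝ^n_{>0}` converges as `t → ∞`. -/
theorem deficiency_zero_single_linkage_global_attractor
    {n m : ℕ} (y : Fin m → Fin n → ℝ) (hy : Function.Injective y)
    (E : Fin m → Fin m → Prop) [DecidableRel E]
    (hE_noself : ∀ i, ¬ E i i)
    (hconn : ∀ i j : Fin m, Relation.ReflTransGen E i j)
    (k : Fin m → Fin m → ℝ) (hk : ∀ i j, E i j → 0 < k i j)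
    (S : Submodule ℝ (Fin n → ℝ))
    (hS : S = Submodule.span ℝ {d | ∃ i j, E i j ∧ d = y j - y i})
    (hdef : Module.finrank ℝ S = m - 1) :
    ∀ x₀ : Fin n → ℝ, (∀ l, 0 < x₀ l) →
      ∃ xt : Fin n → ℝ,
        xt - x₀ ∈ S ∧ (∀ l, 0 < xt l) ∧
        (∑ i, ∑ j ∈ Finset.univ.filter (fun j => E i j),
            k i j • (∏ l, xt l ^ y i l) • (y j - y i)) = 0 ∧
        ∀ x : ℝ → Fin n → ℝ,
          (∀ t ∈ Set.Ici (0 : ℝ), ∀ l, 0 < x t l) →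
          (∀ t ∈ Set.Ici (0 : ℝ), HasDerivWithinAt x
              (∑ i, ∑ j ∈ Finset.univ.filter (fun j => E i j),
                k i j • (∏ l, x t l ^ y i l) • (y j - y i))
              (Set.Ici 0) t) →
          x 0 - x₀ ∈ S →
          Tendsto x atTop (nhds xt) := by
  
  intro x₀ hx₀
  classical
  let K : Fin m → Fin m → ℝ := fun i j => if E i j then k i j else 0
  have hK0 : ∀ i j, 0 ≤ K i j := by
    intro i j
    by_cases h : E i j
    · simp [K, h, (hk i j h).le]
    · simp [K, h]
  have hKE : ∀ i j, E i j → 0 < K i j := fun i j h => by simp [K, h, hk i j h]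
  obtain ⟨c, hc, hcb⟩ := dz_kernel K hK0 E hKE hconn
  obtain ⟨hdS, hw⟩ := dz_exists_w y E hconn S hS hdef
  obtain ⟨w, hw⟩ := hw (fun i => Real.log (c i))
  obtain ⟨xt, hxt, hxtS, hxtw⟩ := dz_birch S (fun l => Real.exp (w l)) x₀
    (fun l => Real.exp_pos _) hx₀
  have hS' : S = Submodule.span ℝ (Set.range fun q : Fin m × Fin m => y q.2 - y q.1) := by
    apply le_antisymm
    · rw [hS]
      apply Submodule.span_mono
      rintro _ ⟨i, j, _, rfl⟩
      exact ⟨(i, j), rfl⟩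
    · rw [Submodule.span_le]
      rintro _ ⟨q, rfl⟩
      exact hdS _ _
  have hmono : ∀ z : Fin n → ℝ, (∀ l, 0 < z l) → ∀ i,
      ∏ l, z l ^ y i l = Real.exp (y i ⬝ᵥ fun l => Real.log (z l)) := by
    intro z hz i
    rw [dotProduct, Real.exp_sum]
    exact Finset.prod_congr rfl fun l _ => by rw [Real.rpow_def_of_pos (hz l), mul_comm]
  let a : Fin m → ℝ := fun i => ∏ l, xt l ^ y i l
  have ha : ∀ i, 0 < a i := fun i => Finset.prod_pos fun l _ => Real.rpow_pos_of_pos (hxt l) _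
  have hac : ∀ i j, a i * c j = a j * c i := by
    intro i j
    have h1 := hxtw _ (hdS i j)
    have h2 := hw i j
    have e : (fun l => Real.log (xt l) - Real.log (Real.exp (w l)))
        = (fun l => Real.log (xt l)) - w := by
      ext l; simp
    rw [e, dotProduct_sub, h2, sub_dotProduct] at h1
    simp only [a, hmono xt hxt]
    rw [← Real.exp_log (hc j), ← Real.exp_log (hc i), ← Real.exp_add, ← Real.exp_add]
    congr 1
    linarith
  let κ : Fin m → Fin m → ℝ := fun i j => K i j * a i
  have hκ : ∀ i j, 0 ≤ κ i j := fun i j => mul_nonneg (hK0 i j) (ha i).le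
  have hκE : ∀ i j, E i j → 0 < κ i j := fun i j h => mul_pos (hKE i j h) (ha i)
  have hbal : ∀ j, ∑ i, κ i j = ∑ i, κ j i := by
    intro j
    have h1 := hcb j
    have h2 : (∑ i, κ i j) * c j = (∑ i, κ j i) * c j := by
      calc (∑ i, κ i j) * c j = (∑ i, K i j * c i) * a j := by
            rw [Finset.sum_mul, Finset.sum_mul]
            refine Finset.sum_congr rfl fun i _ => ?_
            simp only [κ]
            rw [mul_assoc, hac i j]; ring
        _ = (∑ i, κ j i) * c j := by
            rw [h1]
            simp only [κ]
            rw [← Finset.sum_mul]; ring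
    exact mul_right_cancel₀ (hc j).ne' h2
  have hfield : ∀ z : Fin n → ℝ, (∀ l, 0 < z l) →
      (∑ i, ∑ j ∈ Finset.univ.filter (fun j => E i j),
        k i j • (∏ l, z l ^ y i l) • (y j - y i)) = dzf y κ xt z := by
    intro z hz
    unfold dzf
    refine Finset.sum_congr rfl fun i _ => ?_
    rw [Finset.sum_filter]
    refine Finset.sum_congr rfl fun j _ => ?_
    have e : ∏ l, z l ^ y i l = a i * Real.exp (y i ⬝ᵥ dzw xt z) := by
      simp only [a]
      rw [hmono z hz, hmono xt hxt, ← Real.exp_add, ← dotProduct_add]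
      congr 2
      ext l
      simp [dzw]
    rw [e]
    by_cases h : E i j
    · simp only [h, if_true, κ, K, smul_smul]
      congr 1; ring
    · simp [h, κ, K]
  refine ⟨xt, hxtS, hxt, ?_, ?_⟩
  · rw [hfield xt hxt]
    have e : dzw xt xt = 0 := by ext l; simp [dzw]
    unfold dzf
    simp only [e, dotProduct_zero, Real.exp_zero, mul_one, smul_sub, Finset.sum_sub_distrib]
    rw [Finset.sum_comm]
    simp only [← Finset.sum_smul, hbal, sub_self]
  · intro x hx hd h0
    refine dz_dyn y κ hκ E hκE hconn hbal S hS' xt hxt x hx (fun t ht => ?_) ?_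
    · rw [← hfield (x t) (hx t ht)]
      exact hd t ht
    · have e : x 0 - xt = (x 0 - x₀) - (xt - x₀) := by abel
      rw [e]
      exact S.sub_mem h0 hxtS
end

section
/- Let (G, k) be a mass-action system whose reaction network G is weakly reversible, has a single linkage class with vertices y_1, …, y_m ∈ ℝ^n, and has deficiency one (dim S = m − 2), with positive rate constants k. Then every stoichiometric compatibility class contains exactly one positive steady state: for every x_0 ∈ ℝ^n_{>0} there exists a unique x* ∈ (x_0 + S) ∩ ℝ^n_{>0} such that Σ_{y_i→y_j ∈ E} k_{ij} (x*)^{y_i}(y_j − y_i) = 0. -/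
open Finset

namespace DefOne
section Lap
variable {ι : Type*} [Fintype ι]

/-- The kinetic (Laplacian) operator. -/
noncomputable def lap (w : ι → ι → ℝ) : (ι → ℝ) →ₗ[ℝ] (ι → ℝ) where
  toFun p := fun j => ∑ i, (w i j * p i - w j i * p j)
  map_add' p q := by
    funext j; simp only [Pi.add_apply, ← Finset.sum_add_distrib]
    exact Finset.sum_congr rfl fun i _ => by ring
  map_smul' a p := by
    funext j; simp only [Pi.smul_apply, smul_eq_mul, RingHom.id_apply, Finset.mul_sum]
    exact Finset.sum_congr rfl fun i _ => by ring

lemma lap_apply (w : ι → ι → ℝ) (p : ι → ℝ) (j : ι) :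
    lap w p j = ∑ i, (w i j * p i - w j i * p j) := rfl

lemma lap_pair (w : ι → ι → ℝ) (p g : ι → ℝ) :
    ∑ j, lap w p j * g j = ∑ i, ∑ j, w i j * p i * (g j - g i) := by
  simp only [lap_apply, Finset.sum_mul, sub_mul, mul_sub, Finset.sum_sub_distrib]
  rw [Finset.sum_comm]

lemma lap_sum (w : ι → ι → ℝ) (p : ι → ℝ) : ∑ j, lap w p j = 0 := by
  have := lap_pair w p (fun _ => 1)
  simpa using this

set_option linter.unusedSectionVars false in
lemma cross {w : ι → ι → ℝ}
    (hconn : ∀ i j, Relation.ReflTransGen (fun i j => 0 < w i j) i j)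
    (P : ι → Prop) {a b : ι} (ha : ¬ P a) (hb : P b) :
    ∃ i j, 0 < w i j ∧ ¬ P i ∧ P j := by
  by_contra hcon
  push Not at hcon
  have : ∀ x, Relation.ReflTransGen (fun i j => 0 < w i j) a x → ¬ P x := by
    intro x hx
    induction hx with
    | refl => exact ha
    | tail _ h ih => exact hcon _ _ h ih
  exact this b (hconn a b) hb

lemma keyK {w : ι → ι → ℝ} (hw : ∀ i j, 0 ≤ w i j) {c : ι → ℝ} (hc : ∀ i, 0 < c i)
    (hcA : lap w c = 0) (G : ι → ℝ) (Q : ι → ι → ℝ) (hQ : ∀ i j, G j - G i ≤ Q i j)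
    (hs : ∃ i j, 0 < w i j ∧ G j - G i < Q i j) :
    0 < ∑ i, ∑ j, w i j * c i * Q i j := by
  have h0 : ∑ i, ∑ j, w i j * c i * (G j - G i) = 0 := by
    rw [← lap_pair, hcA]; simp
  rw [← h0]
  obtain ⟨a, b, hab, hlt⟩ := hs
  have hle : ∀ i j, w i j * c i * (G j - G i) ≤ w i j * c i * Q i j := fun i j =>
    mul_le_mul_of_nonneg_left (hQ i j) (mul_nonneg (hw i j) (hc i).le)
  refine Finset.sum_lt_sum (fun i _ => Finset.sum_le_sum fun j _ => hle i j) ⟨a, mem_univ _, ?_⟩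
  exact Finset.sum_lt_sum (fun j _ => hle a j)
    ⟨b, mem_univ _, mul_lt_mul_of_pos_left hlt (mul_pos hab (hc a))⟩

lemma exists_pos_ker [Nonempty ι] {w : ι → ι → ℝ} (hw : ∀ i j, 0 ≤ w i j)
    (hconn : ∀ i j, Relation.ReflTransGen (fun i j => 0 < w i j) i j) :
    ∃ c : ι → ℝ, (∀ i, 0 < c i) ∧ lap w c = 0 := by
  classical
  obtain ⟨c, hc0, hcA⟩ : ∃ c : ι → ℝ, c ≠ 0 ∧ lap w c = 0 := by
    by_contra hcon
    push Not at hcon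
    have hinj : Function.Injective (lap w) := by
      rw [← LinearMap.ker_eq_bot, LinearMap.ker_eq_bot']
      intro p hp
      by_contra h
      exact hcon p h hp
    have hsurj := LinearMap.injective_iff_surjective.mp hinj
    obtain ⟨p, hp⟩ := hsurj (fun _ => 1)
    have := lap_sum w p
    rw [hp] at this
    simp at this
  have hnn : ∀ j, 0 ≤ lap w (fun i => |c i|) j := by
    intro j
    have h1 := congrFun hcA j
    simp only [lap_apply, Finset.sum_sub_distrib, Pi.zero_apply, ← Finset.sum_mul] at h1 ⊢
    have h2 : (∑ i, w j i) * |c j| = |∑ i, w i j * c i| := by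
      rw [sub_eq_zero.mp h1, abs_mul, abs_of_nonneg (Finset.sum_nonneg fun i _ => hw j i)]
    rw [h2]
    have h3 := Finset.abs_sum_le_sum_abs (fun i => w i j * c i) univ
    simp only [abs_mul, abs_of_nonneg (hw _ _)] at h3
    linarith
  have hz : lap w (fun i => |c i|) = 0 := by
    funext j
    exact (Finset.sum_eq_zero_iff_of_nonneg (fun j _ => hnn j)).mp (lap_sum w _) j (mem_univ j)
  refine ⟨fun i => |c i|, ?_, hz⟩
  obtain ⟨a, ha⟩ := Function.ne_iff.mp hc0
  intro b
  by_contra hb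
  obtain ⟨i, j, hij, hi, hj⟩ := cross hconn (fun x => c x = 0) (a := a) (b := b) (by simpa using ha)
    (by simpa using hb)
  have h1 := congrFun hz j
  simp only [lap_apply, hj, abs_zero, mul_zero, sub_zero, Pi.zero_apply] at h1
  have h2 := (Finset.sum_eq_zero_iff_of_nonneg
    (fun i _ => mul_nonneg (hw i j) (abs_nonneg (c i)))).mp h1 i (mem_univ i)
  have h3 : 0 < |c i| := abs_pos.mpr hi
  nlinarith [mul_pos hij h3]

variable {w : ι → ι → ℝ}

/-- Quadratic dissipation. -/
lemma quad_neg (hw : ∀ i j, 0 ≤ w i j)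
    (hconn : ∀ i j, Relation.ReflTransGen (fun i j => 0 < w i j) i j)
    {c : ι → ℝ} (hc : ∀ i, 0 < c i) (hcA : lap w c = 0) (θ : ι → ℝ) {a b : ι} (hab : θ a ≠ θ b) :
    ∑ i, lap w (fun i => c i * θ i) i * θ i < 0 := by
  obtain ⟨i, j, hij, hi, hj⟩ := cross hconn (fun x => θ x = θ b) hab rfl
  have := keyK hw hc hcA (fun i => - θ i ^ 2 / 2) (fun i j => - (θ i * (θ j - θ i)))
    (fun i j => by nlinarith [sq_nonneg (θ i - θ j)])
    ⟨i, j, hij, by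
      have : θ i - θ j ≠ 0 := by rw [hj]; exact sub_ne_zero.mpr hi
      have := sq_pos_of_ne_zero this
      nlinarith⟩
  rw [lap_pair]
  rw [← neg_pos, ← Finset.sum_neg_distrib]
  simp only [← Finset.sum_neg_distrib]
  convert this using 4
  ring

lemma ker_lap (hw : ∀ i j, 0 ≤ w i j)
    (hconn : ∀ i j, Relation.ReflTransGen (fun i j => 0 < w i j) i j)
    {c : ι → ℝ} (hc : ∀ i, 0 < c i) (hcA : lap w c = 0) [Nonempty ι]
    {p : ι → ℝ} (hp : lap w p = 0) : ∃ s : ℝ, p = s • c := by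
  obtain ⟨a⟩ := ‹Nonempty ι›
  refine ⟨p a / c a, ?_⟩
  funext b
  by_contra hne
  have hne' : p a / c a ≠ p b / c b := by
    intro h
    apply hne
    rw [h]
    simp [(hc b).ne']
  have := quad_neg hw hconn hc hcA (fun i => p i / c i) hne'
  have h2 : (fun i => c i * (p i / c i)) = p := by
    funext i; have := (hc i).ne'; field_simp
  rw [h2, hp] at this
  simp at this

lemma deriv_neg' (hw : ∀ i j, 0 ≤ w i j)
    (hconn : ∀ i j, Relation.ReflTransGen (fun i j => 0 < w i j) i j)
    {c : ι → ℝ} (hc : ∀ i, 0 < c i) (hcA : lap w c = 0) (θ : ι → ℝ) {a b : ι} (hab : θ a ≠ θ b)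
    (t : ℝ) (ht : ∀ i, 0 < 1 + t * θ i) :
    ∑ i, lap w (fun i => c i * θ i) i * (θ i / (1 + t * θ i)) < 0 := by
  by_cases h0 : t = 0
  · subst h0
    simpa using quad_neg hw hconn hc hcA θ hab
  set d := lap w (fun i => c i * θ i) with hd
  have hdr : lap w (fun i => c i * (1 + t * θ i)) = t • d := by
    have : (fun i => c i * (1 + t * θ i)) = c + t • (fun i => c i * θ i) := by
      funext i; simp; ring
    rw [this, map_add, map_smul, hcA, zero_add]
  obtain ⟨i, j, hij, hi, hj⟩ := cross hconn (fun x => θ x = θ b) hab rfl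
  have hlog : ∀ x y : ℝ, 0 < x → 0 < y → -Real.log y - -Real.log x ≤ x * (1 / y - 1 / x) := by
    intro x y hx hy
    have := Real.log_le_sub_one_of_pos (div_pos hx hy)
    rw [Real.log_div hx.ne' hy.ne'] at this
    have e : x * (1 / y - 1 / x) = x / y - 1 := by field_simp
    rw [e]; linarith
  have hlog' : ∀ x y : ℝ, 0 < x → 0 < y → x ≠ y → 
      -Real.log y - -Real.log x < x * (1 / y - 1 / x) := by
    intro x y hx hy hxy
    have := Real.log_lt_sub_one_of_pos (div_pos hx hy) (by rwa [Ne, div_eq_one_iff_eq hy.ne'])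
    rw [Real.log_div hx.ne' hy.ne'] at this
    have e : x * (1 / y - 1 / x) = x / y - 1 := by field_simp
    rw [e]; linarith
  have key := keyK hw hc hcA (fun i => - Real.log (1 + t * θ i))
    (fun i j => (1 + t * θ i) * (1 / (1 + t * θ j) - 1 / (1 + t * θ i)))
    (fun i j => hlog _ _ (ht i) (ht j))
    ⟨i, j, hij, hlog' _ _ (ht i) (ht j) (by
      intro h
      apply hi
      have : t * θ i = t * θ j := by linarith
      rw [mul_left_cancel₀ h0 this, hj])⟩
  have h1 : 0 < t * ∑ i, d i * (1 / (1 + t * θ i)) := by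
    have h := lap_pair w (fun i => c i * (1 + t * θ i)) (fun i => 1 / (1 + t * θ i))
    rw [hdr] at h
    rw [Finset.mul_sum]
    calc (0:ℝ) < _ := key
      _ = ∑ i, ∑ j, w i j * (c i * (1 + t * θ i)) * (1 / (1 + t * θ j) - 1 / (1 + t * θ i)) := by
        refine Finset.sum_congr rfl fun i _ => Finset.sum_congr rfl fun j _ => by ring
      _ = _ := by
        rw [← h]
        refine Finset.sum_congr rfl fun i _ => by simp [mul_assoc]
  have h2 : t ^ 2 * ∑ i, d i * (θ i / (1 + t * θ i)) = - (t * ∑ i, d i * (1 / (1 + t * θ i))) := by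
    have h3 : t * ∑ i, d i = 0 := by rw [hd, lap_sum]; simp
    have h4 : ∑ i, t * (t * (d i * (θ i / (1 + t * θ i))) + d i * (1 / (1 + t * θ i)))
        = ∑ i, t * d i := by
      refine Finset.sum_congr rfl fun i _ => ?_
      have := (ht i).ne'
      field_simp
      ring
    simp only [← Finset.mul_sum, Finset.sum_add_distrib] at h4
    rw [h3] at h4
    linarith
  have h3 : 0 < t ^ 2 := by positivity
  by_contra hcon
  push Not at hcon
  have := mul_nonneg h3.le hcon
  linarith

lemma log_strictAnti (hw : ∀ i j, 0 ≤ w i j)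
    (hconn : ∀ i j, Relation.ReflTransGen (fun i j => 0 < w i j) i j)
    {c : ι → ℝ} (hc : ∀ i, 0 < c i) (hcA : lap w c = 0) (θ : ι → ℝ) {a b : ι} (hab : θ a ≠ θ b) :
    StrictAntiOn (fun t : ℝ => ∑ i, lap w (fun i => c i * θ i) i * Real.log (1 + t * θ i))
      {t | ∀ i, 0 < 1 + t * θ i} := by
  have hD : ∀ t : ℝ, (∀ i, 0 < 1 + t * θ i) →
      HasDerivAt (fun t : ℝ => ∑ i, lap w (fun i => c i * θ i) i * Real.log (1 + t * θ i))
        (∑ i, lap w (fun i => c i * θ i) i * (θ i / (1 + t * θ i))) t := by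
    intro t ht
    refine HasDerivAt.fun_sum fun i _ => ?_
    refine HasDerivAt.const_mul _ ?_
    have h1 : HasDerivAt (fun t : ℝ => 1 + t * θ i) (θ i) t := by
      simpa using ((hasDerivAt_id t).mul_const (θ i)).const_add 1
    exact h1.log (ht i).ne'
  have hconv : Convex ℝ {t : ℝ | ∀ i, 0 < 1 + t * θ i} := by
    intro x hx y hy p q hp hq hpq i
    have h1 := hx i
    have h2 := hy i
    have e : 1 + (p • x + q • y) * θ i = p * (1 + x * θ i) + q * (1 + y * θ i) := by
      simp only [smul_eq_mul]
      linear_combination (-1 : ℝ) * hpq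
    rw [e]
    rcases hp.eq_or_lt with h | h
    · have : q = 1 := by linarith
      subst this; rw [← h]; linarith
    · have := mul_pos h h1
      have := mul_nonneg hq h2.le
      linarith
  refine strictAntiOn_of_deriv_neg hconv (fun t ht => (hD t ht).continuousAt.continuousWithinAt) ?_
  intro t ht
  have ht' := interior_subset ht
  rw [(hD t ht').deriv]
  exact deriv_neg' hw hconn hc hcA θ hab t ht'

lemma min_flux [DecidableEq ι] (hw : ∀ i j, 0 ≤ w i j)
    (hconn : ∀ i j, Relation.ReflTransGen (fun i j => 0 < w i j) i j)
    {c : ι → ℝ} (hc : ∀ i, 0 < c i) (hcA : lap w c = 0) (θ : ι → ℝ) {a b : ι} (hab : θ b < θ a)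
    (hmin : ∀ i, θ b ≤ θ i) :
    0 < ∑ i with θ i = θ b, lap w (fun i => c i * θ i) i := by
  classical
  obtain ⟨i, j, hij, hi, hj⟩ := cross hconn (fun x => θ x = θ b) hab.ne' rfl
  have key := keyK hw hc hcA (fun i => θ b * if θ i = θ b then 1 else 0)
    (fun i j => θ i * ((if θ j = θ b then 1 else 0) - (if θ i = θ b then 1 else 0)))
    (fun i j => by
      have := hmin i
      by_cases h1 : θ i = θ b <;> by_cases h2 : θ j = θ b <;> simp [h1, h2, this])
    ⟨i, j, hij, by
      have := lt_of_le_of_ne (hmin i) (Ne.symm hi)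
      simp [hi, hj, this]⟩
  have h := lap_pair w (fun i => c i * θ i) (fun i => if θ i = θ b then 1 else 0)
  simp only [mul_ite, mul_one, mul_zero] at h
  rw [Finset.sum_filter, h]
  simpa only [mul_assoc] using key

open Filter Topology in
/-- The function takes arbitrarily negative values. -/
lemma exists_le (hw : ∀ i j, 0 ≤ w i j)
    (hconn : ∀ i j, Relation.ReflTransGen (fun i j => 0 < w i j) i j)
    {c : ι → ℝ} (hc : ∀ i, 0 < c i) (hcA : lap w c = 0) (θ : ι → ℝ) {a b : ι}
    (ha : 0 < θ a) (hb : θ b < 0) (M : ℝ) :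
    ∃ t : ℝ, 0 < t ∧ (∀ i, 0 < 1 + t * θ i) ∧
      ∑ i, lap w (fun i => c i * θ i) i * Real.log (1 + t * θ i) ≤ M := by
  classical
  have : Nonempty ι := ⟨a⟩
  obtain ⟨b', hb'⟩ := Finite.exists_min θ
  have hneg : θ b' < 0 := lt_of_le_of_lt (hb' b) hb
  have hflux := min_flux hw hconn hc hcA θ (a := a) (b := b') (by linarith) hb'
  set d := lap w (fun i => c i * θ i) with hd
  set T := -1 / θ b' with hT
  have hTpos : 0 < T := div_pos_of_neg_of_neg (by norm_num) hneg
  have hTb : 1 + T * θ b' = 0 := by rw [hT, div_mul_cancel₀ _ hneg.ne]; ring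
  have hpos : ∀ t, 0 < t → t < T → ∀ i, 0 < 1 + t * θ i := by
    intro t h0 h1 i
    have := mul_le_mul_of_nonneg_left (hb' i) h0.le
    have : T * θ b' < t * θ b' := mul_lt_mul_of_neg_right h1 hneg
    linarith
  have hlim1 : Tendsto (fun t : ℝ => 1 + t * θ b') (𝓝[<] T) (𝓝[>] 0) := by
    rw [tendsto_nhdsWithin_iff]
    constructor
    · have : ContinuousAt (fun t : ℝ => 1 + t * θ b') T := by fun_prop
      have h := this.tendsto
      simp only [hTb] at h
      exact h.mono_left nhdsWithin_le_nhds
    · filter_upwards [Ioo_mem_nhdsLT hTpos] with t ht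
      exact hpos t ht.1 ht.2 b'
  have hlim2 : Tendsto (fun t : ℝ => (∑ i with θ i = θ b', d i) * Real.log (1 + t * θ b'))
      (𝓝[<] T) atBot := by
    exact (Real.tendsto_log_nhdsGT_zero.comp hlim1).const_mul_atBot hflux
  have hlim3 : Tendsto (fun t : ℝ => ∑ i with ¬ θ i = θ b', d i * Real.log (1 + t * θ i))
      (𝓝[<] T) (𝓝 (∑ i with ¬ θ i = θ b', d i * Real.log (1 + T * θ i))) := by
    refine tendsto_finsetSum _ fun i hi => ?_
    have hi' : θ b' < θ i := lt_of_le_of_ne (hb' i) (Ne.symm (by simpa using hi))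
    have h1 : 0 < 1 + T * θ i := by
      have := mul_lt_mul_of_pos_left hi' hTpos
      linarith
    have : ContinuousAt (fun t : ℝ => d i * Real.log (1 + t * θ i)) T := by
      refine ContinuousAt.mul continuousAt_const (ContinuousAt.log (by fun_prop) h1.ne')
    exact this.tendsto.mono_left nhdsWithin_le_nhds
  have hsum := hlim2.atBot_add hlim3
  have hev := hsum.eventually (eventually_le_atBot M)
  obtain ⟨t, htM, ht⟩ := (hev.and (Ioo_mem_nhdsLT hTpos)).exists
  refine ⟨t, ht.1, hpos t ht.1 ht.2, ?_⟩
  refine le_trans (le_of_eq ?_) htM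
  rw [← Finset.sum_filter_add_sum_filter_not univ (fun i => θ i = θ b'), Finset.sum_mul]
  congr 1
  refine Finset.sum_congr rfl fun i hi => ?_
  rw [(by simpa using hi : θ i = θ b')]

lemma exists_eq (hw : ∀ i j, 0 ≤ w i j)
    (hconn : ∀ i j, Relation.ReflTransGen (fun i j => 0 < w i j) i j)
    {c : ι → ℝ} (hc : ∀ i, 0 < c i) (hcA : lap w c = 0) (θ : ι → ℝ) {a b : ι}
    (ha : 0 < θ a) (hb : θ b < 0) (M : ℝ) :
    ∃ t : ℝ, (∀ i, 0 < 1 + t * θ i) ∧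
      ∑ i, lap w (fun i => c i * θ i) i * Real.log (1 + t * θ i) = M := by
  obtain ⟨t₁, ht₁, hp₁, hM₁⟩ := exists_le hw hconn hc hcA θ ha hb M
  obtain ⟨t₂, ht₂, hp₂, hM₂⟩ := exists_le hw hconn hc hcA (fun i => - θ i) (a := b) (b := a)
    (by simpa using hb) (by simpa using ha) (-M)
  have e : (fun i => c i * -θ i) = - (fun i => c i * θ i) := by funext i; simp
  rw [e, map_neg] at hM₂
  simp only [Pi.neg_apply, neg_mul, Finset.sum_neg_distrib, neg_le_neg_iff, mul_neg] at hM₂ hp₂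
  have hpos : ∀ t ∈ Set.Icc (-t₂) t₁, ∀ i, 0 < 1 + t * θ i := by
    intro t ht i
    have h1 := hp₁ i
    have h2 := hp₂ i
    rcases le_total 0 (θ i) with h | h
    · have := mul_le_mul_of_nonneg_right ht.1 h
      linarith
    · have := mul_le_mul_of_nonpos_right ht.2 h
      linarith
  have hcont : ContinuousOn
      (fun t : ℝ => ∑ i, lap w (fun i => c i * θ i) i * Real.log (1 + t * θ i))
      (Set.Icc (-t₂) t₁) := by
    refine continuousOn_finsetSum _ fun i _ => ?_
    refine ContinuousOn.mul continuousOn_const (ContinuousOn.log (by fun_prop) ?_)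
    exact fun t ht => (hpos t ht i).ne'
  obtain ⟨t, ht, hft⟩ := intermediate_value_Icc' (by linarith) hcont ⟨hM₁, by simpa using hM₂⟩
  exact ⟨t, hpos t ht, hft⟩

end Lap
end DefOne

namespace DefOne
section Birch
variable {n : ℕ}

/-- Orthogonal complement with respect to the standard pairing. -/
def orth (S : Submodule ℝ (Fin n → ℝ)) : Submodule ℝ (Fin n → ℝ) where
  carrier := {v | ∀ s ∈ S, ∑ l, v l * s l = 0}
  add_mem' {a b} ha hb s hs := by
    simp only [Pi.add_apply, add_mul, Finset.sum_add_distrib, ha s hs, hb s hs, add_zero]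
  zero_mem' s _ := by simp
  smul_mem' r v hv s hs := by
    simp only [Pi.smul_apply, smul_eq_mul, mul_assoc, ← Finset.mul_sum, hv s hs, mul_zero]

lemma mem_of_orth (S : Submodule ℝ (Fin n → ℝ)) (x : Fin n → ℝ)
    (h : ∀ v ∈ orth S, ∑ l, v l * x l = 0) : x ∈ S := by
  by_contra hx
  obtain ⟨f, hfx, hf⟩ := Submodule.exists_le_ker_of_notMem hx
  have hrep : ∀ z : Fin n → ℝ, f z = ∑ l, f (Pi.single l 1) * z l := by
    intro z
    conv_lhs => rw [pi_eq_sum_univ' z, map_sum]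
    refine Finset.sum_congr rfl fun l _ => ?_
    rw [map_smul, smul_eq_mul, mul_comm]
  refine hfx ?_
  rw [hrep]
  refine h _ ?_
  intro s hs
  rw [← hrep]
  exact hf hs

lemma birch_unique (S : Submodule ℝ (Fin n → ℝ)) (x x' : Fin n → ℝ)
    (hx : ∀ l, 0 < x l) (hx' : ∀ l, 0 < x' l) (hS : x - x' ∈ S)
    (ho : (fun l => Real.log (x l) - Real.log (x' l)) ∈ orth S) : x = x' := by
  have h := ho _ hS
  have hnn : ∀ l, 0 ≤ (Real.log (x l) - Real.log (x' l)) * (x - x') l := by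
    intro l
    rcases le_total (x l) (x' l) with h | h
    · have := Real.log_le_log (hx l) h
      exact mul_nonneg_of_nonpos_of_nonpos (by linarith) (by simpa using h)
    · have := Real.log_le_log (hx' l) h
      exact mul_nonneg (by linarith) (by simpa using h)
  funext l
  have h0 := (Finset.sum_eq_zero_iff_of_nonneg (fun l _ => hnn l)).mp h l (mem_univ l)
  rcases mul_eq_zero.mp h0 with h1 | h1
  · exact Real.log_injOn_pos (hx l) (hx' l) (sub_eq_zero.mp h1)
  · simpa [sub_eq_zero] using h1

lemma scalar_bound (a b v : ℝ) (ha : 0 < a) (hb : 0 < b) :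
    b * |v| - |2 * b * (1 - Real.log (2 * b / a))| ≤ a * Real.exp v - b * v := by
  rcases le_total v 0 with h | h
  · rw [abs_of_nonpos h]
    have := abs_nonneg (2 * b * (1 - Real.log (2 * b / a)))
    have := mul_pos ha (Real.exp_pos v)
    linarith
  · rw [abs_of_nonneg h]
    have h1 := Real.add_one_le_exp (v - Real.log (2 * b / a))
    rw [Real.exp_sub, Real.exp_log (by positivity)] at h1
    have h2 : a * Real.exp v = 2 * b * (Real.exp v / (2 * b / a)) := by field_simp
    have h3 := mul_le_mul_of_nonneg_left h1 (by positivity : 0 ≤ 2 * b)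
    have h4 := neg_abs_le (2 * b * (1 - Real.log (2 * b / a)))
    rw [h2]
    linarith

open Filter in
lemma birch_exists (S : Submodule ℝ (Fin n → ℝ)) (xh x₀ : Fin n → ℝ)
    (hxh : ∀ l, 0 < xh l) (hx₀ : ∀ l, 0 < x₀ l) :
    ∃ v ∈ orth S, (fun l => xh l * Real.exp (v l)) - x₀ ∈ S := by
  let F : orth S → ℝ := fun v => ∑ l, (xh l * Real.exp (v.1 l) - x₀ l * v.1 l)
  have hF : Continuous F := by
    refine continuous_finsetSum _ fun l _ => ?_
    have : Continuous fun v : orth S => v.1 l := (continuous_apply l).comp continuous_subtype_val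
    exact (continuous_const.mul (Real.continuous_exp.comp this)).sub (continuous_const.mul this)
  obtain ⟨β, hβ, hβx⟩ : ∃ β : ℝ, 0 < β ∧ ∀ l, β ≤ x₀ l := by
    rcases isEmpty_or_nonempty (Fin n) with h | h
    · exact ⟨1, one_pos, fun l => h.elim l⟩
    · obtain ⟨l, hl⟩ := Finite.exists_min x₀
      exact ⟨x₀ l, hx₀ l, hl⟩
  set C := ∑ l, |2 * x₀ l * (1 - Real.log (2 * x₀ l / xh l))| with hC
  have hbd : ∀ v : orth S, β * ‖v‖ - C ≤ F v := by
    intro v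
    have h1 : ‖v‖ ≤ ∑ l, |v.1 l| := by
      change ‖v.1‖ ≤ _
      rw [pi_norm_le_iff_of_nonneg (Finset.sum_nonneg fun l _ => abs_nonneg _)]
      intro l
      exact Finset.single_le_sum (f := fun l => |v.1 l|) (fun l _ => abs_nonneg _) (mem_univ l)
    have h2 : β * ∑ l, |v.1 l| - C ≤ F v := by
      rw [hC, Finset.mul_sum, ← Finset.sum_sub_distrib]
      refine Finset.sum_le_sum fun l _ => ?_
      have := scalar_bound (xh l) (x₀ l) (v.1 l) (hxh l) (hx₀ l)
      have := mul_le_mul_of_nonneg_right (hβx l) (abs_nonneg (v.1 l))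
      linarith
    have := mul_le_mul_of_nonneg_left h1 hβ.le
    linarith
  have hlim : Tendsto F (cocompact (orth S)) atTop := by
    refine tendsto_atTop_mono hbd ?_
    refine tendsto_atTop_add_const_right _ _ ?_
    exact (tendsto_norm_cocompact_atTop).const_mul_atTop hβ
  obtain ⟨v, hv⟩ := hF.exists_forall_le hlim
  refine ⟨v.1, v.2, mem_of_orth S _ ?_⟩
  intro u hu
  let g : ℝ → ℝ := fun t =>
    ∑ l, (xh l * Real.exp (v.1 l + t * u l) - x₀ l * (v.1 l + t * u l))
  have hmin : IsLocalMin g 0 := by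
    refine Filter.Eventually.of_forall fun t => ?_
    have := hv (v + t • ⟨u, hu⟩)
    simpa [F, g] using this
  have hder : HasDerivAt g (∑ l, (xh l * (Real.exp (v.1 l + 0 * u l) * u l) - x₀ l * u l)) 0 := by
    refine HasDerivAt.fun_sum fun l _ => ?_
    have h1 : HasDerivAt (fun t : ℝ => v.1 l + t * u l) (u l) 0 := by
      simpa using ((hasDerivAt_id (0:ℝ)).mul_const (u l)).const_add (v.1 l)
    exact (h1.exp.const_mul _).sub (h1.const_mul _)
  have h0 := hmin.hasDerivAt_eq_zero hder
  rw [← h0]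
  refine Finset.sum_congr rfl fun l _ => ?_
  simp only [Pi.sub_apply, zero_mul, add_zero]
  ring

end Birch

section LinAlg
variable {n m : ℕ}

lemma fr_one {V : Type*} [AddCommGroup V] [Module ℝ V] (N : Submodule ℝ V)
    (h : Module.finrank ℝ N = 1) : ∃ d ∈ N, d ≠ 0 ∧ ∀ e ∈ N, ∃ t : ℝ, t • d = e := by
  obtain ⟨⟨d, hd⟩, hd0, hdu⟩ := finrank_eq_one_iff'.mp h
  refine ⟨d, hd, fun h => hd0 (Subtype.ext h), fun e he => ?_⟩
  obtain ⟨t, ht⟩ := hdu ⟨e, he⟩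
  exact ⟨t, congrArg Subtype.val ht⟩

lemma exists_d (hm : 3 ≤ m) (y : Fin m → Fin n → ℝ) (S : Submodule ℝ (Fin n → ℝ))
    (hdiff : ∀ i j, y j - y i ∈ S)
    (hS : S ≤ Submodule.span ℝ {d | ∃ i j, d = y j - y i})
    (hdef : Module.finrank ℝ S = m - 2) :
    ∃ d : Fin m → ℝ, d ≠ 0 ∧ ∑ i, d i = 0 ∧ ∑ i, d i • y i = 0 ∧
      (∀ e : Fin m → ℝ, ∑ i, e i = 0 → ∑ i, e i • y i = 0 → ∃ t : ℝ, e = t • d) ∧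
      (∀ z : Fin m → ℝ, ∑ i, d i * z i = 0 →
        ∃ (u : Fin n → ℝ) (a : ℝ), ∀ i, z i = ∑ l, y i l * u l + a) := by
  classical
  let σ : (Fin m → ℝ) →ₗ[ℝ] ℝ := Fintype.linearCombination ℝ (fun _ : Fin m => (1:ℝ))
  let Y : (Fin m → ℝ) →ₗ[ℝ] (Fin n → ℝ) := Fintype.linearCombination ℝ y
  have hσ : ∀ p, σ p = ∑ i, p i := by
    intro p; simp [σ, Fintype.linearCombination_apply]
  have hY : ∀ p, Y p = ∑ i, p i • y i := by
    intro p; simp [Y, Fintype.linearCombination_apply]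
  have i0 : Fin m := ⟨0, by omega⟩
  have hσs : LinearMap.range σ = ⊤ := by
    rw [LinearMap.range_eq_top]
    intro r
    refine ⟨Pi.single i0 r, ?_⟩
    rw [hσ]; simp
  have hT : Module.finrank ℝ (LinearMap.ker σ) = m - 1 := by
    have := LinearMap.finrank_range_add_finrank_ker σ
    rw [hσs] at this
    simp at this
    omega
  have hr : LinearMap.range (Y.domRestrict (LinearMap.ker σ)) = S := by
    apply le_antisymm
    · rintro _ ⟨⟨p, hp⟩, rfl⟩
      rw [LinearMap.mem_ker, hσ] at hp
      have : Y.domRestrict (LinearMap.ker σ) ⟨p, by rw [LinearMap.mem_ker, hσ]; exact hp⟩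
          = ∑ i, p i • (y i - y i0) := by
        simp only [LinearMap.domRestrict_apply, hY, smul_sub, Finset.sum_sub_distrib,
          ← Finset.sum_smul, hp, zero_smul, sub_zero]
      rw [this]
      exact S.sum_mem fun i _ => S.smul_mem _ (hdiff _ _)
    · refine hS.trans (Submodule.span_le.mpr ?_)
      rintro _ ⟨i, j, rfl⟩
      refine ⟨⟨Pi.single j 1 - Pi.single i 1, ?_⟩, ?_⟩
      · rw [LinearMap.mem_ker, hσ]; simp
      · simp [Y]
  have hk := LinearMap.finrank_range_add_finrank_ker (Y.domRestrict (LinearMap.ker σ))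
  rw [hr, hdef, hT] at hk
  have hk1 : Module.finrank ℝ (LinearMap.ker (Y.domRestrict (LinearMap.ker σ))) = 1 := by omega
  obtain ⟨⟨d, hd1⟩, hd2, hd0, hdu⟩ := fr_one _ hk1
  have hspan : ∀ e : Fin m → ℝ, ∑ i, e i = 0 → ∑ i, e i • y i = 0 → ∃ t : ℝ, e = t • d := by
    intro e h1 h2
    obtain ⟨t, ht⟩ := hdu ⟨e, by rw [LinearMap.mem_ker, hσ]; exact h1⟩ (by
      rw [LinearMap.mem_ker, LinearMap.domRestrict_apply, hY]; exact h2)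
    refine ⟨t, ?_⟩
    have := congrArg Subtype.val ht
    exact this.symm
  refine ⟨d, ?_, ?_, ?_, hspan, ?_⟩
  · rintro rfl
    exact hd0 rfl
  · rw [LinearMap.mem_ker, hσ] at hd1; exact hd1
  · rw [LinearMap.mem_ker, LinearMap.domRestrict_apply, hY] at hd2; exact hd2
  · intro z hz
    let Z : Module.Dual ℝ (Fin m → ℝ) := Fintype.linearCombination ℝ z
    have hZ : ∀ p, Z p = ∑ i, p i * z i := by
      intro p; simp [Z, Fintype.linearCombination_apply]
    have hmem : Z ∈ (LinearMap.ker (Y.prod σ)).dualAnnihilator := by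
      rw [Submodule.mem_dualAnnihilator]
      intro e he
      have he' : (Y e, σ e) = 0 := he
      rw [Prod.mk_eq_zero, hY, hσ] at he'
      obtain ⟨t, rfl⟩ := hspan e he'.2 he'.1
      rw [hZ]
      simp only [Pi.smul_apply, smul_eq_mul, mul_assoc, ← Finset.mul_sum, hz, mul_zero]
    rw [← LinearMap.range_dualMap_eq_dualAnnihilator_ker] at hmem
    obtain ⟨ψ, hψ⟩ := hmem
    refine ⟨fun l => ψ (Pi.single l 1, 0), ψ (0, 1), fun i => ?_⟩
    have h1 : Z (Pi.single i 1) = z i := by simp [Z]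
    rw [← h1, ← hψ, LinearMap.dualMap_apply]
    change ψ (Y (Pi.single i 1), σ (Pi.single i 1)) = _
    have h2 : Y (Pi.single i 1) = y i := by simp [Y]
    have h3 : σ (Pi.single i 1) = 1 := by simp [σ]
    rw [h2, h3]
    have h4 : ((y i, 1) : (Fin n → ℝ) × ℝ)
        = LinearMap.inl ℝ (Fin n → ℝ) ℝ (∑ l, y i l • Pi.single l (1:ℝ)) + (0, 1) := by
      have : ∑ l, y i l • Pi.single l (1:ℝ) = y i := by
        funext j; simp [Pi.single_apply]
      rw [this]; simp
    rw [h4, map_add, map_sum, map_sum]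
    simp only [map_smul, LinearMap.inl_apply, smul_eq_mul]

end LinAlg
end DefOne

namespace DefOne
section Main

lemma lap_surj {ι : Type*} [Fintype ι] [Nonempty ι] {w : ι → ι → ℝ} (hw : ∀ i j, 0 ≤ w i j)
    (hconn : ∀ i j, Relation.ReflTransGen (fun i j => 0 < w i j) i j)
    {c : ι → ℝ} (hc : ∀ i, 0 < c i) (hcA : lap w c = 0) (d : ι → ℝ) (hd : ∑ i, d i = 0) :
    ∃ h, lap w h = d := by
  classical
  have hC : 0 < ∑ i, c i := Finset.sum_pos (fun i _ => hc i) univ_nonempty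
  let B : (ι → ℝ) →ₗ[ℝ] (ι → ℝ) :=
    lap w + (Fintype.linearCombination ℝ (fun _ : ι => (1:ℝ))).smulRight c
  have hB : ∀ p, B p = lap w p + (∑ i, p i) • c := by
    intro p; simp [B, Fintype.linearCombination_apply]
  have hs : ∀ p, ∑ j, B p j = (∑ i, p i) * ∑ i, c i := by
    intro p
    rw [hB]
    simp only [Pi.add_apply, Pi.smul_apply, smul_eq_mul, Finset.sum_add_distrib, lap_sum,
      zero_add, Finset.mul_sum]
  have hinj : Function.Injective B := by
    rw [← LinearMap.ker_eq_bot, LinearMap.ker_eq_bot']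
    intro p hp
    have h1 := hs p
    rw [hp] at h1
    have h2 : ∑ i, p i = 0 := by
      have h1' : (∑ i, p i) * ∑ i, c i = 0 := by rw [← h1]; simp
      exact (mul_eq_zero.mp h1').resolve_right hC.ne'
    rw [hB, h2, zero_smul, add_zero] at hp
    obtain ⟨s, rfl⟩ := ker_lap hw hconn hc hcA hp
    simp only [Pi.smul_apply, smul_eq_mul, ← Finset.mul_sum] at h2
    rw [(mul_eq_zero.mp h2).resolve_right hC.ne', zero_smul]
  obtain ⟨p, hp⟩ := LinearMap.injective_iff_surjective.mp hinj d
  have h1 := hs p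
  rw [hp, hd] at h1
  have h2 := (mul_eq_zero.mp h1.symm).resolve_right hC.ne'
  rw [hB, h2, zero_smul, add_zero] at hp
  exact ⟨p, hp⟩

lemma exists_theta {ι : Type*} [Fintype ι] [Nonempty ι] {w : ι → ι → ℝ}
    (hw : ∀ i j, 0 ≤ w i j)
    (hconn : ∀ i j, Relation.ReflTransGen (fun i j => 0 < w i j) i j)
    {c : ι → ℝ} (hc : ∀ i, 0 < c i) (hcA : lap w c = 0) (d : ι → ℝ) (hd : ∑ i, d i = 0)
    (hd0 : d ≠ 0) :
    ∃ θ : ι → ℝ, lap w (fun i => c i * θ i) = d ∧ (∃ a, 0 < θ a) ∧ (∃ b, θ b < 0) := by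
  obtain ⟨h, rfl⟩ := lap_surj hw hconn hc hcA d hd
  obtain ⟨b, hb⟩ := Finite.exists_min (fun i => h i / c i)
  obtain ⟨a, ha⟩ := Finite.exists_max (fun i => h i / c i)
  have hlt : h b / c b < h a / c a := by
    refine lt_of_le_of_ne (hb a) ?_
    intro heq
    apply hd0
    have : h = (h a / c a) • c := by
      funext i
      have h1 : h b / c b ≤ h i / c i := hb i
      have h2 : h i / c i ≤ h a / c a := ha i
      have h3 : h i / c i = h a / c a := le_antisymm h2 (heq ▸ h1)
      rw [Pi.smul_apply, smul_eq_mul, ← h3]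
      have := (hc i).ne'
      field_simp
    rw [this, map_smul, hcA, smul_zero]
  obtain ⟨r, hr1, hr2⟩ := exists_between hlt
  refine ⟨fun i => h i / c i - r, ?_, ⟨a, by linarith⟩, ⟨b, by linarith⟩⟩
  have : (fun i => c i * (h i / c i - r)) = h - r • c := by
    funext i
    have := (hc i).ne'
    simp only [Pi.sub_apply, Pi.smul_apply, smul_eq_mul]
    field_simp
  rw [this, map_sub, map_smul, hcA, smul_zero, sub_zero]

lemma log_monomial {n : ℕ} (x y : Fin n → ℝ) (hx : ∀ l, 0 < x l) :
    Real.log (∏ l, x l ^ y l) = ∑ l, y l * Real.log (x l) := by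
  rw [Real.log_prod fun l _ => (Real.rpow_pos_of_pos (hx l) _).ne']
  exact Finset.sum_congr rfl fun l _ => Real.log_rpow (hx l) _

lemma main_aux {n m : ℕ} (hm : 3 ≤ m) (y : Fin m → Fin n → ℝ) (w : Fin m → Fin m → ℝ)
    (hw : ∀ i j, 0 ≤ w i j)
    (hconn : ∀ i j, Relation.ReflTransGen (fun i j => 0 < w i j) i j)
    (S : Submodule ℝ (Fin n → ℝ))
    (hdiff : ∀ i j, y j - y i ∈ S)
    (hS : S ≤ Submodule.span ℝ {d | ∃ i j, d = y j - y i})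
    (hdef : Module.finrank ℝ S = m - 2) (x₀ : Fin n → ℝ) (hx₀ : ∀ l, 0 < x₀ l) :
    ∃! xs : Fin n → ℝ, xs - x₀ ∈ S ∧ (∀ l, 0 < xs l) ∧
      ∑ j, lap w (fun i => ∏ l, xs l ^ y i l) j • y j = 0 := by
  have : Nonempty (Fin m) := ⟨⟨0, by omega⟩⟩
  obtain ⟨d, hd0, hds, hdy, hspan, hrep⟩ := exists_d hm y S hdiff hS hdef
  obtain ⟨c, hc, hcA⟩ := exists_pos_ker hw hconn
  obtain ⟨θ, hθ, ⟨a, ha⟩, ⟨b, hb⟩⟩ := exists_theta hw hconn hc hcA d hds hd0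
  obtain ⟨t, ht, hft⟩ := exists_eq hw hconn hc hcA θ ha hb (- ∑ i, d i * Real.log (c i))
  have hanti := log_strictAnti hw hconn hc hcA θ (a := a) (b := b) (by linarith)
  rw [hθ] at hft hanti
  -- every steady state lies on the ray of `t`
  have hray : ∀ x : Fin n → ℝ, (∀ l, 0 < x l) →
      ∑ j, lap w (fun i => ∏ l, x l ^ y i l) j • y j = 0 →
      ∃ s : ℝ, 0 < s ∧ ∀ i, ∏ l, x l ^ y i l = s * (c i * (1 + t * θ i)) := by
    intro x hx hst
    have hpos : ∀ i, 0 < ∏ l, x l ^ y i l := fun i =>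
      Finset.prod_pos fun l _ => Real.rpow_pos_of_pos (hx l) _
    obtain ⟨τ, hτ⟩ := hspan _ (lap_sum w _) hst
    have hker : lap w ((fun i => ∏ l, x l ^ y i l) - τ • (fun i => c i * θ i)) = 0 := by
      rw [map_sub, map_smul, hθ, hτ, sub_self]
    obtain ⟨s, hs⟩ := ker_lap hw hconn hc hcA hker
    have hval : ∀ i, ∏ l, x l ^ y i l = c i * (s + τ * θ i) := by
      intro i
      have := congrFun hs i
      simp only [Pi.sub_apply, Pi.smul_apply, smul_eq_mul] at this
      linarith
    have hq : ∀ i, 0 < s + τ * θ i := by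
      intro i
      have := hpos i
      rw [hval] at this
      exact (mul_pos_iff_of_pos_left (hc i)).mp this
    have hspos : 0 < s := by
      have h1 := hq a
      have h2 := hq b
      rcases le_total 0 τ with h | h
      · have := mul_nonpos_of_nonneg_of_nonpos h hb.le
        linarith
      · have := mul_nonpos_of_nonpos_of_nonneg h ha.le
        linarith
    have hfac : ∀ i, s + τ * θ i = s * (1 + τ / s * θ i) := by
      intro i; field_simp
    have hq' : ∀ i, 0 < 1 + τ / s * θ i := by
      intro i
      have := hq i
      rw [hfac] at this
      exact (mul_pos_iff_of_pos_left hspos).mp this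
    have hlog : ∑ i, d i * Real.log (∏ l, x l ^ y i l) = 0 := by
      simp only [log_monomial x _ hx, Finset.mul_sum]
      rw [Finset.sum_comm]
      refine Finset.sum_eq_zero fun l _ => ?_
      have := congrFun hdy l
      simp only [Finset.sum_apply, Pi.smul_apply, smul_eq_mul, Pi.zero_apply] at this
      simp only [← mul_assoc, ← Finset.sum_mul, this, zero_mul]
    have heq : ∑ i, d i * Real.log (1 + τ / s * θ i) = - ∑ i, d i * Real.log (c i) := by
      have : ∀ i, d i * Real.log (∏ l, x l ^ y i l)
          = d i * Real.log (c i) + d i * Real.log s + d i * Real.log (1 + τ / s * θ i) := by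
        intro i
        rw [hval, hfac, Real.log_mul (hc i).ne' (mul_pos hspos (hq' i)).ne',
          Real.log_mul hspos.ne' (hq' i).ne']
        ring
      simp only [this, Finset.sum_add_distrib, ← Finset.sum_mul, hds, zero_mul] at hlog
      linarith
    have htt : τ / s = t := hanti.injOn hq' ht (heq.trans hft.symm)
    refine ⟨s, hspos, fun i => ?_⟩
    rw [hval, hfac, htt]; ring
  -- orthogonality
  have horth : ∀ v : Fin n → ℝ, (∃ r : ℝ, ∀ i, ∑ l, y i l * v l = r) → v ∈ orth S := by
    rintro v ⟨r, hr⟩ s hs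
    have hs' := hS hs
    induction hs' using Submodule.span_induction with
    | mem x hx =>
      obtain ⟨i, j, rfl⟩ := hx
      simp only [Pi.sub_apply, mul_comm (v _), sub_mul, Finset.sum_sub_distrib, hr, sub_self]
    | zero => simp
    | add p q hp hq ihp ihq =>
      have hle : Submodule.span ℝ {d | ∃ i j, d = y j - y i} ≤ S :=
        Submodule.span_le.mpr (by rintro _ ⟨i, j, rfl⟩; exact hdiff i j)
      simp only [Pi.add_apply, mul_add, Finset.sum_add_distrib, ihp (hle hp), ihq (hle hq), add_zero]
    | smul r p hp ihp =>
      have hle : Submodule.span ℝ {d | ∃ i j, d = y j - y i} ≤ S :=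
        Submodule.span_le.mpr (by rintro _ ⟨i, j, rfl⟩; exact hdiff i j)
      simp only [Pi.smul_apply, smul_eq_mul, mul_left_comm, ← Finset.mul_sum, ihp (hle hp), mul_zero]
  have hp : ∀ i, 0 < c i * (1 + t * θ i) := fun i => mul_pos (hc i) (ht i)
  obtain ⟨u, r, hu⟩ := hrep (fun i => Real.log (c i * (1 + t * θ i))) (by
    have : ∀ i, d i * Real.log (c i * (1 + t * θ i))
        = d i * Real.log (c i) + d i * Real.log (1 + t * θ i) := by
      intro i
      rw [Real.log_mul (hc i).ne' (ht i).ne']; ring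
    simp only [this, Finset.sum_add_distrib]
    linarith)
  obtain ⟨v, hv, hvS⟩ := birch_exists S (fun l => Real.exp (u l)) x₀ (fun l => Real.exp_pos _) hx₀
  refine ⟨fun l => Real.exp (u l) * Real.exp (v l), ⟨hvS, fun l => by positivity, ?_⟩, ?_⟩
  · obtain ⟨i₀⟩ := this
    have hconst : ∀ i, ∑ l, y i l * v l = ∑ l, y i₀ l * v l := by
      intro i
      have := hv _ (hdiff i₀ i)
      simp only [Pi.sub_apply, mul_comm (v _), sub_mul, Finset.sum_sub_distrib] at this
      linarith
    set B := ∑ l, y i₀ l * v l with hB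
    have hψ : (fun i => ∏ l, (Real.exp (u l) * Real.exp (v l)) ^ y i l)
        = Real.exp (B - r) • (c + t • (fun i => c i * θ i)) := by
      funext i
      have hpos : 0 < ∏ l, (Real.exp (u l) * Real.exp (v l)) ^ y i l :=
        Finset.prod_pos fun l _ => Real.rpow_pos_of_pos (by positivity) _
      have h1 : (Real.exp (B - r) • (c + t • (fun i => c i * θ i))) i
          = Real.exp (B - r) * (c i * (1 + t * θ i)) := by
        simp; ring
      rw [h1]
      refine Real.log_injOn_pos hpos (mul_pos (Real.exp_pos _) (hp i)) ?_
      rw [log_monomial _ _ (fun l => by positivity), Real.log_mul (Real.exp_pos _).ne' (hp i).ne',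
        Real.log_exp, hu i, ← hconst i]
      simp only [← Real.exp_add, Real.log_exp, mul_add, Finset.sum_add_distrib]
      ring
    rw [hψ, map_smul, map_add, map_smul, hcA, hθ, zero_add]
    simp only [Pi.smul_apply, smul_eq_mul, mul_smul, ← Finset.smul_sum, hdy, smul_zero]
  · rintro x ⟨hxS, hx, hst⟩
    obtain ⟨s, hs, hxs⟩ := hray x hx hst
    have hx' : ∀ l, 0 < Real.exp (u l) * Real.exp (v l) := fun l => by positivity
    refine birch_unique S x _ hx hx' ?_ ?_
    · have := S.sub_mem hxS hvS
      simpa using this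
    · have e : (fun l => Real.log (x l) - Real.log (Real.exp (u l) * Real.exp (v l)))
          = (fun l => Real.log (x l) - u l) - v := by
        funext l
        simp only [← Real.exp_add, Real.log_exp, Pi.sub_apply]
        ring
      rw [e]
      refine (orth S).sub_mem (horth _ ⟨Real.log s + r, fun i => ?_⟩) hv
      have h1 := log_monomial x (y i) hx
      rw [hxs i, Real.log_mul hs.ne' (hp i).ne', hu i] at h1
      simp only [mul_sub, Finset.sum_sub_distrib]
      linarith

end Main
end DefOne

/-- Let `(G, k)` be a mass-action system whose network is weakly
reversible, has a single linkage class (i.e. is strongly connected) with vertices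
`y 1, …, y m ∈ ℝ^n`, and has deficiency one (`dim S = m - 2`), with positive rate
constants. Then every stoichiometric compatibility class contains exactly one positive
steady state: for every `x₀ ∈ ℝ^n_{>0}` there is a unique `x* ∈ (x₀ + S) ∩ ℝ^n_{>0}`
at which the mass-action right-hand side vanishes. -/
theorem deficiency_one_single_linkage_unique_steady_state
    {n m : ℕ} (y : Fin m → Fin n → ℝ) (hy : Function.Injective y)
    (E : Fin m → Fin m → Prop) [DecidableRel E]
    (hE_noself : ∀ i, ¬ E i i)
    (hconn : ∀ i j : Fin m, Relation.ReflTransGen E i j)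
    (k : Fin m → Fin m → ℝ) (hk : ∀ i j, E i j → 0 < k i j)
    (S : Submodule ℝ (Fin n → ℝ))
    (hS : S = Submodule.span ℝ {d | ∃ i j, E i j ∧ d = y j - y i})
    (hdef : Module.finrank ℝ S = m - 2) :
    ∀ x₀ : Fin n → ℝ, (∀ l, 0 < x₀ l) →
      ∃! xs : Fin n → ℝ,
        xs - x₀ ∈ S ∧ (∀ l, 0 < xs l) ∧
        (∑ i, ∑ j ∈ Finset.univ.filter (fun j => E i j),
            k i j • (∏ l, xs l ^ y i l) • (y j - y i)) = 0 := by
  classical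
  have hall : ∀ i j, y j - y i ∈ S := by
    intro i j
    have h := hconn i j
    induction h with
    | refl => simp
    | @tail b c _ hbc ih =>
      have h1 : y c - y b ∈ S := by
        rw [hS]
        exact Submodule.subset_span ⟨b, c, hbc, rfl⟩
      have := S.add_mem ih h1
      simpa using this
  intro x₀ hx₀
  rcases Nat.lt_or_ge m 3 with hm | hm
  · -- few vertices: the stoichiometric subspace is trivial
    have hfr : Module.finrank ℝ S = 0 := by omega
    have hbot : S = ⊥ := Submodule.finrank_eq_zero.mp hfr
    have heq : ∀ i j : Fin m, y j - y i = 0 := by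
      intro i j
      have := hall i j
      rw [hbot] at this
      simpa using this
    refine ⟨x₀, ⟨by simp, hx₀, ?_⟩, ?_⟩
    · simp only [heq, smul_zero, Finset.sum_const_zero]
    · rintro x ⟨hx, -, -⟩
      rw [hbot, Submodule.mem_bot, sub_eq_zero] at hx
      exact hx
  · have hmain := DefOne.main_aux hm y (fun i j => if E i j then k i j else 0)
      (fun i j => by
        by_cases h : E i j
        · simp only [h, if_true]; exact (hk i j h).le
        · simp [h])
      (fun i j => by
        have h := hconn i j
        induction h with
        | refl => exact Relation.ReflTransGen.refl
        | tail _ hbc ih =>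
          refine ih.tail ?_
          simp only [hbc, if_true]
          exact hk _ _ hbc)
      S hall (by
        rw [hS]
        refine Submodule.span_mono ?_
        rintro _ ⟨i, j, -, rfl⟩
        exact ⟨i, j, rfl⟩) hdef x₀ hx₀
    have hconv : ∀ x : Fin n → ℝ,
        (∑ i, ∑ j ∈ Finset.univ.filter (fun j => E i j),
            k i j • (∏ l, x l ^ y i l) • (y j - y i))
        = ∑ j, DefOne.lap (fun i j => if E i j then k i j else 0)
            (fun i => ∏ l, x l ^ y i l) j • y j := by
      intro x
      funext q
      have h := DefOne.lap_pair (fun i j => if E i j then k i j else 0)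
            (fun i => ∏ l, x l ^ y i l) (fun j => y j q)
      simp only [Finset.sum_apply, Pi.smul_apply, smul_eq_mul, Pi.sub_apply]
      rw [h]
      refine Finset.sum_congr rfl fun i _ => ?_
      rw [Finset.sum_filter]
      refine Finset.sum_congr rfl fun j _ => ?_
      by_cases hij : E i j
      · simp [hij, mul_assoc]
      · simp [hij]
    simp only [hconv]
    exact hmain
end

section
/- Let (G, k) be a mass-action system whose reaction network G is weakly reversible and has a single linkage class, with vertices y_1, …, y_m ∈ ℝ^n and positive rate constants k. Then (G, k) is persistent: every solution x : [0, ∞) → ℝ^n_{>0} of dx/dt = Σ_{y_i→y_j ∈ E} k_{ij} x^{y_i}(y_j − y_i) with x(0) ∈ ℝ^n_{>0} satisfies liminf_{t→∞} x_i(t) > 0 for every coordinate i ∈ {1, …, n}. -/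
open Finset Filter

namespace WRP

lemma exists_pos_le {ι : Type*} [Fintype ι] (f : ι → ℝ) (hf : ∀ i, 0 < f i) :
    ∃ e : ℝ, 0 < e ∧ ∀ i, e ≤ f i := by
  have h0 : ∀ i ∈ (Finset.univ : Finset ι), 0 ≤ (f i)⁻¹ := fun i _ => (inv_pos.2 (hf i)).le
  have hS : 0 ≤ ∑ i, (f i)⁻¹ := Finset.sum_nonneg h0
  refine ⟨(1 + ∑ i, (f i)⁻¹)⁻¹, by positivity, fun i => ?_⟩
  have h1 : (f i)⁻¹ ≤ ∑ i, (f i)⁻¹ := Finset.single_le_sum h0 (Finset.mem_univ i)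
  exact inv_le_of_inv_le₀ (hf i) (by linarith)

lemma exists_ge {ι : Type*} [Fintype ι] (f : ι → ℝ) :
    ∃ e : ℝ, 0 ≤ e ∧ ∀ i, f i ≤ e := by
  have h0 : ∀ i ∈ (Finset.univ : Finset ι), 0 ≤ |f i| := fun i _ => abs_nonneg _
  exact ⟨∑ i, |f i|, Finset.sum_nonneg h0, fun i =>
    (le_abs_self _).trans (Finset.single_le_sum h0 (Finset.mem_univ i))⟩

/-- Along a strongly connected graph, controlled increments give a uniform bound. -/
lemma path_bound {m : ℕ} (E : Fin m → Fin m → Prop)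
    (hconn : ∀ i j : Fin m, Relation.ReflTransGen E i j) (D : ℝ) (hD : 0 ≤ D) :
    ∃ C : ℝ, ∀ v : Fin m → ℝ, (∃ p, v p = 0) →
      (∀ i j, E i j → Real.exp (-v i) * (v j - v i) ≤ D) → ∀ q, v q ≤ C := by
  have key : ∀ p q : Fin m, ∃ C : ℝ, ∀ v : Fin m → ℝ, v p = 0 →
      (∀ i j, E i j → Real.exp (-v i) * (v j - v i) ≤ D) → v q ≤ C := by
    intro p q
    induction hconn p q with
    | refl => exact ⟨0, fun v hv _ => hv.le⟩
    | @tail b c _ hbc ih =>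
      obtain ⟨C, hC⟩ := ih
      refine ⟨C + D * Real.exp C, fun v hv hE => ?_⟩
      have h1 := hC v hv hE
      have h2 := hE b c hbc
      have h3 : Real.exp (v b) * Real.exp (-v b) = 1 := by
        rw [← Real.exp_add]; simp
      have h4 : v c - v b ≤ D * Real.exp (v b) := by
        have := mul_le_mul_of_nonneg_left h2 (Real.exp_pos (v b)).le
        rw [← mul_assoc, h3] at this
        linarith
      have h5 : D * Real.exp (v b) ≤ D * Real.exp C :=
        mul_le_mul_of_nonneg_left (Real.exp_le_exp.2 h1) hD
      linarith
  choose C hC using key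
  obtain ⟨e, _, he⟩ := exists_ge (fun pq : Fin m × Fin m => C pq.1 pq.2)
  refine ⟨e, fun v ⟨p, hp⟩ hE q => (hC p q v hp hE).trans (he (p, q))⟩

/-- Negativity of the entropy production when the spread of `u` is large. -/
lemma spread_neg {m : ℕ} (E : Fin m → Fin m → Prop) [DecidableRel E]
    (hconn : ∀ i j : Fin m, Relation.ReflTransGen E i j) (a b : ℝ) (ha : 0 < a) (hb : 0 ≤ b) :
    ∃ C : ℝ, ∀ (κ : Fin m → Fin m → ℝ) (u : Fin m → ℝ),
      (∀ i j, E i j → a ≤ κ i j ∧ κ i j ≤ b) → (∃ p q, C < u p - u q) →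
      ∑ i, ∑ j ∈ Finset.univ.filter (fun j => E i j),
        κ i j * (Real.exp (u i) * (u j - u i)) ≤ 0 := by
  obtain ⟨C, hC⟩ := path_bound E hconn (b * m * m / a) (by positivity)
  refine ⟨C, fun κ u hκ ⟨p, q, hpq⟩ => ?_⟩
  obtain ⟨p0, -, hp0⟩ := Finset.exists_max_image Finset.univ u ⟨p, Finset.mem_univ p⟩
  have hedge : ∃ i j, E i j ∧ b * m * m / a < Real.exp (-(u p0 - u i)) * (u i - u j) := by
    by_contra hcon
    push Not at hcon
    have := hC (fun i => u p0 - u i) ⟨p0, by simp⟩ (fun i j hij => by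
      have := hcon i j hij
      have h : (u p0 - u j - (u p0 - u i)) = u i - u j := by ring
      rw [h]; exact this) q
    have h2 := hp0 p (Finset.mem_univ p)
    linarith
  obtain ⟨i0, j0, hE0, h0⟩ := hedge
  set T : Fin m × Fin m → ℝ := fun ij => if E ij.1 ij.2 then
    κ ij.1 ij.2 * (Real.exp (-(u p0 - u ij.1)) * (u ij.2 - u ij.1)) else 0 with hT
  have hsum : ∑ i, ∑ j ∈ Finset.univ.filter (fun j => E i j),
        κ i j * (Real.exp (u i) * (u j - u i)) = Real.exp (u p0) * ∑ ij, T ij := by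
    rw [Fintype.sum_prod_type, Finset.mul_sum]
    refine Finset.sum_congr rfl fun i _ => ?_
    rw [Finset.mul_sum, Finset.sum_filter]
    refine Finset.sum_congr rfl fun j _ => ?_
    simp only [hT]
    split_ifs with h
    · have : Real.exp (u i) = Real.exp (u p0) * Real.exp (-(u p0 - u i)) := by
        rw [← Real.exp_add]; congr 1; ring
      rw [this]; ring
    · simp
  have hTb : ∀ ij, T ij ≤ b := by
    rintro ⟨i, j⟩
    simp only [hT]
    split_ifs with h
    · obtain ⟨h1, h2⟩ := hκ i j h
      have hi := hp0 i (Finset.mem_univ i)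
      have hj := hp0 j (Finset.mem_univ j)
      have h3 : Real.exp (-(u p0 - u i)) * (u j - u i) ≤ 1 := by
        have e1 : u p0 - u i ≤ Real.exp (u p0 - u i) := by
          have := Real.add_one_le_exp (u p0 - u i); linarith
        calc Real.exp (-(u p0 - u i)) * (u j - u i)
            ≤ Real.exp (-(u p0 - u i)) * Real.exp (u p0 - u i) :=
              mul_le_mul_of_nonneg_left (by linarith) (Real.exp_pos _).le
          _ = 1 := by rw [← Real.exp_add]; simp
      calc κ i j * (Real.exp (-(u p0 - u i)) * (u j - u i)) ≤ κ i j * 1 :=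
            mul_le_mul_of_nonneg_left h3 (by linarith)
        _ ≤ b := by linarith
    · exact hb
  have hT0 : T (i0, j0) ≤ - (b * m * m) := by
    simp only [hT, if_pos hE0]
    obtain ⟨h1, h2⟩ := hκ i0 j0 hE0
    rw [div_lt_iff₀ ha] at h0
    have hnn : 0 ≤ b * m * m := by positivity
    have hpos : 0 ≤ Real.exp (-(u p0 - u i0)) * (u i0 - u j0) := by
      by_contra hneg
      push Not at hneg
      have := mul_neg_of_neg_of_pos hneg ha
      linarith
    have := mul_le_mul_of_nonneg_right h1 hpos
    have h5 : κ i0 j0 * (Real.exp (-(u p0 - u i0)) * (u j0 - u i0))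
      = -(κ i0 j0 * (Real.exp (-(u p0 - u i0)) * (u i0 - u j0))) := by ring
    rw [h5]
    linarith
  rw [hsum]
  refine mul_nonpos_of_nonneg_of_nonpos (Real.exp_pos _).le ?_
  rw [← Finset.add_sum_erase _ _ (Finset.mem_univ (i0, j0))]
  have h6 : ∑ ij ∈ Finset.univ.erase (i0, j0), T ij ≤ b * m * m := by
    calc ∑ ij ∈ Finset.univ.erase (i0, j0), T ij ≤ ∑ ij ∈ Finset.univ.erase (i0, j0), b :=
          Finset.sum_le_sum fun ij _ => hTb ij
      _ ≤ ∑ ij : Fin m × Fin m, b :=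
          Finset.sum_le_sum_of_subset_of_nonneg (Finset.erase_subset _ _) fun _ _ _ => hb
      _ = b * m * m := by simp; ring
  linarith

/-- A bounded image under a linear map has a bounded preimage. -/
lemma bounded_correction {n m : ℕ} (y : Fin m → Fin n → ℝ) (W : Finset (Fin n)) (C : ℝ) :
    ∃ B : ℝ, 0 ≤ B ∧ ∀ z : Fin n → ℝ,
      (∀ p q, ∑ l ∈ W, y p l * z l - ∑ l ∈ W, y q l * z l ≤ C) →
      ∃ b : Fin n → ℝ, (∀ l, |b l| ≤ B) ∧
        ∀ p q, ∑ l ∈ W, (y p l - y q l) * (z l - b l) = 0 := by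
  let A : (Fin n → ℝ) →ₗ[ℝ] (Fin m × Fin m → ℝ) :=
    LinearMap.pi fun pq => ∑ l ∈ W, (y pq.1 l - y pq.2 l) • LinearMap.proj l
  have hA : ∀ z pq, A z pq = ∑ l ∈ W, (y pq.1 l - y pq.2 l) * z l := by
    intro z pq
    simp [A, LinearMap.sum_apply]
  obtain ⟨g, hg⟩ := A.rangeRestrict.exists_rightInverse_of_surjective A.range_rangeRestrict
  obtain ⟨K, hK, hgK⟩ := (LinearMap.toContinuousLinearMap g).bound
  refine ⟨K * |C|, by positivity, fun z hz => ⟨g (A.rangeRestrict z), fun l => ?_, fun p q => ?_⟩⟩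
  · have h1 := hgK (A.rangeRestrict z)
    have h2 : ‖A.rangeRestrict z‖ ≤ |C| := by
      change ‖A z‖ ≤ |C|
      rw [pi_norm_le_iff_of_nonneg (abs_nonneg _)]
      rintro ⟨p, q⟩
      rw [hA, Real.norm_eq_abs]
      have h3 := hz p q
      have h4 := hz q p
      have h5 := le_abs_self C
      simp only [sub_mul, Finset.sum_sub_distrib]
      rw [abs_le]; constructor <;> linarith
    calc |g (A.rangeRestrict z) l| ≤ ‖g (A.rangeRestrict z)‖ := norm_le_pi_norm (g (A.rangeRestrict z)) l
      _ ≤ K * ‖A.rangeRestrict z‖ := h1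
      _ ≤ K * |C| := mul_le_mul_of_nonneg_left h2 hK.le
  · have h1 : A.rangeRestrict (g (A.rangeRestrict z)) = A.rangeRestrict z :=
      LinearMap.congr_fun hg (A.rangeRestrict z)
    have h2 : A (g (A.rangeRestrict z)) = A z := by
      have := congrArg Subtype.val h1
      simpa using this
    have h3 := congrFun h2 (p, q)
    rw [hA, hA] at h3
    simp only [mul_sub, Finset.sum_sub_distrib]
    simp only at h3
    linarith

/-- Barrier argument. -/
lemma barrier (f f' h : ℝ → ℝ) (K : ℝ)
    (hf : ∀ t ∈ Set.Ici (0 : ℝ), HasDerivWithinAt f (f' t) (Set.Ici 0) t)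
    (hh : ContinuousOn h (Set.Ici 0)) (h0 : 0 ≤ h 0)
    (hneg : ∀ t, 0 ≤ t → h t < 0 → f' t ≤ 0)
    (hzero : ∀ t, 0 ≤ t → h t = 0 → f t ≤ K) :
    ∀ t, 0 ≤ t → h t < 0 → f t ≤ K := by
  intro t ht hht
  have hsub : Set.Icc 0 t ⊆ Set.Ici (0 : ℝ) := Set.Icc_subset_Ici_self
  have hcomp : IsCompact (Set.Icc 0 t ∩ h ⁻¹' Set.Ici 0) :=
    isCompact_Icc.of_isClosed_subset
      ((hh.mono hsub).preimage_isClosed_of_isClosed isClosed_Icc isClosed_Ici)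
      Set.inter_subset_left
  obtain ⟨s, hs⟩ := hcomp.exists_isGreatest ⟨0, ⟨le_refl 0, ht⟩, h0⟩
  obtain ⟨⟨⟨hs0, hst⟩, hhs⟩, hmax⟩ := hs
  have hhs' : 0 ≤ h s := hhs
  have hafter : ∀ r, s < r → r ≤ t → h r < 0 := by
    intro r h1 h2
    by_contra hc
    push Not at hc
    have := hmax ⟨⟨hs0.trans h1.le, h2⟩, hc⟩
    linarith
  have hsz : h s = 0 := by
    have hcont : ContinuousOn h (Set.Icc s t) := hh.mono fun r hr => hs0.trans hr.1
    obtain ⟨r, hr, hr0⟩ := intermediate_value_Icc' hst hcont ⟨hht.le, hhs'⟩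
    rcases eq_or_lt_of_le hr.1 with h1 | h1
    · rw [h1]; exact hr0
    · have := hafter r h1 hr.2
      linarith
  have hcf : ContinuousOn f (Set.Icc s t) := fun r hr =>
    ((hf r (hs0.trans hr.1)).continuousWithinAt).mono fun q hq => hs0.trans hq.1
  have hder : ∀ r ∈ interior (Set.Icc s t), HasDerivAt f (f' r) r := by
    intro r hr
    rw [interior_Icc] at hr
    have : 0 < r := lt_of_le_of_lt hs0 hr.1
    exact (hf r this.le).hasDerivAt (Ici_mem_nhds this)
  have hanti : AntitoneOn f (Set.Icc s t) := by
    refine antitoneOn_of_deriv_nonpos (convex_Icc s t) hcf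
      (fun r hr => (hder r hr).differentiableAt.differentiableWithinAt) fun r hr => ?_
    rw [(hder r hr).deriv]
    rw [interior_Icc] at hr
    exact hneg r (hs0.trans hr.1.le) (hafter r hr.1 hr.2.le)
  exact (hanti ⟨le_refl s, hst⟩ ⟨hst, le_refl t⟩ hst).trans (hzero s hs0 hsz)

/-- The tangent-line inequality for `x log x - x`. -/
lemma tangent (x A : ℝ) (hx : 0 < x) : A * x - Real.exp A ≤ x * Real.log x - x := by
  have h1 : Real.exp A = x * Real.exp (A - Real.log x) := by
    rw [Real.exp_sub, Real.exp_log hx]; field_simp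
  have h2 := Real.add_one_le_exp (A - Real.log x)
  have h3 := mul_le_mul_of_nonneg_left h2 hx.le
  rw [h1]
  linarith

lemma term_bound (x x0 b B : ℝ) (hx : 0 < x) (hx0 : 0 < x0) (hb : |b| ≤ B) :
    (x * Real.log x - x) / 2 - (Real.exp (2 * B) / 2 + (x0 * Real.log x0 - x0) + B * x0)
      ≤ (Real.log x - b) * (x - x0) := by
  obtain ⟨hb1, hb2⟩ := abs_le.1 hb
  have h1 := tangent x (2 * B) hx
  have h2 := tangent x0 (Real.log x) hx0
  rw [Real.exp_log hx] at h2
  have h3 : b * x ≤ B * x := mul_le_mul_of_nonneg_right hb2 hx.le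
  have h4 : -B * x0 ≤ b * x0 := mul_le_mul_of_nonneg_right hb1 hx0.le
  nlinarith

section
variable {n m : ℕ} (y : Fin m → Fin n → ℝ) (E : Fin m → Fin m → Prop) [DecidableRel E]
  (k : Fin m → Fin m → ℝ)

/-- The mass-action vector field. -/
noncomputable def field (z : Fin n → ℝ) : Fin n → ℝ :=
  ∑ i, ∑ j ∈ Finset.univ.filter (fun j => E i j),
            k i j • (∏ l, z l ^ y i l) • (y j - y i)

lemma field_sum (W : Finset (Fin n)) (c z : Fin n → ℝ) :
    ∑ l ∈ W, c l * field y E k z l = ∑ i, ∑ j ∈ Finset.univ.filter (fun j => E i j),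
      k i j * ((∏ l, z l ^ y i l) * (∑ l ∈ W, y j l * c l - ∑ l ∈ W, y i l * c l)) := by
  simp only [field, Finset.sum_apply, Pi.smul_apply, Pi.sub_apply, smul_eq_mul, Finset.mul_sum]
  rw [Finset.sum_comm]
  refine Finset.sum_congr rfl fun i _ => ?_
  rw [Finset.sum_comm]
  refine Finset.sum_congr rfl fun j _ => ?_
  rw [← Finset.sum_sub_distrib, Finset.mul_sum, Finset.mul_sum]
  refine Finset.sum_congr rfl fun l _ => ?_
  ring

lemma field_log (W : Finset (Fin n)) (z : Fin n → ℝ) (hz : ∀ l, 0 < z l) :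
    ∑ l ∈ W, Real.log (z l) * field y E k z l
      = ∑ i, ∑ j ∈ Finset.univ.filter (fun j => E i j),
      (k i j * Real.exp (∑ l ∈ Wᶜ, y i l * Real.log (z l))) *
        (Real.exp (∑ l ∈ W, y i l * Real.log (z l)) *
          (∑ l ∈ W, y j l * Real.log (z l) - ∑ l ∈ W, y i l * Real.log (z l))) := by
  rw [field_sum]
  refine Finset.sum_congr rfl fun i _ => Finset.sum_congr rfl fun j _ => ?_
  have : ∏ l, z l ^ y i l = Real.exp (∑ l ∈ Wᶜ, y i l * Real.log (z l)) *
      Real.exp (∑ l ∈ W, y i l * Real.log (z l)) := by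
    rw [← Real.exp_add, Finset.sum_compl_add_sum, Real.exp_sum]
    refine Finset.prod_congr rfl fun l _ => ?_
    rw [Real.rpow_def_of_pos (hz l), mul_comm]
  rw [this]; ring

/-- Main dichotomy: either the `W`-entropy is nonincreasing, or the `W`-part is
close to being log-orthogonal to the stoichiometric directions. -/
lemma dichotomy (hconn : ∀ i j : Fin m, Relation.ReflTransGen E i j)
    (hk : ∀ i j, E i j → 0 < k i j) (W : Finset (Fin n)) (r R : ℝ) (hr : 0 < r) :
    ∃ B : ℝ, 0 ≤ B ∧ ∀ z : Fin n → ℝ, (∀ l, 0 < z l) → (∀ l, l ∉ W → r ≤ z l ∧ z l ≤ R) →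
      ∑ l ∈ W, Real.log (z l) * field y E k z l ≤ 0 ∨
      ∃ b : Fin n → ℝ, (∀ l, |b l| ≤ B) ∧
        ∀ p q, ∑ l ∈ W, (y p l - y q l) * (Real.log (z l) - b l) = 0 := by
  obtain ⟨a, ha, hak⟩ := exists_pos_le
    (fun ij : Fin m × Fin m => if E ij.1 ij.2 then k ij.1 ij.2 else 1) (by
      rintro ⟨i, j⟩
      simp only
      split_ifs with h
      · exact hk i j h
      · exact one_pos)
  obtain ⟨b, hb, hbk⟩ := exists_ge (fun ij : Fin m × Fin m => k ij.1 ij.2)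
  set L := |Real.log r| + |Real.log R|
  have hL : 0 ≤ L := by positivity
  obtain ⟨S, hS, hSy⟩ := exists_ge (fun i : Fin m => ∑ l ∈ Wᶜ, |y i l| * L)
  obtain ⟨C, hC⟩ := spread_neg E hconn (a * Real.exp (-S)) (b * Real.exp S)
    (by positivity) (by positivity)
  obtain ⟨B, hB, hBz⟩ := bounded_correction y W C
  refine ⟨B, hB, fun z hz hzW => ?_⟩
  by_cases hsp : ∃ p q, C < ∑ l ∈ W, y p l * Real.log (z l) - ∑ l ∈ W, y q l * Real.log (z l)
  · left
    rw [field_log y E k W z hz]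
    refine hC _ (fun i => ∑ l ∈ W, y i l * Real.log (z l)) (fun i j hij => ?_) hsp
    have habs : |∑ l ∈ Wᶜ, y i l * Real.log (z l)| ≤ S := by
      refine (Finset.abs_sum_le_sum_abs _ _).trans (le_trans ?_ (hSy i))
      refine Finset.sum_le_sum fun l hl => ?_
      rw [abs_mul]
      refine mul_le_mul_of_nonneg_left ?_ (abs_nonneg _)
      obtain ⟨h1, h2⟩ := hzW l (by simpa using hl)
      have h3 := Real.log_le_log hr h1
      have h4 := Real.log_le_log (hz l) h2
      have h5 := neg_abs_le (Real.log r)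
      have h6 := le_abs_self (Real.log R)
      have h7 := abs_nonneg (Real.log r)
      have h8 := abs_nonneg (Real.log R)
      rw [abs_le]
      constructor <;> simp only [L] <;> linarith
    obtain ⟨h1, h2⟩ := abs_le.1 habs
    have h3 := hak (i, j)
    simp only [if_pos hij] at h3
    have h4 := hbk (i, j)
    simp only at h4
    exact ⟨mul_le_mul h3 (Real.exp_le_exp.2 h1) (Real.exp_pos _).le (hk i j hij).le,
      mul_le_mul h4 (Real.exp_le_exp.2 h2) (Real.exp_pos _).le hb⟩
  · right
    push Not at hsp
    exact hBz (fun l => Real.log (z l)) hsp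

variable (x : ℝ → Fin n → ℝ) (hpos : ∀ t ∈ Set.Ici (0 : ℝ), ∀ l, 0 < x t l)
  (hx : ∀ t ∈ Set.Ici (0 : ℝ), HasDerivWithinAt x (field y E k (x t)) (Set.Ici 0) t)

include hx in
lemma conserved (W : Finset (Fin n)) (c : Fin n → ℝ)
    (hc : ∀ p q, ∑ l ∈ W, (y p l - y q l) * c l = 0) (t : ℝ) (ht : 0 ≤ t) :
    ∑ l ∈ W, c l * (x t l - x 0 l) = 0 := by
  have hd : ∀ s ∈ Set.Ici (0 : ℝ), HasDerivWithinAt (fun s => ∑ l ∈ W, c l * x s l) 0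
      (Set.Ici 0) s := by
    intro s hs
    have h1 : HasDerivWithinAt (fun s => ∑ l ∈ W, c l * x s l)
        (∑ l ∈ W, c l * field y E k (x s) l) (Set.Ici 0) s :=
      HasDerivWithinAt.fun_sum fun l _ => ((hasDerivWithinAt_pi.1 (hx s hs) l).const_mul (c l))
    rw [field_sum] at h1
    convert h1 using 1
    symm
    refine Finset.sum_eq_zero fun i _ => Finset.sum_eq_zero fun j _ => ?_
    have := hc j i
    simp only [sub_mul, Finset.sum_sub_distrib] at this
    rw [this]; simp
  have := (convex_Ici (0 : ℝ)).is_const_of_fderivWithin_eq_zero (𝕜 := ℝ)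
    (f := fun s => ∑ l ∈ W, c l * x s l)
    (fun s hs => (hd s hs).differentiableWithinAt)
    (fun s hs => by
      have h := (hd s hs).hasFDerivWithinAt.fderivWithin (uniqueDiffOn_Ici 0 s hs)
      rw [h]; ext; simp)
    (Set.mem_Ici.2 ht) (Set.mem_Ici.2 le_rfl)
  simp only [mul_sub, Finset.sum_sub_distrib]
  linarith

include hpos hx in
lemma deriv_entropy (W : Finset (Fin n)) (t : ℝ) (ht : t ∈ Set.Ici (0 : ℝ)) :
    HasDerivWithinAt (fun s => ∑ l ∈ W, (x s l * Real.log (x s l) - x s l))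
      (∑ l ∈ W, Real.log (x t l) * field y E k (x t) l) (Set.Ici 0) t := by
  refine HasDerivWithinAt.fun_sum fun l _ => ?_
  have h1 := hasDerivWithinAt_pi.1 (hx t ht) l
  have h2 := (Real.hasDerivAt_mul_log (hpos t ht l).ne').comp_hasDerivWithinAt t h1
  have h3 := h2.sub h1
  have h4 : (Real.log (x t l) + 1) * field y E k (x t) l - field y E k (x t) l
      = Real.log (x t l) * field y E k (x t) l := by ring
  rw [h4] at h3
  exact h3

include hpos hx in
lemma bounded (hconn : ∀ i j : Fin m, Relation.ReflTransGen E i j)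
    (hk : ∀ i j, E i j → 0 < k i j) :
    ∃ R : ℝ, ∀ t, 0 ≤ t → ∀ l, x t l ≤ R := by
  obtain ⟨B, hB, hdi⟩ := dichotomy y E k hconn hk Finset.univ 1 1 one_pos
  set V : ℝ → ℝ := fun s => ∑ l, (x s l * Real.log (x s l) - x s l) with hV
  set M : ℝ := 2 * ∑ l, (Real.exp (2 * B) / 2 + (x 0 l * Real.log (x 0 l) - x 0 l) + B * x 0 l)
  set M' := max M (V 0)
  have hVM : ∀ t, 0 ≤ t → V t ≤ M' := by
    have hb := barrier V (fun t => ∑ l, Real.log (x t l) * field y E k (x t) l)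
      (fun t => M' - V t) M' (fun t ht => deriv_entropy y E k x hpos hx Finset.univ t ht)
      (continuousOn_const.sub fun t ht =>
        (deriv_entropy y E k x hpos hx Finset.univ t ht).continuousWithinAt)
      (sub_nonneg.2 (le_max_right _ _)) ?_ (fun t _ h => by linarith)
    · intro t ht
      by_contra hc
      push Not at hc
      have := hb t ht (by linarith)
      linarith
    · intro t ht hlt
      rcases hdi (x t) (hpos t ht) (fun l hl => absurd (Finset.mem_univ l) hl) with h | h
      · exact h
      · exfalso
        obtain ⟨b, hbB, hb⟩ := h
        have hc := conserved y E k x hx Finset.univ (fun l => Real.log (x t l) - b l) hb t ht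
        have h1 := Finset.sum_le_sum fun l (_ : l ∈ Finset.univ) =>
          term_bound (x t l) (x 0 l) (b l) B (hpos t ht l) (hpos 0 (Set.mem_Ici.2 le_rfl) l) (hbB l)
        rw [hc, Finset.sum_sub_distrib, ← Finset.sum_div] at h1
        have h2 : M ≤ M' := le_max_left _ _
        simp only [M, hV] at h2 hlt
        linarith
  refine ⟨M' + n * Real.exp 1, fun t ht l => ?_⟩
  have h1 : ∑ l, (x t l - Real.exp 1) ≤ V t :=
    Finset.sum_le_sum fun l _ => by
      have := tangent (x t l) 1 (hpos t ht l)
      linarith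
  rw [Finset.sum_sub_distrib] at h1
  simp at h1
  have h2 : x t l ≤ ∑ l, x t l :=
    Finset.single_le_sum (f := fun l => x t l) (fun l _ => (hpos t ht l).le) (Finset.mem_univ l)
  have := hVM t ht
  linarith

include hpos hx in
lemma face_repel (hconn : ∀ i j : Fin m, Relation.ReflTransGen E i j)
    (hk : ∀ i j, E i j → 0 < k i j) (d : ℕ) :
    ∀ W : Finset (Fin n), W.Nonempty → Wᶜ.card = d →
      ∃ ε : ℝ, 0 < ε ∧ ∀ t, 0 ≤ t → ∃ l ∈ W, ε ≤ x t l := by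
  obtain ⟨R, hR⟩ := bounded y E k x hpos hx hconn hk
  induction d using Nat.strong_induction_on with
  | _ d ih =>
  intro W hW hWd
  -- uniform lower bound coming from larger faces
  have hsup : ∀ j : Fin n, ∃ e : ℝ, 0 < e ∧
      (j ∉ W → ∀ t, 0 ≤ t → ∃ l ∈ insert j W, e ≤ x t l) := by
    intro j
    by_cases hj : j ∈ W
    · exact ⟨1, one_pos, fun h => absurd hj h⟩
    · have hcard : (insert j W)ᶜ.card < d := by
        rw [← hWd]
        refine Finset.card_lt_card ?_
        rw [Finset.compl_ssubset_compl]
        exact Finset.ssubset_insert hj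
      obtain ⟨e, he, h⟩ := ih _ hcard (insert j W) (Finset.insert_nonempty _ _) rfl
      exact ⟨e, he, fun _ => h⟩
  choose e he hesup using hsup
  obtain ⟨r, hr, hre⟩ := exists_pos_le e he
  obtain ⟨B, hB, hdi⟩ := dichotomy y E k hconn hk W r R hr
  have hx0 := hpos 0 (Set.mem_Ici.2 le_rfl)
  obtain ⟨q, hq, hqx⟩ := exists_pos_le (x 0) hx0
  set δ : ℝ := min (min r q) (min (Real.exp (-B)) (1 / 2)) with hδ
  have hδ0 : 0 < δ := lt_min (lt_min hr hq) (lt_min (Real.exp_pos _) (by norm_num))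
  have hδr : δ ≤ r := (min_le_left _ _).trans (min_le_left _ _)
  have hδq : δ ≤ q := (min_le_left _ _).trans (min_le_right _ _)
  have hδB : δ ≤ Real.exp (-B) := (min_le_right _ _).trans (min_le_left _ _)
  have hδ1 : δ ≤ 1 / 2 := (min_le_right _ _).trans (min_le_right _ _)
  set K : ℝ := δ * Real.log δ - δ with hK
  have hφ : ∀ z : ℝ, 0 < z → z ≤ 1 → z * Real.log z - z < 0 := by
    intro z h0 h1
    have := mul_nonpos_of_nonneg_of_nonpos h0.le (Real.log_nonpos h0.le h1)
    linarith
  have hK0 : K < 0 := hφ δ hδ0 (by linarith)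
  have hcontx : ∀ l, ContinuousOn (fun t => x t l) (Set.Ici 0) := fun l t ht =>
    (hasDerivWithinAt_pi.1 (hx t ht) l).continuousWithinAt
  have hbar := barrier (fun s => ∑ l ∈ W, (x s l * Real.log (x s l) - x s l))
    (fun t => ∑ l ∈ W, Real.log (x t l) * field y E k (x t) l)
    (fun t => W.sup' hW (fun l => x t l) - δ) K
    (fun t ht => deriv_entropy y E k x hpos hx W t ht)
    ((ContinuousOn.finset_sup'_apply hW fun l _ => hcontx l).sub continuousOn_const)
    (by
      have ⟨l, hl⟩ := id hW
      have h1 := Finset.le_sup' (fun l => x 0 l) hl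
      have h2 := hqx l
      linarith)
    ?_ ?_
  · -- conclude
    have hcard : 0 < (W.card : ℝ) := by exact_mod_cast hW.card_pos
    have hcont : Filter.Tendsto (fun z : ℝ => z * Real.log z - z) (nhds 0) (nhds 0) := by
      have hc : Continuous (fun z : ℝ => z * Real.log z - z) :=
        Real.continuous_mul_log.sub continuous_id
      simpa using hc.tendsto (0 : ℝ)
    have hev : ∀ᶠ z in nhds (0 : ℝ), K / W.card < z * Real.log z - z :=
      hcont.eventually (lt_mem_nhds (div_neg_of_neg_of_pos hK0 hcard))
    obtain ⟨η, hη, hηK⟩ := Metric.eventually_nhds_iff.1 hev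
    refine ⟨min η δ, lt_min hη hδ0, fun t ht => ?_⟩
    by_contra hc
    push Not at hc
    have h1 := hbar t ht (by
      have : W.sup' hW (fun l => x t l) < δ := by
        rw [Finset.sup'_lt_iff]
        exact fun l hl => (hc l hl).trans_le (min_le_right _ _)
      linarith)
    have h2 : ∑ l ∈ W, K / W.card < ∑ l ∈ W, (x t l * Real.log (x t l) - x t l) := by
      refine Finset.sum_lt_sum_of_nonempty hW fun l hl => hηK ?_
      rw [Real.dist_eq, sub_zero, abs_of_pos (hpos t ht l)]
      exact (hc l hl).trans_le (min_le_left _ _)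
    rw [Finset.sum_const, nsmul_eq_mul, mul_div_cancel₀ _ hcard.ne'] at h2
    linarith
  · -- the entropy decreases near the face
    intro t ht hlt
    have hlt' : W.sup' hW (fun l => x t l) < δ := by simpa using hlt
    rw [Finset.sup'_lt_iff] at hlt'
    have hout : ∀ l, l ∉ W → r ≤ x t l ∧ x t l ≤ R := by
      intro j hj
      refine ⟨?_, hR t ht j⟩
      obtain ⟨l, hl, hel⟩ := hesup j hj t ht
      rcases Finset.mem_insert.1 hl with h | h
      · rw [h] at hel; exact (hre j).trans hel
      · have := hlt' l h
        have := hre j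
        linarith
    rcases hdi (x t) (hpos t ht) hout with h | h
    · exact h
    · exfalso
      obtain ⟨b, hbB, hb⟩ := h
      have hc := conserved y E k x hx W (fun l => Real.log (x t l) - b l) hb t ht
      have : 0 < ∑ l ∈ W, (Real.log (x t l) - b l) * (x t l - x 0 l) := by
        refine Finset.sum_pos (fun l hl => ?_) hW
        have h1 := hlt' l hl
        have h2 := hqx l
        have h3 : Real.log (x t l) < -B := by
          rw [Real.log_lt_iff_lt_exp (hpos t ht l)]
          exact h1.trans_le hδB
        have h4 := (abs_le.1 (hbB l)).1
        exact mul_pos_of_neg_of_neg (by linarith) (by linarith)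
      linarith
  · intro t ht heq
    have heq' : W.sup' hW (fun l => x t l) = δ := by linarith
    obtain ⟨l0, hl0, hl0e⟩ := Finset.exists_mem_eq_sup' hW (fun l => x t l)
    have hle : ∀ l ∈ W, x t l ≤ δ := fun l hl => by
      rw [← heq']; exact Finset.le_sup' (fun l => x t l) hl
    have h1 : x t l0 = δ := by rw [← heq', hl0e]
    rw [← Finset.add_sum_erase _ _ hl0, h1]
    have : ∑ l ∈ W.erase l0, (x t l * Real.log (x t l) - x t l) ≤ 0 :=
      Finset.sum_nonpos fun l hl =>
        (hφ _ (hpos t ht l) ((hle l (Finset.mem_of_mem_erase hl)).trans (by linarith))).le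
    linarith

end

end WRP

/-- Let `(G, k)` be a mass-action system whose network is weakly
reversible and has a single linkage class (i.e. is strongly connected), with vertices
`y 1, …, y m ∈ ℝ^n` and positive rate constants `k`. Then `(G, k)` is persistent: every
positive solution `x` of the mass-action ODE on `[0, ∞)` satisfies
`liminf_{t→∞} x_l(t) > 0` for every coordinate `l`. -/
theorem weakly_reversible_single_linkage_persistent
    {n m : ℕ} (y : Fin m → Fin n → ℝ) (hy : Function.Injective y)
    (E : Fin m → Fin m → Prop) [DecidableRel E]
    (hE_noself : ∀ i, ¬ E i i)
    (hconn : ∀ i j : Fin m, Relation.ReflTransGen E i j)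
    (k : Fin m → Fin m → ℝ) (hk : ∀ i j, E i j → 0 < k i j) :
    ∀ x : ℝ → Fin n → ℝ,
      (∀ t ∈ Set.Ici (0 : ℝ), ∀ l, 0 < x t l) →
      (∀ t ∈ Set.Ici (0 : ℝ), HasDerivWithinAt x
          (∑ i, ∑ j ∈ Finset.univ.filter (fun j => E i j),
            k i j • (∏ l, x t l ^ y i l) • (y j - y i))
          (Set.Ici 0) t) →
      ∀ l : Fin n, 0 < liminf (fun t => x t l) atTop := by
  intro x hpos hx l
  have hx' : ∀ t ∈ Set.Ici (0 : ℝ), HasDerivWithinAt x (WRP.field y E k (x t)) (Set.Ici 0) t := hx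
  obtain ⟨R, hR⟩ := WRP.bounded y E k x hpos hx' hconn hk
  obtain ⟨ε, hε, h⟩ := WRP.face_repel y E k x hpos hx' hconn hk _ {l}
    (Finset.singleton_nonempty l) rfl
  refine lt_of_lt_of_le hε (le_liminf_of_le ?_ ?_)
  · refine Filter.IsBoundedUnder.isCoboundedUnder_ge ⟨R, ?_⟩
    rw [Filter.eventually_map]
    filter_upwards [eventually_ge_atTop (0 : ℝ)] with t ht using hR t ht l
  · filter_upwards [eventually_ge_atTop (0 : ℝ)] with t ht
    obtain ⟨l', hl', h'⟩ := h t ht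
    rw [Finset.mem_singleton] at hl'
    rwa [hl'] at h'
end
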